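/- arXiv:1404.7612 — 6 statements merged into one kernel-verified Lean document; each statement's English description precedes it below -/
import Mathlib

section
/- Let 1<α<2, n≥3, and let δ = α − αn/2. For every s>0 and every c>0, ∫_0^∞ e^{−st} t^{δ−1} Φ(−α/2, δ; −c t^{−α/2}) dt = s^{−δ} e^{−c s^{α/2}}. -/
open MeasureTheory Filter Set

/-- The Wright function `Φ(-α/2, δ; z) = ∑ z^m / (m! Γ(δ - αm/2))`, with the entire
reciprocal Gamma function (Mathlib's `Real.Gamma` vanishes at the poles). -/
noncomputable def wrightPhi (α δ z : ℝ) : ℝ :=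
  ∑' m : ℕ, z ^ m / ((m.factorial : ℝ) * Real.Gamma (δ - α * m / 2))

theorem integrable_exp_mul_sub_mul_exp {a b κ : ℝ} (ha : 0 < a) (hb : 0 < b) (hκ : 0 < κ) :
    Integrable fun x : ℝ => Real.exp (a * x - κ * Real.exp (b * x)) := by
  have hI : IntegrableOn (fun r : ℝ => r ^ (a - 1) * Real.exp (-κ * r ^ b)) (Ioi 0) := by
    refine Not.imp_symm integral_undef ?_
    rw [integral_rpow_mul_exp_neg_mul_rpow hb (by linarith) hκ]
    have := Real.Gamma_pos_of_pos (show 0 < (a - 1 + 1) / b by simp; positivity)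
    positivity
  rw [← Real.range_exp, ← image_univ, integrableOn_image_iff_integrableOn_abs_deriv_smul
    MeasurableSet.univ (fun x _ => (Real.hasDerivAt_exp x).hasDerivWithinAt)
    Real.exp_injective.injOn, integrableOn_univ] at hI
  refine hI.congr (Eventually.of_forall fun x => ?_)
  simp only [abs_of_pos (Real.exp_pos x), smul_eq_mul, ← Real.exp_mul, ← Real.exp_add]
  rw [mul_comm x b]
  congr 1
  ring

theorem integral_exp_mul_sub_mul_exp {a t : ℝ} (ha : 0 < a) (ht : 0 < t) :
    ∫ x : ℝ, Real.exp (a * x - t * Real.exp x) = t ^ (-a) * Real.Gamma a := by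
  have h := Real.integral_rpow_mul_exp_neg_mul_Ioi ha ht
  rw [← Real.range_exp, ← image_univ, integral_image_eq_integral_abs_deriv_smul
    MeasurableSet.univ (fun x _ => (Real.hasDerivAt_exp x).hasDerivWithinAt)
    Real.exp_injective.injOn, setIntegral_univ, one_div, Real.inv_rpow ht.le,
    ← Real.rpow_neg ht.le] at h
  rw [← h]
  congr 1 with x
  simp only [abs_of_pos (Real.exp_pos x), smul_eq_mul, ← Real.exp_mul, ← Real.exp_add]
  congr 1
  ring

theorem tendsto_exp_mul_sub_mul_exp_atTop (a : ℝ) {b κ : ℝ} (hb : 0 < b) (hκ : 0 < κ) :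
    Tendsto (fun x : ℝ => Real.exp (a * x - κ * Real.exp (b * x))) atTop (nhds 0) := by
  refine ((tendsto_rpow_mul_exp_neg_mul_atTop_nhds_zero (a / b) κ hκ).comp
    (Real.tendsto_exp_atTop.comp (tendsto_id.const_mul_atTop hb))).congr fun x => ?_
  simp only [Function.comp, id, ← Real.exp_mul, ← Real.exp_add]
  congr 1
  field_simp
  ring

theorem tendsto_exp_mul_sub_mul_exp_atBot {a κ : ℝ} (b : ℝ) (ha : 0 < a) (hκ : 0 < κ) :
    Tendsto (fun x : ℝ => Real.exp (a * x - κ * Real.exp (b * x))) atBot (nhds 0) := by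
  refine squeeze_zero (fun _ => (Real.exp_pos _).le) (fun x => Real.exp_le_exp.2 ?_)
    (Real.tendsto_exp_atBot.comp (tendsto_id.const_mul_atBot ha))
  simp only [id]
  have := Real.exp_pos (b * x)
  nlinarith

/-- The difference of the integrals of a holomorphic function over two horizontal segments of a
strip tends to zero when the function decays at both ends of the strip. -/
theorem tendsto_integral_sub_integral_strip {h : ℂ → ℂ} {θ : ℝ} {B : ℝ → ℝ}
    (hd : ∀ w : ℂ, w.im ∈ uIcc 0 θ → DifferentiableAt ℂ h w)
    (hB : ∀ x : ℝ, 1 ≤ |x| → ∀ y ∈ uIcc 0 θ, ‖h (x + y * Complex.I)‖ ≤ B x)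
    (hT : Tendsto B atTop (nhds 0)) (hb : Tendsto B atBot (nhds 0)) :
    Tendsto (fun R : ℝ => (∫ x : ℝ in -R..R, h x) - ∫ x : ℝ in -R..R, h (x + θ * Complex.I))
      atTop (nhds 0) := by
  have key : ∀ R : ℝ, (∫ x : ℝ in -R..R, h x) - ∫ x : ℝ in -R..R, h (x + θ * Complex.I) =
      Complex.I • (∫ y : ℝ in 0..θ, h ((-R : ℝ) + y * Complex.I)) -
      Complex.I • (∫ y : ℝ in 0..θ, h (R + y * Complex.I)) := by
    intro R
    have := Complex.integral_boundary_rect_eq_zero_of_differentiableOn h (-R : ℝ)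
      (R + θ * Complex.I) (fun w hw => (hd w ?_).differentiableWithinAt)
    · simp at this
      simp
      linear_combination this
    · have := hw.2
      simpa using this
  simp_rw [key]
  rw [tendsto_zero_iff_norm_tendsto_zero]
  refine squeeze_zero' (g := fun R => B (-R) * |θ| + B R * |θ|)
    (Eventually.of_forall fun _ => norm_nonneg _) ?_ ?_
  · filter_upwards [eventually_ge_atTop 1] with R hR
    refine (norm_sub_le _ _).trans ?_
    simp only [norm_smul, Complex.norm_I, one_mul]
    have e : |θ| = |θ - 0| := by simp
    rw [e]
    refine add_le_add ?_ ?_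
    · refine intervalIntegral.norm_integral_le_of_norm_le_const fun y hy => ?_
      exact hB (-R) (by rw [abs_neg, abs_of_nonneg] <;> linarith) y (uIoc_subset_uIcc hy)
    · refine intervalIntegral.norm_integral_le_of_norm_le_const fun y hy => ?_
      exact hB R (by rw [abs_of_nonneg] <;> linarith) y (uIoc_subset_uIcc hy)
  · simpa using ((hb.comp tendsto_neg_atTop_atBot).mul_const |θ|).add (hT.mul_const |θ|)

theorem norm_exp_mul_sub_mul_exp (a b C x y : ℝ) :
    ‖Complex.exp (a * (x + y * Complex.I) - C * Complex.exp (b * (x + y * Complex.I)))‖ =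
      Real.exp (a * x - C * Real.cos (b * y) * Real.exp (b * x)) := by
  rw [Complex.norm_exp]
  congr 1
  simp [Complex.exp_re]
  ring

theorem norm_exp_mul_sub_mul_exp_le (a : ℝ) {b C θ : ℝ} (x : ℝ) {y : ℝ} (hb : 0 < b) (hC : 0 < C)
    (hθ : |b * θ| < Real.pi / 2) (hy : y ∈ uIcc 0 θ) :
    ‖Complex.exp (a * (x + y * Complex.I) - C * Complex.exp (b * (x + y * Complex.I)))‖ ≤
      Real.exp (a * x - C * Real.cos (b * θ) * Real.exp (b * x)) := by
  rw [norm_exp_mul_sub_mul_exp]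
  have h1 : |y| ≤ |θ| := by simpa using abs_sub_left_of_mem_uIcc hy
  have h2 : Real.cos (b * θ) ≤ Real.cos (b * y) := by
    rw [← Real.cos_abs (b * θ), ← Real.cos_abs (b * y)]
    refine Real.cos_le_cos_of_nonneg_of_le_pi (abs_nonneg _) (by linarith [Real.pi_pos]) ?_
    rw [abs_mul, abs_mul]
    gcongr
  gcongr

theorem integrable_exp_mul_sub_mul_exp_line {a b C θ : ℝ} (ha : 0 < a) (hb : 0 < b) (hC : 0 < C)
    (hθ : |b * θ| < Real.pi / 2) :
    Integrable fun x : ℝ => Complex.exp (a * (x + θ * Complex.I) -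
      C * Complex.exp (b * (x + θ * Complex.I))) := by
  refine (integrable_exp_mul_sub_mul_exp (κ := C * Real.cos (b * θ)) ha hb
    (mul_pos hC (Real.cos_pos_of_mem_Ioo (abs_lt.1 hθ)))).mono'
    (Continuous.aestronglyMeasurable (by fun_prop)) (Eventually.of_forall fun x => ?_)
  exact norm_exp_mul_sub_mul_exp_le a x hb hC hθ right_mem_uIcc

/-- Euler's integral for the Gamma function along a rotated ray. -/
theorem integral_exp_mul_sub_mul_exp_line {a t ψ : ℝ} (ha : 0 < a) (ht : 0 < t)
    (hψ : |ψ| < Real.pi / 2) :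
    ∫ x : ℝ, Complex.exp (a * (x + ψ * Complex.I) - t * Complex.exp (x + ψ * Complex.I)) =
      ((t ^ (-a) * Real.Gamma a : ℝ) : ℂ) := by
  have hκ : 0 < t * Real.cos (1 * ψ) :=
    mul_pos ht (Real.cos_pos_of_mem_Ioo (by simpa using abs_lt.1 hψ))
  have h1 : |(1 : ℝ) * ψ| < Real.pi / 2 := by simpa using hψ
  have hlim := tendsto_integral_sub_integral_strip
    (h := fun w => Complex.exp (a * w - t * Complex.exp ((1 : ℝ) * w))) (θ := ψ)
    (fun w _ => by fun_prop)
    (fun x _ y hy => norm_exp_mul_sub_mul_exp_le a x one_pos ht h1 hy)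
    (tendsto_exp_mul_sub_mul_exp_atTop a one_pos hκ)
    (tendsto_exp_mul_sub_mul_exp_atBot 1 ha hκ)
  have i0 := integrable_exp_mul_sub_mul_exp_line (θ := 0) ha one_pos ht
    (by simpa using Real.pi_pos)
  have i1 := integrable_exp_mul_sub_mul_exp_line ha one_pos ht h1
  have l0 := intervalIntegral_tendsto_integral i0 tendsto_neg_atTop_atBot tendsto_id
  have l1 := intervalIntegral_tendsto_integral i1 tendsto_neg_atTop_atBot tendsto_id
  have l := l0.sub l1
  simp only [Complex.ofReal_zero, zero_mul, add_zero, Complex.ofReal_one, one_mul, id] at l hlim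
  have := tendsto_nhds_unique hlim l
  rw [← integral_exp_mul_sub_mul_exp ha ht, ← integral_complex_ofReal]
  push_cast
  linear_combination this

theorem exists_mul_exp_mul_le {b q : ℝ} (C : ℝ) (hb₀ : 0 < b) (hb₁ : b < 1) (hC : 0 < C)
    (hq : 0 < q) : ∃ M : ℝ, ∀ x : ℝ, C * Real.exp (b * x) ≤ q * Real.exp x + M := by
  -- weighted AM-GM applied to `exp x` and a constant `exp y`
  set y := Real.log (C / q) / (1 - b) with hy
  refine ⟨q * Real.exp y, fun x => ?_⟩
  have h := Real.geom_mean_le_arith_mean2_weighted hb₀.le (by linarith : 0 ≤ 1 - b)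
    (Real.exp_pos x).le (Real.exp_pos y).le (by ring)
  rw [← Real.exp_mul, ← Real.exp_mul, hy, div_mul_cancel₀ _ (by linarith), ← hy,
    Real.exp_log (by positivity), mul_comm x b] at h
  have e : C * Real.exp (b * x) = q * (Real.exp (b * x) * (C / q)) := by field_simp
  rw [e, ← mul_add]
  gcongr
  refine h.trans ?_
  nlinarith [Real.exp_pos x, Real.exp_pos y]

theorem integrable_exp_mul_sub_mul_exp_add_mul_exp {a b q C : ℝ} (ha : 0 < a) (hb₀ : 0 < b)
    (hb₁ : b < 1) (hq : 0 < q) (hC : 0 < C) :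
    Integrable fun x : ℝ => Real.exp (a * x - q * Real.exp x) * Real.exp (C * Real.exp (b * x)) := by
  obtain ⟨M, hM⟩ := exists_mul_exp_mul_le C hb₀ hb₁ hC (half_pos hq)
  refine ((integrable_exp_mul_sub_mul_exp (κ := q / 2) ha one_pos (half_pos hq)).mul_const
    (Real.exp M)).mono' (Continuous.aestronglyMeasurable (by fun_prop))
    (Eventually.of_forall fun x => ?_)
  rw [Real.norm_of_nonneg (by positivity), ← Real.exp_add, ← Real.exp_add, one_mul]
  refine Real.exp_le_exp.2 ?_
  linarith [hM x]

/-- Integral representation of the Wright function along a ray of angle `θ`, in logarithmic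
coordinates. -/
theorem im_integral_exp_eq_wrightPhi {α δ C t θ : ℝ} (hα₀ : 0 < α) (hα₂ : α < 2) (hδ : δ < 1)
    (hC : 0 < C) (ht : 0 < t) (hθ₁ : Real.pi / 2 < θ) (hθ₂ : θ < Real.pi) :
    (∫ x : ℝ, Complex.exp (t * Complex.exp (x + θ * Complex.I)) *
      Complex.exp (((1 - δ : ℝ) : ℂ) * (x + θ * Complex.I) -
        C * Complex.exp (((α / 2 : ℝ) : ℂ) * (x + θ * Complex.I)))).im =
      Real.pi * (t ^ (δ - 1) * wrightPhi α δ (-(C * t ^ (-α / 2)))) := by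
  have hq : 0 < t * -Real.cos θ :=
    mul_pos ht (neg_pos.2 (Real.cos_neg_of_pi_div_two_lt_of_lt hθ₁ (by linarith)))
  have hψ : |θ - Real.pi| < Real.pi / 2 := by rw [abs_lt]; constructor <;> linarith
  set b := α / 2 with hb
  have hb₀ : 0 < b := by positivity
  have hb₁ : b < 1 := by rw [hb]; linarith
  have ha : ∀ m : ℕ, 0 < 1 - δ + b * m := fun m => by
    have : 0 ≤ b * m := by positivity
    linarith
  set P : ℝ → ℂ := fun x => Complex.exp (((1 - δ : ℝ) : ℂ) * (x + θ * Complex.I) +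
    t * Complex.exp (x + θ * Complex.I)) with hP
  set Q : ℝ → ℂ := fun x => -(C * Complex.exp (b * (x + θ * Complex.I))) with hQ
  have hPn : ∀ x, ‖P x‖ = Real.exp ((1 - δ) * x - t * -Real.cos θ * Real.exp x) := fun x => by
    rw [hP, Complex.norm_exp]
    congr 1
    simp [Complex.exp_re]
    ring
  have hQn : ∀ x, ‖Q x‖ = C * Real.exp (b * x) := fun x => by
    simp [hQ, Complex.norm_exp, abs_of_pos hC]
  have hPc : Continuous P := by fun_prop
  have hQc : Continuous Q := by fun_prop
  have hsum : HasSum (fun m : ℕ => ∫ x, P x * (Q x ^ m / (m.factorial : ℂ)))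
      (∫ x, P x * Complex.exp (Q x)) := by
    have hreal : ∀ x, HasSum (fun m : ℕ => ‖P x‖ * (‖Q x‖ ^ m / (m.factorial : ℝ)))
        (‖P x‖ * Real.exp ‖Q x‖) := fun x => by
      have := NormedSpace.expSeries_div_hasSum_exp ‖Q x‖
      rw [← Real.exp_eq_exp_ℝ] at this
      exact this.mul_left _
    refine hasSum_integral_of_dominated_convergence
      (fun m x => ‖P x‖ * (‖Q x‖ ^ m / (m.factorial : ℝ)))
      (fun m => Continuous.aestronglyMeasurable (by fun_prop))
      (fun m => Eventually.of_forall fun x => by simp)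
      (Eventually.of_forall fun x => (hreal x).summable) ?_
      (Eventually.of_forall fun x => ?_)
    · simp_rw [fun x => (hreal x).tsum_eq, hPn, hQn]
      exact integrable_exp_mul_sub_mul_exp_add_mul_exp (by linarith) hb₀ hb₁ hq hC
    · have := NormedSpace.expSeries_div_hasSum_exp (Q x)
      rw [← Complex.exp_eq_exp_ℂ] at this
      exact this.mul_left _
  have hterm : ∀ m : ℕ, ∫ x, P x * (Q x ^ m / (m.factorial : ℂ)) =
      (((-C) ^ m / m.factorial * (t ^ (-(1 - δ + b * m)) * Real.Gamma (1 - δ + b * m)) : ℝ) : ℂ) *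
        Complex.exp ((Real.pi * (1 - δ + b * m) : ℝ) * Complex.I) := fun m => by
    rw [Complex.ofReal_mul, ← integral_exp_mul_sub_mul_exp_line (ha m) ht hψ, mul_right_comm,
      ← integral_const_mul]
    congr 1 with x
    have e1 : Complex.exp (x + θ * Complex.I) =
        -Complex.exp (x + (θ - Real.pi : ℝ) * Complex.I) := by
      rw [← Complex.exp_add_pi_mul_I]
      congr 1
      push_cast
      ring
    simp only [hP, hQ]
    rw [neg_mul_eq_neg_mul, mul_pow, ← Complex.exp_nat_mul, e1]
    push_cast
    rw [mul_comm, div_mul_eq_mul_div, div_mul_eq_mul_div, div_mul_eq_mul_div, mul_assoc, mul_assoc,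
      ← Complex.exp_add, ← Complex.exp_add]
    congr 3
    ring
  have him : ∀ m : ℕ, (∫ x, P x * (Q x ^ m / (m.factorial : ℂ))).im =
      Real.pi * (t ^ (δ - 1) * ((-(C * t ^ (-α / 2))) ^ m /
        ((m.factorial : ℝ) * Real.Gamma (δ - α * m / 2)))) := fun m => by
    rw [hterm, Complex.im_ofReal_mul, Complex.exp_ofReal_mul_I_im]
    have hG := Real.Gamma_mul_Gamma_one_sub (1 - δ + b * m)
    have hG0 := (Real.Gamma_pos_of_pos (ha m)).ne'
    have e : (Real.Gamma (δ - α * m / 2))⁻¹ =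
        Real.Gamma (1 - δ + b * m) * Real.sin (Real.pi * (1 - δ + b * m)) / Real.pi := by
      rw [show δ - α * m / 2 = 1 - (1 - δ + b * m) by rw [hb]; ring]
      rw [mul_div_assoc, ← inv_div, ← hG, mul_inv, mul_inv_cancel_left₀ hG0]
    have e2 : t ^ (-(1 - δ + b * m)) = t ^ (δ - 1) * (t ^ (-α / 2)) ^ m := by
      rw [← Real.rpow_natCast, ← Real.rpow_mul ht.le, ← Real.rpow_add ht]
      congr 1
      rw [hb]
      ring
    rw [div_mul_eq_div_div, div_eq_mul_inv _ (Real.Gamma _), e, e2, neg_mul_eq_neg_mul, mul_pow]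
    have := Real.pi_ne_zero
    have := Nat.factorial_ne_zero m
    field_simp
  have hmain := (Complex.hasSum_im hsum)
  simp_rw [him] at hmain
  rw [wrightPhi, ← tsum_mul_left, ← tsum_mul_left, hmain.tsum_eq]
  congr 2 with x
  simp only [hP, hQ]
  rw [← Complex.exp_add, ← Complex.exp_add]
  congr 1
  ring

theorem dslope_exp_zero_ne_zero {w : ℂ} (hw : |w.im| < Real.pi) :
    dslope Complex.exp 0 w ≠ 0 := by
  rcases eq_or_ne w 0 with rfl | h0
  · simp [dslope_same]
  · rw [dslope_of_ne _ h0, slope_def_field, Complex.exp_zero, sub_zero]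
    refine div_ne_zero (fun h => h0 ?_) h0
    have h1 := sub_eq_zero.1 h
    rw [← Complex.log_exp (x := w) (abs_lt.1 hw).1 (abs_lt.1 hw).2.le, h1, Complex.log_one]

theorem integral_im_inv_add_mul_I {θ : ℝ} (hθ : 0 < θ) :
    Integrable (fun x : ℝ => ((x + θ * Complex.I : ℂ)⁻¹).im) ∧
      ∫ x : ℝ, ((x + θ * Complex.I : ℂ)⁻¹).im = -Real.pi := by
  have e : (fun x : ℝ => ((x + θ * Complex.I : ℂ)⁻¹).im) =
      fun x => -θ⁻¹ * (1 + (x / θ) ^ 2)⁻¹ := by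
    ext x
    have : x ^ 2 + θ ^ 2 ≠ 0 := by positivity
    simp only [Complex.inv_im, Complex.normSq_apply]
    simp
    rw [show x * x + θ * θ = x ^ 2 + θ ^ 2 by ring,
      show 1 + (x / θ) ^ 2 = (x ^ 2 + θ ^ 2) / θ ^ 2 by field_simp; ring]
    field_simp
  rw [e]
  refine ⟨(integrable_inv_one_add_sq.comp_div hθ.ne').const_mul _, ?_⟩
  rw [integral_const_mul, Measure.integral_comp_div (fun x : ℝ => (1 + x ^ 2)⁻¹) θ,
    integral_univ_inv_one_add_sq, abs_of_pos hθ, smul_eq_mul]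
  field_simp

theorem one_le_norm_one_sub_exp (x : ℝ) {θ : ℝ} (hθ : Real.cos θ ≤ 0) :
    1 ≤ ‖1 - Complex.exp (x + θ * Complex.I)‖ := by
  refine le_trans ?_ (Complex.re_le_norm _)
  have := Real.exp_pos x
  simp [Complex.exp_re]
  nlinarith

theorem one_half_le_norm_one_sub_exp {w : ℂ} (hw : 1 ≤ |w.re|) :
    1 / 2 ≤ ‖1 - Complex.exp w‖ := by
  have h := abs_norm_sub_norm_le 1 (Complex.exp w)
  rw [norm_one, Complex.norm_exp] at h
  refine le_trans ?_ h
  rcases le_abs'.1 hw with h1 | h1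
  · have h2 := Real.add_one_le_exp (-w.re)
    have h3 : Real.exp w.re * Real.exp (-w.re) = 1 := by rw [← Real.exp_add]; simp
    refine le_trans ?_ (le_abs_self _)
    nlinarith [Real.exp_pos w.re]
  · have h2 := Real.add_one_le_exp w.re
    refine le_trans ?_ (neg_le_abs _)
    linarith

/-- Cauchy's integral formula in a sector of half-angle `θ`, in logarithmic coordinates, for the
stretched exponential `z ^ (a - 1) * exp (-C * z ^ b)`. -/
theorem im_integral_exp_div_one_sub_exp {a b C θ : ℝ} (ha : 0 < a) (hb : 0 < b) (hC : 0 < C)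
    (hθ₁ : Real.pi / 2 < θ) (hθ₂ : θ < Real.pi) (hbθ : b * θ < Real.pi / 2) :
    (∫ x : ℝ, Complex.exp (a * (x + θ * Complex.I) - C * Complex.exp (b * (x + θ * Complex.I))) /
      (1 - Complex.exp (x + θ * Complex.I))).im = Real.pi * Real.exp (-C) := by
  have hθ₀ : 0 < θ := by linarith [Real.pi_pos]
  have hbθ' : |b * θ| < Real.pi / 2 := by rwa [abs_of_pos (by positivity)]
  have hcos : Real.cos θ ≤ 0 :=
    (Real.cos_neg_of_pi_div_two_lt_of_lt hθ₁ (by linarith)).le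
  have hκ : 0 < C * Real.cos (b * θ) :=
    mul_pos hC (Real.cos_pos_of_mem_Ioo (abs_lt.1 hbθ'))
  set K : ℂ → ℂ := fun w => Complex.exp (a * w - C * Complex.exp (b * w)) with hK
  set g : ℂ → ℂ := fun w => K w / (1 - Complex.exp w) with hg
  set φ : ℂ → ℂ := fun w => -(K w / dslope Complex.exp 0 w) with hφ
  set h : ℂ → ℂ := dslope φ 0 with hh
  set U : Set ℂ := {w | |w.im| < Real.pi} with hU
  have hUo : IsOpen U := isOpen_lt (by fun_prop) continuous_const
  have hφd : DifferentiableOn ℂ φ U := by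
    have h1 : DifferentiableOn ℂ (dslope Complex.exp 0) U :=
      (Complex.differentiableOn_dslope (hUo.mem_nhds (by simp [hU, Real.pi_pos]))).2
        Complex.differentiable_exp.differentiableOn
    have h2 : DifferentiableOn ℂ K U := by fun_prop
    exact (h2.div h1 fun w hw => dslope_exp_zero_ne_zero hw).neg
  have hhd : DifferentiableOn ℂ h U :=
    (Complex.differentiableOn_dslope (hUo.mem_nhds (by simp [hU, Real.pi_pos]))).2 hφd
  have hstrip : ∀ w : ℂ, w.im ∈ uIcc 0 θ → w ∈ U := fun w hw => by
    rw [uIcc_of_le hθ₀.le] at hw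
    change |w.im| < Real.pi
    rw [abs_of_nonneg hw.1]
    exact hw.2.trans_lt hθ₂
  have hφ0 : φ 0 = -(Real.exp (-C) : ℝ) := by
    simp [hφ, hK, dslope_same]
  have hh_eq : ∀ w : ℂ, w ≠ 0 → h w = g w + (Real.exp (-C) : ℝ) * w⁻¹ := fun w hw => by
    rw [hh, dslope_of_ne _ hw, slope_def_field, hφ0]
    simp only [hφ, hg]
    rw [sub_zero, dslope_of_ne _ hw, slope_def_field, Complex.exp_zero, sub_zero,
      div_div_eq_mul_div, ← neg_sub (Complex.exp w) 1, div_neg]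
    field_simp
    ring
  have hlim := tendsto_integral_sub_integral_strip (h := h) (θ := θ)
    (B := fun x => 2 * Real.exp (a * x - C * Real.cos (b * θ) * Real.exp (b * x)) +
      Real.exp (-C) * |x|⁻¹)
    (fun w hw => (hhd w (hstrip w hw)).differentiableAt (hUo.mem_nhds (hstrip w hw)))
    (fun x hx y hy => by
      have hre : |x| ≤ ‖(x + y * Complex.I : ℂ)‖ := by
        simpa using Complex.abs_re_le_norm (x + y * Complex.I : ℂ)
      have hne : (x + y * Complex.I : ℂ) ≠ 0 := norm_pos_iff.1 (by linarith)
      rw [hh_eq _ hne]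
      refine (norm_add_le _ _).trans (add_le_add ?_ ?_)
      · rw [hg, norm_div, div_le_iff₀ (lt_of_lt_of_le (by norm_num)
          (one_half_le_norm_one_sub_exp (by simpa using hx)))]
        have h1 := norm_exp_mul_sub_mul_exp_le a x hb hC hbθ' hy
        have h2 : 1 / 2 ≤ ‖1 - Complex.exp (x + y * Complex.I)‖ :=
          one_half_le_norm_one_sub_exp (by simpa using hx)
        refine h1.trans ?_
        nlinarith [Real.exp_pos (a * x - C * Real.cos (b * θ) * Real.exp (b * x))]
      · rw [norm_mul, norm_inv, Complex.norm_real, Real.norm_of_nonneg (Real.exp_pos _).le]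
        have : 0 < |x| := by linarith
        gcongr)
    (by simpa using ((tendsto_exp_mul_sub_mul_exp_atTop a hb hκ).const_mul 2).add
          ((tendsto_inv_atTop_zero.comp tendsto_abs_atTop_atTop).const_mul (Real.exp (-C))))
    (by simpa using ((tendsto_exp_mul_sub_mul_exp_atBot b ha hκ).const_mul 2).add
          ((tendsto_inv_atTop_zero.comp tendsto_abs_atBot_atTop).const_mul (Real.exp (-C))))
  have hbot : ∀ R : ℝ, (∫ x : ℝ in -R..R, h x).im = 0 := fun R => by
    have : ∫ x : ℝ in -R..R, h x = ∫ x : ℝ in -R..R, (((h x).re : ℝ) : ℂ) := by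
      refine intervalIntegral.integral_congr_ae ?_
      filter_upwards [compl_mem_ae_iff.2 (measure_singleton (0 : ℝ))] with x hx _
      have hx0 : (x : ℂ) ≠ 0 := Complex.ofReal_ne_zero.2 hx
      rw [hh_eq _ hx0]
      simp only [hg, hK]
      norm_cast
    rw [this, intervalIntegral.integral_ofReal, Complex.ofReal_im]
  have hline : ∀ x : ℝ, (x + θ * Complex.I : ℂ) ≠ 0 := fun x hx => by
    have := congrArg Complex.im hx
    simp at this
    exact hθ₀.ne' this
  have hcont : Continuous fun x : ℝ => h (x + θ * Complex.I) :=
    hhd.continuousOn.comp_continuous (by fun_prop)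
      fun x => hstrip _ (by simp)
  have hgi : Integrable fun x : ℝ => g (x + θ * Complex.I) := by
    refine (integrable_exp_mul_sub_mul_exp_line ha hb hC hbθ').norm.mono'
      (Measurable.aestronglyMeasurable (by fun_prop)) (Eventually.of_forall fun x => ?_)
    rw [hg, norm_div]
    exact div_le_self (norm_nonneg _) (one_le_norm_one_sub_exp x hcos)
  obtain ⟨hpi, hpv⟩ := integral_im_inv_add_mul_I hθ₀
  have him : ∀ x : ℝ, (h (x + θ * Complex.I)).im =
      (g (x + θ * Complex.I)).im + Real.exp (-C) * ((x + θ * Complex.I : ℂ)⁻¹).im := fun x => by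
    rw [hh_eq _ (hline x), Complex.add_im, Complex.im_ofReal_mul]
  have htop : ∀ R : ℝ, (∫ x : ℝ in -R..R, h (x + θ * Complex.I)).im =
      ∫ x : ℝ in -R..R, ((g (x + θ * Complex.I)).im +
        Real.exp (-C) * ((x + θ * Complex.I : ℂ)⁻¹).im) := fun R => by
    simp_rw [← him]
    exact (Complex.imCLM.intervalIntegral_comp_comm (hcont.intervalIntegrable _ _)).symm
  have hgim : Integrable fun x : ℝ => (g (x + θ * Complex.I)).im := hgi.im
  have l1 := intervalIntegral_tendsto_integral (hgim.add (hpi.const_mul (Real.exp (-C))))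
    tendsto_neg_atTop_atBot tendsto_id
  have l2 := (Complex.continuous_im.tendsto 0).comp hlim
  have l3 : Tendsto (fun R : ℝ => -∫ x : ℝ in -R..R, ((g (x + θ * Complex.I)).im +
        Real.exp (-C) * ((x + θ * Complex.I : ℂ)⁻¹).im)) atTop (nhds 0) := by
    refine l2.congr fun R => ?_
    simp only [Function.comp, Complex.sub_im, hbot, htop, zero_sub]
  have l4 := tendsto_nhds_unique l3 l1.neg
  simp only [Pi.add_apply] at l4
  rw [integral_add hgim (hpi.const_mul _), integral_const_mul, hpv] at l4
  have l5 : (∫ x : ℝ, g (x + θ * Complex.I)).im = ∫ x : ℝ, (g (x + θ * Complex.I)).im :=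
    (Complex.imCLM.integral_comp_comm hgi).symm
  rw [l5]
  linarith

/-- The Laplace transform at `1` of `t ^ (δ - 1) * Φ(-α/2, δ; -C * t ^ (-α/2))`. -/
theorem integral_exp_neg_mul_wrightPhi {α δ C : ℝ} (hα₁ : 1 < α) (hα₂ : α < 2) (hδ : δ < 1)
    (hC : 0 < C) :
    ∫ t in Ioi (0 : ℝ), Real.exp (-t) * (t ^ (δ - 1) * wrightPhi α δ (-(C * t ^ (-α / 2)))) =
      Real.exp (-C) := by
  obtain ⟨θ, hθ₁, hθ⟩ : ∃ θ, Real.pi / 2 < θ ∧ θ < Real.pi / α :=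
    exists_between (div_lt_div_of_pos_left Real.pi_pos (by linarith) hα₂)
  have hθ₂ : θ < Real.pi := hθ.trans (div_lt_self Real.pi_pos hα₁)
  have hbθ : α / 2 * θ < Real.pi / 2 := by
    rw [lt_div_iff₀ (by linarith)] at hθ
    linarith
  have hα₀ : 0 < α := by linarith
  have hθ₀ : 0 < θ := by linarith [Real.pi_pos]
  have hcos : Real.cos θ ≤ 0 :=
    (Real.cos_neg_of_pi_div_two_lt_of_lt hθ₁ (by linarith)).le
  set K : ℝ → ℂ := fun x => Complex.exp (((1 - δ : ℝ) : ℂ) * (x + θ * Complex.I) -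
    C * Complex.exp (((α / 2 : ℝ) : ℂ) * (x + θ * Complex.I))) with hK
  have hKi : Integrable K := integrable_exp_mul_sub_mul_exp_line (by linarith) (by linarith) hC
    (by rwa [abs_of_pos (by positivity)])
  have hKc : Continuous K := by fun_prop
  set F : ℝ → ℝ → ℂ := fun t x =>
    Complex.exp (-t) * (Complex.exp (t * Complex.exp (x + θ * Complex.I)) * K x) with hF
  have hFi : Integrable (Function.uncurry F) ((volume.restrict (Ioi (0 : ℝ))).prod volume) := by
    have h0 : Integrable (fun t : ℝ => Real.exp (-t)) (volume.restrict (Ioi 0)) :=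
      integrableOn_exp_neg_Ioi 0
    have h1 := Integrable.mul_prod h0 hKi.norm
    refine h1.mono' (Continuous.aestronglyMeasurable (by fun_prop)) ?_
    have h2 : ∀ᵐ z : ℝ × ℝ ∂((volume.restrict (Ioi (0 : ℝ))).prod volume), 0 < z.1 :=
      Measure.quasiMeasurePreserving_fst.ae (ae_restrict_mem measurableSet_Ioi)
    filter_upwards [h2] with z hz
    simp only [Function.uncurry, hF, norm_mul]
    refine mul_le_mul ?_ ?_ (by positivity) (by positivity)
    · simp [Complex.norm_exp]
    · refine mul_le_of_le_one_left (norm_nonneg _) ?_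
      rw [Complex.norm_exp, Real.exp_le_one_iff]
      simp [Complex.exp_re]
      exact mul_nonpos_of_nonneg_of_nonpos hz.le
        (mul_nonpos_of_nonneg_of_nonpos (Real.exp_pos _).le hcos)
  have hswap := integral_integral_swap hFi
  have hinner : ∀ x : ℝ, ∫ t in Ioi (0 : ℝ), F t x =
      K x / (1 - Complex.exp (x + θ * Complex.I)) := fun x => by
    have hre : (Complex.exp (x + θ * Complex.I) - 1).re < 0 := by
      have := mul_nonpos_of_nonneg_of_nonpos (Real.exp_pos x).le hcos
      simp [Complex.exp_re]
      linarith
    have h1 := integral_exp_mul_complex_Ioi hre 0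
    have h2 : ∀ t : ℝ, F t x =
        Complex.exp ((Complex.exp (x + θ * Complex.I) - 1) * t) * K x := fun t => by
      simp only [hF]
      rw [← mul_assoc, ← Complex.exp_add]
      congr 2
      ring
    simp_rw [h2]
    rw [integral_mul_const, h1, Complex.ofReal_zero, mul_zero, Complex.exp_zero,
      ← neg_sub 1 (Complex.exp _), neg_div_neg_eq, one_div_mul_eq_div]
  have hrepr : ∀ t ∈ Ioi (0 : ℝ),
      Real.exp (-t) * (t ^ (δ - 1) * wrightPhi α δ (-(C * t ^ (-α / 2)))) =
      Real.pi⁻¹ * (∫ x, F t x).im := fun t ht => by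
    simp only [hF]
    rw [integral_const_mul, ← Complex.ofReal_neg, ← Complex.ofReal_exp, Complex.im_ofReal_mul,
      im_integral_exp_eq_wrightPhi hα₀ hα₂ hδ hC ht hθ₁ hθ₂, mul_left_comm Real.pi⁻¹,
      inv_mul_cancel_left₀ Real.pi_ne_zero]
  rw [setIntegral_congr_fun measurableSet_Ioi hrepr, integral_const_mul]
  have hre : ∫ t in Ioi (0 : ℝ), (∫ x, F t x).im = (∫ t in Ioi (0 : ℝ), ∫ x, F t x).im :=
    Complex.imCLM.integral_comp_comm hFi.integral_prod_left
  rw [hre, hswap]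
  simp_rw [hinner]
  rw [hK, im_integral_exp_div_one_sub_exp (by linarith) (by linarith) hC hθ₁ hθ₂ hbθ,
    inv_mul_cancel_left₀ Real.pi_ne_zero]

/-- Laplace transform identity: for `δ = α - αn/2`, `s > 0`, `c > 0`,
`∫_0^∞ e^{-st} t^{δ-1} Φ(-α/2, δ; -c t^{-α/2}) dt = s^{-δ} e^{-c s^{α/2}}`. -/
theorem laplace_transform_wright
    (α : ℝ) (n : ℕ) (hα₁ : 1 < α) (hα₂ : α < 2) (hn : 3 ≤ n)
    (δ : ℝ) (hδ : δ = α - α * n / 2) :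
    ∀ s : ℝ, 0 < s → ∀ c : ℝ, 0 < c →
      (∫ t in Ioi (0 : ℝ),
          Real.exp (-(s * t)) * t ^ (δ - 1) * wrightPhi α δ (-(c * t ^ (-α / 2))))
        = s ^ (-δ) * Real.exp (-(c * s ^ (α / 2))) := by
  intro s hs c hc
  have hδ₁ : δ < 1 := by
    have : (3 : ℝ) ≤ n := by exact_mod_cast hn
    nlinarith
  have hC : 0 < c * s ^ (α / 2) := by positivity
  have hscale := integral_comp_mul_left_Ioi (fun u : ℝ => Real.exp (-u) *
    (u ^ (δ - 1) * wrightPhi α δ (-(c * s ^ (α / 2) * u ^ (-α / 2))))) 0 hs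
  rw [mul_zero, integral_exp_neg_mul_wrightPhi hα₁ hα₂ hδ₁ hC] at hscale
  have hcongr : ∀ t ∈ Ioi (0 : ℝ),
      Real.exp (-(s * t)) * t ^ (δ - 1) * wrightPhi α δ (-(c * t ^ (-α / 2))) =
      s ^ (1 - δ) * (Real.exp (-(s * t)) * ((s * t) ^ (δ - 1) *
        wrightPhi α δ (-(c * s ^ (α / 2) * (s * t) ^ (-α / 2))))) := fun t ht => by
    have h1 : s ^ (1 - δ) * s ^ (δ - 1) = 1 := by rw [← Real.rpow_add hs]; simp
    have h2 : s ^ (α / 2) * s ^ (-α / 2) = 1 := by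
      rw [← Real.rpow_add hs, neg_div, add_neg_cancel, Real.rpow_zero]
    have ht' : (0 : ℝ) ≤ t := (mem_Ioi.1 ht).le
    rw [Real.mul_rpow hs.le ht', Real.mul_rpow hs.le ht',
      show c * s ^ (α / 2) * (s ^ (-α / 2) * t ^ (-α / 2)) =
        c * (s ^ (α / 2) * s ^ (-α / 2)) * t ^ (-α / 2) by ring, h2, mul_one]
    linear_combination -(Real.exp (-(s * t)) * t ^ (δ - 1) *
      wrightPhi α δ (-(c * t ^ (-α / 2)))) * h1
  rw [setIntegral_congr_fun measurableSet_Ioi hcongr, integral_const_mul, hscale, smul_eq_mul,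
    ← mul_assoc, ← Real.rpow_neg_one s, ← Real.rpow_add hs]
  congr 2
  ring
end

section
/- Let 1<α<2, λ>0, ω>0, and set μ = i^α ω^α = e^{iπα/2} ω^α (so λ + μ ≠ 0). Then for every t>0, ∫_0^t (t−τ)^{α−1} E_{α,α}(−λ(t−τ)^α) E_α(μ τ^α) dτ = t^α · (λ E_{α,α+1}(−λ t^α) + μ E_{α,α+1}(μ t^α)) / (λ + μ). -/
open MeasureTheory Filter Set

/-- The Mittag-Leffler function `E_{a,b}(z) = ∑ z^k / Γ(a k + b)`, where `1/Γ` is the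
entire reciprocal Gamma function (Mathlib's `Real.Gamma` vanishes at the poles). -/
noncomputable def mittagLeffler (a b : ℝ) (z : ℂ) : ℂ :=
  ∑' k : ℕ, z ^ k / (Real.Gamma (a * k + b) : ℂ)

theorem summable_norm_mittagLeffler {a b : ℝ} (ha : 1 ≤ a) (z : ℂ) :
    Summable fun k : ℕ => ‖z ^ k / (Real.Gamma (a * k + b) : ℂ)‖ := by
  have hlim : Tendsto (fun k : ℕ => a * (k : ℝ) + b) atTop atTop :=
    tendsto_atTop_add_const_right _ _
      (tendsto_natCast_atTop_atTop.const_mul_atTop (by linarith))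
  refine summable_of_ratio_norm_eventually_le (r := 1 / 2) (by norm_num) ?_
  filter_upwards [hlim.eventually_ge_atTop 2, hlim.eventually_ge_atTop (2 * ‖z‖)] with k hk hz
  have hΓ : 0 < Real.Gamma (a * k + b) := Real.Gamma_pos_of_pos (by linarith)
  have hstep : (a * k + b) * Real.Gamma (a * k + b) ≤ Real.Gamma (a * (k + 1 : ℕ) + b) := by
    rw [← Real.Gamma_add_one (by linarith)]
    refine Real.Gamma_strictMonoOn_Ici.monotoneOn ?_ ?_ ?_
    · exact mem_Ici.2 (by linarith)
    · exact mem_Ici.2 (by push_cast; linarith)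
    · push_cast
      linarith
  have hΓ' : 0 < Real.Gamma (a * (k + 1 : ℕ) + b) := (by nlinarith : (0 : ℝ) < _).trans_le hstep
  simp only [norm_norm, norm_div, norm_pow, Complex.norm_real, Real.norm_of_nonneg hΓ.le,
    Real.norm_of_nonneg hΓ'.le]
  rw [← mul_div_assoc, div_le_div_iff₀ hΓ' hΓ, pow_succ]
  have hzΓ : ‖z‖ * Real.Gamma (a * k + b) ≤ 1 / 2 * Real.Gamma (a * (k + 1 : ℕ) + b) := by
    nlinarith
  nlinarith [mul_le_mul_of_nonneg_left hzΓ (pow_nonneg (norm_nonneg z) k)]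

theorem hasSum_mittagLeffler {a : ℝ} (ha : 1 ≤ a) (b : ℝ) (z : ℂ) :
    HasSum (fun k : ℕ => z ^ k / (Real.Gamma (a * k + b) : ℂ)) (mittagLeffler a b z) :=
  (summable_norm_mittagLeffler ha z).of_norm.hasSum

theorem hasSum_mittagLeffler_mul_mittagLeffler {a : ℝ} (ha : 1 ≤ a) (b c : ℝ) (z w : ℂ) :
    HasSum (fun p : ℕ × ℕ => z ^ p.1 / (Real.Gamma (a * p.1 + b) : ℂ)
        * (w ^ p.2 / (Real.Gamma (a * p.2 + c) : ℂ)))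
      (mittagLeffler a b z * mittagLeffler a c w) := by
  have hf := summable_norm_mittagLeffler (b := b) ha z
  have hg := summable_norm_mittagLeffler (b := c) ha w
  have hfg := summable_mul_of_summable_norm hf hg
  have h := hf.of_norm.hasSum.mul hg.of_norm.hasSum hfg
  exact h

theorem integral_sub_rpow_mul_rpow {u v t : ℝ} (hu : 0 < u) (hv : 0 < v) (ht : 0 < t) :
    ∫ τ in (0 : ℝ)..t, (((t - τ) ^ (u - 1) * τ ^ (v - 1) : ℝ) : ℂ) =
      ((t ^ (u + v - 1) * (Real.Gamma u * Real.Gamma v / Real.Gamma (u + v)) : ℝ) : ℂ) := by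
  have hΓ : (Real.Gamma (u + v) : ℂ) ≠ 0 := by
    exact_mod_cast (Real.Gamma_pos_of_pos (add_pos hu hv)).ne'
  have hbeta := Complex.Gamma_mul_Gamma_eq_betaIntegral (s := (v : ℂ)) (t := (u : ℂ))
    (by simpa using hv) (by simpa using hu)
  rw [← Complex.ofReal_add, Complex.Gamma_ofReal, Complex.Gamma_ofReal, Complex.Gamma_ofReal,
    add_comm v u] at hbeta
  have hscaled := Complex.betaIntegral_scaled (v : ℂ) (u : ℂ) ht
  rw [eq_div_of_mul_eq hΓ ((mul_comm _ _).trans hbeta.symm)] at hscaled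
  calc _ = ∫ x in (0 : ℝ)..t, (x : ℂ) ^ ((v : ℂ) - 1) * ((t : ℂ) - x) ^ ((u : ℂ) - 1) := by
        refine intervalIntegral.integral_congr fun x hx => ?_
        rw [uIcc_of_le ht.le] at hx
        simp only [Complex.ofReal_mul]
        rw [Complex.ofReal_cpow hx.1, Complex.ofReal_cpow (sub_nonneg.2 hx.2), mul_comm]
        push_cast
        rfl
    _ = _ := by
        rw [hscaled, Complex.ofReal_mul, Complex.ofReal_cpow ht.le]
        push_cast
        rw [add_comm (v : ℂ) u, mul_comm (Real.Gamma v : ℂ)]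

theorem rpow_sub_one_mul_rpow_pow {α x : ℝ} (hα : 1 < α) (hx : 0 ≤ x) (j : ℕ) :
    x ^ (α - 1) * (x ^ α) ^ j = x ^ (α * j + α - 1) := by
  have hj : 0 ≤ α * j := by positivity
  rw [← Real.rpow_natCast, ← Real.rpow_mul hx, ← Real.rpow_add' hx (by linarith)]
  congr 1
  ring

theorem integral_mittagLeffler_terms {α t : ℝ} (hα : 1 < α) (ht : 0 < t) (z w : ℂ) (j k : ℕ) :
    ∫ τ in (0 : ℝ)..t, (((t - τ) ^ (α - 1) : ℝ) : ℂ)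
        * ((z * (((t - τ) ^ α : ℝ) : ℂ)) ^ j / (Real.Gamma (α * j + α) : ℂ))
        * ((w * ((τ ^ α : ℝ) : ℂ)) ^ k / (Real.Gamma (α * k + 1) : ℂ)) =
      z ^ j * w ^ k * (((t ^ α : ℝ) : ℂ) ^ (j + k + 1)
        / (Real.Gamma (α * (j + k : ℕ) + (α + 1)) : ℂ)) := by
  have hα₀ : 0 < α := by linarith
  have hu : 0 < α * j + α := by positivity
  have hv : 0 < α * k + 1 := by positivity
  have hΓu : (Real.Gamma (α * j + α) : ℂ) ≠ 0 := by
    exact_mod_cast (Real.Gamma_pos_of_pos hu).ne'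
  have hΓv : (Real.Gamma (α * k + 1) : ℂ) ≠ 0 := by
    exact_mod_cast (Real.Gamma_pos_of_pos hv).ne'
  have hexp : (t ^ α) ^ (j + k + 1) = t ^ (α * j + α + (α * k + 1) - 1) := by
    rw [← Real.rpow_natCast, ← Real.rpow_mul ht.le]
    congr 1
    push_cast
    ring
  calc _ = ∫ τ in (0 : ℝ)..t,
        z ^ j * w ^ k / ((Real.Gamma (α * j + α) : ℂ) * (Real.Gamma (α * k + 1) : ℂ))
          * (((t - τ) ^ (α * j + α - 1) * τ ^ (α * k + 1 - 1) : ℝ) : ℂ) := by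
        refine intervalIntegral.integral_congr fun x hx => ?_
        rw [uIcc_of_le ht.le] at hx
        rw [← rpow_sub_one_mul_rpow_pow hα (sub_nonneg.2 hx.2), add_sub_cancel_right,
          Real.rpow_mul hx.1, Real.rpow_natCast, mul_pow, mul_pow]
        push_cast
        field_simp
    _ = _ := by
        rw [intervalIntegral.integral_const_mul, integral_sub_rpow_mul_rpow hu hv ht, ← hexp,
          show α * j + α + (α * k + 1) = α * (j + k : ℕ) + (α + 1) by push_cast; ring]
        rw [Complex.ofReal_mul, Complex.ofReal_div, Complex.ofReal_mul, Complex.ofReal_pow,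
          mul_comm (((t ^ α : ℝ) : ℂ) ^ _), ← mul_assoc, ← mul_div_assoc,
          div_mul_cancel₀ _ (mul_ne_zero hΓu hΓv), div_mul_eq_mul_div, mul_div_assoc]

theorem hasSum_integral_mittagLeffler_terms {α t : ℝ} (hα : 1 < α) (ht : 0 < t) (z w : ℂ) :
    HasSum (fun p : ℕ × ℕ => z ^ p.1 * w ^ p.2 * (((t ^ α : ℝ) : ℂ) ^ (p.1 + p.2 + 1)
        / (Real.Gamma (α * (p.1 + p.2 : ℕ) + (α + 1)) : ℂ)))
      (∫ τ in (0 : ℝ)..t, (((t - τ) ^ (α - 1) : ℝ) : ℂ)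
        * mittagLeffler α α (z * (((t - τ) ^ α : ℝ) : ℂ))
        * mittagLeffler α 1 (w * ((τ ^ α : ℝ) : ℂ))) := by
  simp_rw [← integral_mittagLeffler_terms hα ht z w]
  have hα₀ : 0 ≤ α := by linarith
  refine intervalIntegral.hasSum_integral_of_dominated_convergence
    (fun p _ => t ^ (α - 1) *
      (‖(z * ((t ^ α : ℝ) : ℂ)) ^ p.1 / (Real.Gamma (α * p.1 + α) : ℂ)‖
        * ‖(w * ((t ^ α : ℝ) : ℂ)) ^ p.2 / (Real.Gamma (α * p.2 + 1) : ℂ)‖))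
    ?_ ?_ ?_ ?_ ?_
  · intro p
    have h₁ : Measurable fun τ : ℝ => (((t - τ) ^ (α - 1) : ℝ) : ℂ) := by fun_prop
    have h₂ : Measurable fun τ : ℝ => (((t - τ) ^ α : ℝ) : ℂ) := by fun_prop
    have h₃ : Measurable fun τ : ℝ => ((τ ^ α : ℝ) : ℂ) := by fun_prop
    exact ((h₁.mul (((h₂.const_mul z).pow_const _).div_const _)).mul
      (((h₃.const_mul w).pow_const _).div_const _)).aestronglyMeasurable
  · refine fun p => ae_of_all _ fun τ hτ => ?_
    rw [uIoc_of_le ht.le] at hτ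
    have h₀ : 0 ≤ t - τ := sub_nonneg.2 hτ.2
    have h₁ : t - τ ≤ t := by linarith [hτ.1]
    have hα₁ : 0 ≤ α - 1 := by linarith
    simp only [norm_mul, norm_div, norm_pow, Complex.norm_real,
      Real.norm_of_nonneg (Real.rpow_nonneg h₀ _), Real.norm_of_nonneg (Real.rpow_nonneg hτ.1.le _),
      Real.norm_of_nonneg (Real.rpow_nonneg ht.le _)]
    rw [mul_assoc]
    have := hτ.1.le
    have := hτ.2
    gcongr
  · exact ae_of_all _ fun _ _ => ((summable_norm_mittagLeffler hα.le _).mul_of_nonneg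
      (summable_norm_mittagLeffler hα.le _) (fun _ => norm_nonneg _)
      (fun _ => norm_nonneg _)).mul_left _
  · exact intervalIntegrable_const
  · refine ae_of_all _ fun τ _ => ?_
    simp_rw [mul_assoc (((t - τ) ^ (α - 1) : ℝ) : ℂ)]
    refine HasSum.mul_left _ ?_
    exact hasSum_mittagLeffler_mul_mittagLeffler hα.le α 1 _ _

theorem integral_mittagLeffler_mul_mittagLeffler {α t : ℝ} (hα : 1 < α) (ht : 0 < t) {z w : ℂ}
    (hzw : z ≠ w) :
    ∫ τ in (0 : ℝ)..t, (((t - τ) ^ (α - 1) : ℝ) : ℂ)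
        * mittagLeffler α α (z * (((t - τ) ^ α : ℝ) : ℂ))
        * mittagLeffler α 1 (w * ((τ ^ α : ℝ) : ℂ)) =
      ((t ^ α : ℝ) : ℂ) * (z * mittagLeffler α (α + 1) (z * ((t ^ α : ℝ) : ℂ))
        - w * mittagLeffler α (α + 1) (w * ((t ^ α : ℝ) : ℂ))) / (z - w) := by
  have hsub : z - w ≠ 0 := sub_ne_zero.2 hzw
  have hdiag := ((Finset.HasAntidiagonal.sigmaAntidiagonalEquivProd (A := ℕ)).hasSum_iff.2
    (hasSum_integral_mittagLeffler_terms hα ht z w)).sigma fun n => hasSum_fintype _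
  have hright := ((((hasSum_mittagLeffler hα.le (α + 1) (z * ((t ^ α : ℝ) : ℂ))).mul_left z).sub
    ((hasSum_mittagLeffler hα.le (α + 1) (w * ((t ^ α : ℝ) : ℂ))).mul_left w)).mul_left
      ((t ^ α : ℝ) : ℂ)).div_const (z - w)
  refine hdiag.unique (hright.congr_fun fun n => ?_)
  have hgeom := (Commute.all z w).geom_sum₂_mul (n + 1)
  simp only [Function.comp_apply, Finset.HasAntidiagonal.sigmaAntidiagonalEquivProd_apply]
  rw [Finset.sum_coe_sort (Finset.HasAntidiagonal.antidiagonal n) fun p : ℕ × ℕ =>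
    z ^ p.1 * w ^ p.2 * (((t ^ α : ℝ) : ℂ) ^ (p.1 + p.2 + 1)
        / (Real.Gamma (α * (p.1 + p.2 : ℕ) + (α + 1)) : ℂ))]
  rw [Finset.sum_congr rfl fun p hp => by rw [Finset.HasAntidiagonal.mem_antidiagonal.1 hp], ← Finset.sum_mul,
    Finset.Nat.sum_antidiagonal_eq_sum_range_succ fun i j => z ^ i * w ^ j, eq_div_iff hsub,
    mul_right_comm]
  simp only [add_tsub_cancel_right] at hgeom
  rw [hgeom]
  ring

/-- Duhamel-type integration formula: the convolution of (t-s)^(a-1) * E_{a,a}(-lam*(t-s)^a)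
with E_a(mu*s^a), mu = i^a w^a, equals t^a*(lam*E_{a,a+1}(-lam t^a) + mu*E_{a,a+1}(mu t^a))/(lam+mu). -/
theorem convolution_mittagLeffler_formula
    (α lam ω : ℝ) (hα₁ : 1 < α) (hα₂ : α < 2) (hlam : 0 < lam) (hω : 0 < ω)
    (μ : ℂ) (hμ : μ = Complex.exp (Real.pi * α / 2 * Complex.I) * ((ω ^ α : ℝ) : ℂ)) :
    ∀ t : ℝ, 0 < t →
      ∫ τ in (0 : ℝ)..t,
          (((t - τ) ^ (α - 1) : ℝ) : ℂ)
            * mittagLeffler α α (-(lam : ℂ) * (((t - τ) ^ α : ℝ) : ℂ))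
            * mittagLeffler α 1 (μ * ((τ ^ α : ℝ) : ℂ))
        = ((t ^ α : ℝ) : ℂ)
            * ((lam : ℂ) * mittagLeffler α (α + 1) (-(lam : ℂ) * ((t ^ α : ℝ) : ℂ))
               + μ * mittagLeffler α (α + 1) (μ * ((t ^ α : ℝ) : ℂ)))
            / ((lam : ℂ) + μ) := by
  intro t ht
  have hθ : 0 < Real.sin (Real.pi * α / 2) :=
    Real.sin_pos_of_pos_of_lt_pi (by positivity) (by nlinarith [Real.pi_pos])
  have him : μ.im = Real.sin (Real.pi * α / 2) * ω ^ α := by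
    rw [hμ, Complex.im_mul_ofReal,
      show (Real.pi * α / 2 * Complex.I : ℂ) = ((Real.pi * α / 2 : ℝ) : ℂ) * Complex.I by
        push_cast; ring, Complex.exp_ofReal_mul_I_im]
  have hne : -(lam : ℂ) ≠ μ := fun h => by
    have h0 : μ.im = 0 := by simp [← h]
    exact (him ▸ mul_pos hθ (Real.rpow_pos_of_pos hω α)).ne' h0
  rw [integral_mittagLeffler_mul_mittagLeffler hα₁ ht hne, ← neg_div_neg_eq]
  congr 1 <;> ring
end

section
/- Let 1<α<2. Then the function x ↦ x · E_{α,α+1}(−x) is bounded on [0,∞): there exists C>0 such that |x E_{α,α+1}(−x)| ≤ C for all x ≥ 0. Equivalently, the function (t,λ) ↦ λ t^α E_{α,α+1}(−λ t^α) is bounded on (0,∞)×(0,∞). -/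
open MeasureTheory Filter Set

theorem integral_rpow_neg_mul_exp_neg_mul {β u : ℝ} (hβ : β < 1) (hu : 0 < u) :
    ∫ r in Ioi (0 : ℝ), r ^ (-β) * Real.exp (-(u * r)) = u ^ (β - 1) * Real.Gamma (1 - β) := by
  have h := Real.integral_rpow_mul_exp_neg_mul_Ioi (a := 1 - β) (by linarith) hu
  rw [show (1 - β - 1 : ℝ) = -β by ring] at h
  rw [h, one_div, Real.inv_rpow hu.le, ← Real.rpow_neg hu.le, neg_sub]

theorem integrable_rpow_neg_mul_exp_neg_mul_prod {β : ℝ} (hβ₀ : 0 < β) (hβ₁ : β < 1) {T : ℝ}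
    (hT : 0 ≤ T) :
    Integrable (fun p : ℝ × ℝ => p.2 ^ (-β) * Real.exp (-(p.1 * p.2)))
      ((volume.restrict (Ioc 0 T)).prod (volume.restrict (Ioi 0))) := by
  rw [integrable_prod_iff (by fun_prop)]
  constructor
  · filter_upwards [ae_restrict_mem measurableSet_Ioc] with u hu
    have h := integrableOn_rpow_mul_exp_neg_mul_rpow (p := 1) (s := -β) (b := u)
      (by linarith) one_pos hu.1
    simpa [IntegrableOn] using h
  · have h : IntegrableOn (fun u : ℝ => u ^ (β - 1) * Real.Gamma (1 - β)) (Ioc 0 T) := by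
      rw [← intervalIntegrable_iff_integrableOn_Ioc_of_le hT]
      exact (intervalIntegral.intervalIntegrable_rpow' (by linarith)).mul_const _
    refine h.congr ?_
    filter_upwards [ae_restrict_mem measurableSet_Ioc] with u hu
    rw [← integral_rpow_neg_mul_exp_neg_mul hβ₁ hu.1]
    refine setIntegral_congr_fun measurableSet_Ioi fun r hr => ?_
    have hr : (0 : ℝ) < r := hr
    exact (Real.norm_of_nonneg (by positivity)).symm

/-- The convolution on `[0, t]` of the exponential kernel of rate `r` with `f`. -/
noncomputable def expConv (f : ℝ → ℝ) (t r : ℝ) : ℝ :=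
  ∫ u in (0 : ℝ)..t, Real.exp (-(u * r)) * f (t - u)

theorem continuous_expConv {f : ℝ → ℝ} (hf : Continuous f) :
    Continuous fun p : ℝ × ℝ => expConv f p.1 p.2 :=
  intervalIntegral.continuous_parametric_intervalIntegral_of_continuous
    (f := fun (p : ℝ × ℝ) u => Real.exp (-(u * p.2)) * f (p.1 - u))
    (by simp only [Function.uncurry_def]; fun_prop) continuous_fst

theorem expConv_eq (f : ℝ → ℝ) (t r : ℝ) :
    expConv f t r = Real.exp (-(t * r)) * ∫ s in (0 : ℝ)..t, Real.exp (s * r) * f s := by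
  have h := intervalIntegral.integral_comp_sub_left (a := 0) (b := t)
    (fun s => Real.exp (-((t - s) * r)) * f s) t
  simp only [sub_sub_cancel, sub_self, sub_zero] at h
  rw [expConv, h, ← intervalIntegral.integral_const_mul]
  refine intervalIntegral.integral_congr fun s _ => ?_
  change _ = Real.exp (-(t * r)) * (Real.exp (s * r) * f s)
  rw [← mul_assoc, ← Real.exp_add]
  ring_nf

theorem hasDerivAt_expConv {f : ℝ → ℝ} (hf : Continuous f) (t r : ℝ) :
    HasDerivAt (fun t => expConv f t r) (f t - r * expConv f t r) t := by
  have h₁ : HasDerivAt (fun t : ℝ => Real.exp (-(t * r))) (Real.exp (-(t * r)) * (-(1 * r))) t :=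
    (((hasDerivAt_id t).mul_const r).neg).exp
  have hc : Continuous fun s => Real.exp (s * r) * f s := by fun_prop
  have h₂ := h₁.mul (hc.integral_hasStrictDerivAt 0 t).hasDerivAt
  have h₃ : (fun t => expConv f t r) = (fun t : ℝ => Real.exp (-(t * r))) *
      fun t => ∫ s in (0 : ℝ)..t, Real.exp (s * r) * f s := funext fun t => expConv_eq f t r
  rw [h₃]
  refine h₂.congr_deriv ?_
  rw [expConv_eq, ← mul_assoc (Real.exp (-(t * r))) (Real.exp (t * r)), ← Real.exp_add]
  simp
  ring

/-- Exponential kernels are positive definite. -/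
theorem integral_mul_expConv_nonneg {f : ℝ → ℝ} (hf : Continuous f) {T r : ℝ} (hT : 0 ≤ T)
    (hr : 0 ≤ r) : 0 ≤ ∫ t in (0 : ℝ)..T, f t * expConv f t r := by
  have hg : Continuous fun t => expConv f t r :=
    (continuous_expConv hf).comp (by fun_prop : Continuous fun t : ℝ => (t, r))
  have hd : ∀ t, HasDerivAt (fun t => expConv f t r ^ 2 / 2)
      (expConv f t r * (f t - r * expConv f t r)) t := fun t => by
    refine (((hasDerivAt_expConv hf t r).pow 2).div_const 2).congr_deriv ?_
    ring
  have hi := intervalIntegral.integral_eq_sub_of_hasDerivAt (a := 0) (b := T) (fun t _ => hd t)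
    (Continuous.intervalIntegrable (by fun_prop) _ _)
  have h₀ : expConv f 0 r = 0 := by simp [expConv]
  have hsq : 0 ≤ ∫ t in (0 : ℝ)..T, r * expConv f t r ^ 2 :=
    intervalIntegral.integral_nonneg hT fun t _ => by positivity
  calc (0 : ℝ) ≤ expConv f T r ^ 2 / 2 + ∫ t in (0 : ℝ)..T, r * expConv f t r ^ 2 := by positivity
    _ = (∫ t in (0 : ℝ)..T, expConv f t r * (f t - r * expConv f t r)) +
        ∫ t in (0 : ℝ)..T, r * expConv f t r ^ 2 := by rw [hi, h₀]; ring
    _ = ∫ t in (0 : ℝ)..T, f t * expConv f t r := by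
      rw [← intervalIntegral.integral_add (Continuous.intervalIntegrable (by fun_prop) _ _)
        (Continuous.intervalIntegrable (by fun_prop) _ _)]
      congr 1 with t
      ring

theorem integral_rpow_mul_comp_sub {β : ℝ} (hβ₀ : 0 < β) (hβ₁ : β < 1) {f : ℝ → ℝ}
    (hf : Continuous f) {t : ℝ} (ht : 0 ≤ t) :
    (∫ u in (0 : ℝ)..t, u ^ (β - 1) * f (t - u)) * Real.Gamma (1 - β) =
      ∫ r in Ioi (0 : ℝ), r ^ (-β) * expConv f t r := by
  obtain ⟨M, hM⟩ := (isCompact_Icc (a := (0 : ℝ)) (b := t)).exists_bound_of_continuousOn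
    hf.continuousOn
  have hint : Integrable (Function.uncurry fun u r : ℝ =>
      r ^ (-β) * Real.exp (-(u * r)) * f (t - u))
      ((volume.restrict (Ioc 0 t)).prod (volume.restrict (Ioi 0))) := by
    refine (integrable_rpow_neg_mul_exp_neg_mul_prod hβ₀ hβ₁ ht).mul_bdd (c := M)
      (g := fun p : ℝ × ℝ => f (t - p.1)) (by fun_prop) ?_
    have : ∀ᵐ p : ℝ × ℝ ∂(volume.restrict (Ioc 0 t)).prod (volume.restrict (Ioi 0)),
        p ∈ Ioc 0 t ×ˢ Ioi (0 : ℝ) := by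
      rw [Measure.prod_restrict]
      exact ae_restrict_mem (measurableSet_Ioc.prod measurableSet_Ioi)
    filter_upwards [this] with p hp
    exact hM _ ⟨by linarith [hp.1.2], by linarith [hp.1.1]⟩
  have h := integral_integral_swap hint
  rw [← intervalIntegral.integral_mul_const, intervalIntegral.integral_of_le ht]
  calc _ = ∫ u in Ioc 0 t, ∫ r in Ioi 0, r ^ (-β) * Real.exp (-(u * r)) * f (t - u) := by
        refine setIntegral_congr_fun measurableSet_Ioc fun u hu => ?_
        rw [integral_mul_const, integral_rpow_neg_mul_exp_neg_mul hβ₁ hu.1]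
        ring
    _ = _ := h
    _ = _ := by
        refine setIntegral_congr_fun measurableSet_Ioi fun r _ => ?_
        simp only [mul_assoc]
        rw [integral_const_mul, expConv, intervalIntegral.integral_of_le ht]

theorem integrable_rpow_mul_mul_expConv {β : ℝ} (hβ₀ : 0 < β) (hβ₁ : β < 1) {f : ℝ → ℝ}
    (hf : Continuous f) {T : ℝ} (hT : 0 ≤ T) :
    Integrable (Function.uncurry fun t r : ℝ => r ^ (-β) * (f t * expConv f t r))
      ((volume.restrict (Ioc 0 T)).prod (volume.restrict (Ioi 0))) := by
  obtain ⟨M, hM⟩ := (isCompact_Icc (a := (0 : ℝ)) (b := T)).exists_bound_of_continuousOn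
    hf.continuousOn
  have hM₀ : 0 ≤ M := (norm_nonneg _).trans (hM 0 ⟨le_rfl, hT⟩)
  have hB := (integrable_rpow_neg_mul_exp_neg_mul_prod hβ₀ hβ₁ hT).integral_prod_right
  have hB' := (hB.comp_snd (volume.restrict (Ioc 0 T))).const_mul (M * M)
  have hmeas : AEStronglyMeasurable
      (Function.uncurry fun t r : ℝ => r ^ (-β) * (f t * expConv f t r))
      ((volume.restrict (Ioc 0 T)).prod (volume.restrict (Ioi 0))) := by
    have h₁ : Measurable fun p : ℝ × ℝ => expConv f p.1 p.2 := (continuous_expConv hf).measurable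
    have h₂ : Measurable f := hf.measurable
    have h₃ : Measurable fun p : ℝ × ℝ => p.2 ^ (-β) * (f p.1 * expConv f p.1 p.2) := by fun_prop
    exact h₃.aestronglyMeasurable
  refine hB'.mono' hmeas ?_
  have : ∀ᵐ p : ℝ × ℝ ∂(volume.restrict (Ioc 0 T)).prod (volume.restrict (Ioi 0)),
      p ∈ Ioc 0 T ×ˢ Ioi (0 : ℝ) := by
    rw [Measure.prod_restrict]
    exact ae_restrict_mem (measurableSet_Ioc.prod measurableSet_Ioi)
  filter_upwards [this] with ⟨t, r⟩ ⟨ht, hr⟩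
  simp only [mem_Ioc, mem_Ioi, Function.uncurry_apply_pair] at ht hr ⊢
  have hE : ‖expConv f t r‖ ≤ M * ∫ u in Ioc 0 T, Real.exp (-(u * r)) := by
    calc ‖expConv f t r‖ ≤ ∫ u in (0 : ℝ)..t, M * Real.exp (-(u * r)) := by
          refine intervalIntegral.norm_integral_le_of_norm_le ht.1.le ?_
            (Continuous.intervalIntegrable (by fun_prop) _ _)
          refine Eventually.of_forall fun u hu => ?_
          rw [norm_mul, Real.norm_of_nonneg (Real.exp_pos _).le, mul_comm]
          gcongr
          exact hM _ ⟨by linarith [hu.2], by linarith [hu.1, ht.2]⟩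
      _ ≤ ∫ u in (0 : ℝ)..T, M * Real.exp (-(u * r)) :=
          intervalIntegral.integral_mono_interval le_rfl ht.1.le ht.2
            (Eventually.of_forall fun u => by positivity)
            (Continuous.intervalIntegrable (by fun_prop) _ _)
      _ = _ := by rw [intervalIntegral.integral_const_mul, intervalIntegral.integral_of_le hT]
  rw [norm_mul, norm_mul, Real.norm_of_nonneg (by positivity), integral_const_mul]
  calc r ^ (-β) * (‖f t‖ * ‖expConv f t r‖)
      ≤ r ^ (-β) * (M * (M * ∫ u in Ioc 0 T, Real.exp (-(u * r)))) := by
        gcongr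
        exact hM t ⟨ht.1.le, ht.2⟩
    _ = _ := by ring

/-- The kernel `u ^ (β - 1)`, `0 < β < 1`, is positive definite. -/
theorem integral_mul_integral_rpow_nonneg {β : ℝ} (hβ₀ : 0 < β) (hβ₁ : β < 1) {f : ℝ → ℝ}
    (hf : Continuous f) {T : ℝ} (hT : 0 ≤ T) :
    0 ≤ ∫ t in (0 : ℝ)..T, f t * ∫ u in (0 : ℝ)..t, u ^ (β - 1) * f (t - u) := by
  have hΓ : 0 < Real.Gamma (1 - β) := Real.Gamma_pos_of_pos (by linarith)
  refine nonneg_of_mul_nonneg_left ?_ hΓ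
  have h := integral_integral_swap (integrable_rpow_mul_mul_expConv hβ₀ hβ₁ hf hT)
  rw [← intervalIntegral.integral_mul_const, intervalIntegral.integral_of_le hT]
  calc (0 : ℝ) ≤ ∫ r in Ioi 0, ∫ t in Ioc 0 T, r ^ (-β) * (f t * expConv f t r) := by
        refine setIntegral_nonneg measurableSet_Ioi fun r hr => ?_
        have hr : (0 : ℝ) < r := hr
        rw [integral_const_mul, ← intervalIntegral.integral_of_le hT]
        have := integral_mul_expConv_nonneg hf hT hr.le
        positivity
    _ = _ := h.symm
    _ = _ := by
        refine setIntegral_congr_fun measurableSet_Ioc fun t ht => ?_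
        rw [mul_assoc, integral_rpow_mul_comp_sub hβ₀ hβ₁ hf ht.1.le, ← integral_const_mul]
        congr 1 with r
        ring

theorem integral_rpow_mul_sub_rpow {p q t : ℝ} (hp : 0 < p) (hq : 0 < q) (ht : 0 < t) :
    ∫ u in (0 : ℝ)..t, u ^ (p - 1) * (t - u) ^ (q - 1) =
      t ^ (p + q - 1) * ProbabilityTheory.beta p q := by
  have h := Complex.betaIntegral_scaled p q ht
  have hB : Complex.betaIntegral p q = (ProbabilityTheory.beta p q : ℝ) := by
    rw [Complex.betaIntegral_eq_Gamma_mul_div _ _ (by simpa) (by simpa), ProbabilityTheory.beta,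
      ← Complex.ofReal_add, Complex.Gamma_ofReal, Complex.Gamma_ofReal, Complex.Gamma_ofReal]
    norm_cast
  rw [hB] at h
  apply Complex.ofReal_injective
  rw [← intervalIntegral.integral_ofReal]
  refine Eq.trans (intervalIntegral.integral_congr fun u hu => ?_) (h.trans ?_)
  · rw [uIcc_of_le ht.le] at hu
    simp only [Complex.ofReal_mul, Complex.ofReal_cpow hu.1,
      Complex.ofReal_cpow (sub_nonneg.2 hu.2)]
    push_cast
    rfl
  · rw [Complex.ofReal_mul, Complex.ofReal_cpow ht.le]
    push_cast
    rfl

theorem intervalIntegrable_rpow_mul_sub_rpow {p q t : ℝ} (hp : 0 < p) (hq : 0 < q) (ht : 0 < t) :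
    IntervalIntegrable (fun u : ℝ => u ^ (p - 1) * (t - u) ^ (q - 1)) volume 0 t := by
  refine intervalIntegral.intervalIntegrable_of_integral_ne_zero ?_
  rw [integral_rpow_mul_sub_rpow hp hq ht]
  have := ProbabilityTheory.beta_pos hp hq
  positivity

/-- The terms of the series expansion of `t ^ (b - 1) * E_{a,b}(-t ^ a)`. -/
noncomputable def mlTerm (a b : ℝ) (k : ℕ) (t : ℝ) : ℝ :=
  (-1) ^ k * t ^ (a * k + b - 1) / Real.Gamma (a * k + b)

/-- The real function `t ^ (b - 1) * E_{a,b}(-t ^ a)`, as a series. -/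
noncomputable def mlSeries (a b t : ℝ) : ℝ := ∑' k, mlTerm a b k t

theorem factorial_le_Gamma {a b : ℝ} (ha : 1 ≤ a) (hb : 1 ≤ b) {k : ℕ} (hk : k ≠ 0) :
    (k.factorial : ℝ) ≤ Real.Gamma (a * k + b) := by
  have hk' : (1 : ℝ) ≤ k := by exact_mod_cast Nat.one_le_iff_ne_zero.2 hk
  have h : (k : ℝ) + 1 ≤ a * k + b := by nlinarith
  rw [← Real.Gamma_nat_eq_factorial]
  exact Real.Gamma_strictMonoOn_Ici.monotoneOn (mem_Ici.2 (by linarith))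
    (mem_Ici.2 (by linarith)) h

theorem inv_Gamma_le {a b : ℝ} (ha : 1 ≤ a) (hb : 1 ≤ b) (k : ℕ) :
    (Real.Gamma (a * k + b))⁻¹ ≤ (1 + (Real.Gamma b)⁻¹) / k.factorial := by
  have hΓ : 0 < Real.Gamma b := Real.Gamma_pos_of_pos (by linarith)
  rcases eq_or_ne k 0 with rfl | hk
  · simp
  · have hk' : (0 : ℝ) < k.factorial := by positivity
    calc (Real.Gamma (a * k + b))⁻¹ ≤ (k.factorial : ℝ)⁻¹ :=
          inv_anti₀ hk' (factorial_le_Gamma ha hb hk)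
      _ = 1 / k.factorial := (one_div _).symm
      _ ≤ _ := by
        gcongr
        linarith [inv_pos.2 hΓ]

theorem norm_mlTerm_le {a b : ℝ} (ha : 1 ≤ a) (hb : 1 ≤ b) {R t : ℝ} (hR : 0 < R) (ht : |t| ≤ R)
    (k : ℕ) : ‖mlTerm a b k t‖ ≤
      R ^ (b - 1) * (1 + (Real.Gamma b)⁻¹) * ((R ^ a) ^ k / k.factorial) := by
  have hk : 0 ≤ a * k := by positivity
  have hΓ : 0 < Real.Gamma (a * k + b) := Real.Gamma_pos_of_pos (by linarith)
  have h₁ : |t ^ (a * k + b - 1)| ≤ R ^ (a * k + b - 1) :=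
    (Real.abs_rpow_le_abs_rpow _ _).trans
      (Real.rpow_le_rpow (abs_nonneg _) ht (by linarith))
  rw [mlTerm, norm_div, norm_mul, norm_pow, norm_neg, norm_one, one_pow, one_mul,
    Real.norm_of_nonneg hΓ.le, Real.norm_eq_abs, div_eq_mul_inv]
  calc _ ≤ R ^ (a * k + b - 1) * ((1 + (Real.Gamma b)⁻¹) / k.factorial) := by
        gcongr
        exact inv_Gamma_le ha hb k
    _ = _ := by
        rw [add_sub_assoc, Real.rpow_add hR, Real.rpow_mul hR.le, Real.rpow_natCast]
        ring

theorem summable_mlTerm_bound (C x : ℝ) :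
    Summable fun k : ℕ => C * (x ^ k / k.factorial) :=
  (Real.summable_pow_div_factorial x).mul_left C

theorem summable_mlTerm {a b : ℝ} (ha : 1 ≤ a) (hb : 1 ≤ b) (t : ℝ) :
    Summable fun k => mlTerm a b k t :=
  .of_norm_bounded (summable_mlTerm_bound _ _)
    (norm_mlTerm_le ha hb (R := |t| + 1) (by positivity) (by linarith))

theorem continuous_mlSeries {a b : ℝ} (ha : 1 ≤ a) (hb : 1 ≤ b) : Continuous (mlSeries a b) := by
  rw [continuous_iff_continuousAt]
  intro t
  have hR : 0 < |t| + 1 := by positivity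
  refine (continuousOn_tsum (s := Ioo (-(|t| + 1)) (|t| + 1)) (fun k => ?_)
    (summable_mlTerm_bound _ _) (fun k y hy =>
      norm_mlTerm_le ha hb hR (abs_le.2 ⟨hy.1.le, hy.2.le⟩) k)).continuousAt
    (Ioo_mem_nhds (by linarith [neg_abs_le t]) (by linarith [le_abs_self t]))
  have hk : 0 ≤ a * k := by positivity
  have : Continuous fun t : ℝ => t ^ (a * k + b - 1) :=
    Real.continuous_rpow_const (by linarith)
  unfold mlTerm
  fun_prop

theorem hasDerivAt_mlTerm {a b : ℝ} (ha : 1 ≤ a) (hb : 1 ≤ b) (k : ℕ) (t : ℝ) :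
    HasDerivAt (mlTerm a (b + 1) k) (mlTerm a b k t) t := by
  have hk : 0 ≤ a * k := by positivity
  have hpos : 0 < a * k + b := by linarith
  have hΓ : 0 < Real.Gamma (a * k + b) := Real.Gamma_pos_of_pos hpos
  have h := (((Real.hasDerivAt_rpow_const (x := t) (p := a * k + (b + 1) - 1)
    (Or.inr (by linarith))).const_mul ((-1) ^ k)).div_const (Real.Gamma (a * k + (b + 1))))
  refine h.congr_deriv ?_
  rw [mlTerm, ← add_assoc, Real.Gamma_add_one hpos.ne', add_sub_cancel_right]
  field_simp

theorem hasDerivAt_mlSeries {a b : ℝ} (ha : 1 ≤ a) (hb : 1 ≤ b) (t : ℝ) :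
    HasDerivAt (mlSeries a (b + 1)) (mlSeries a b t) t := by
  have hR : 0 < |t| + 1 := by positivity
  exact hasDerivAt_tsum_of_isPreconnected (t := Ioo (-(|t| + 1)) (|t| + 1)) (y₀ := t)
    (summable_mlTerm_bound _ _) isOpen_Ioo isPreconnected_Ioo
    (fun k y _ => hasDerivAt_mlTerm ha hb k y)
    (fun k y hy => norm_mlTerm_le ha hb hR (abs_le.2 ⟨hy.1.le, hy.2.le⟩) k)
    ⟨by linarith [neg_abs_le t], by linarith [le_abs_self t]⟩
    (summable_mlTerm ha (by linarith) t)
    ⟨by linarith [neg_abs_le t], by linarith [le_abs_self t]⟩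

theorem mlSeries_one_eq {a : ℝ} (ha : 1 ≤ a) (t : ℝ) :
    mlSeries a 1 t = 1 - mlSeries a (a + 1) t := by
  have h : ∀ k : ℕ, mlTerm a 1 (k + 1) t = -mlTerm a (a + 1) k t := fun k => by
    simp only [mlTerm]
    rw [show a * ((k + 1 : ℕ) : ℝ) + 1 = a * k + (a + 1) by push_cast; ring]
    ring
  rw [mlSeries, (summable_mlTerm ha le_rfl t).tsum_eq_zero_add]
  simp only [h, tsum_neg, mlSeries]
  simp [mlTerm, sub_eq_add_neg]

theorem mlSeries_add_one_zero {a : ℝ} (ha : 1 ≤ a) : mlSeries a (a + 1) 0 = 0 := by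
  have h : ∀ k, mlTerm a (a + 1) k 0 = 0 := fun k => by
    have hk : 0 ≤ a * k := by positivity
    rw [mlTerm, Real.zero_rpow (by linarith)]
    simp
  simp [mlSeries, h]

theorem integral_rpow_mul_mlTerm {a b p : ℝ} (ha : 0 < a) (hb : 0 < b) (hp : 0 < p) {t : ℝ}
    (ht : 0 < t) (k : ℕ) :
    ∫ u in (0 : ℝ)..t, u ^ (p - 1) * mlTerm a b k (t - u) =
      Real.Gamma p * mlTerm a (b + p) k t := by
  have hq : 0 < a * k + b := by positivity
  have hΓ : 0 < Real.Gamma (a * k + b) := Real.Gamma_pos_of_pos hq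
  have hc : ∀ u : ℝ, u ^ (p - 1) * mlTerm a b k (t - u) =
      (-1) ^ k / Real.Gamma (a * k + b) * (u ^ (p - 1) * (t - u) ^ (a * k + b - 1)) := fun u => by
    rw [mlTerm]; ring
  simp_rw [hc]
  rw [intervalIntegral.integral_const_mul, integral_rpow_mul_sub_rpow hp hq ht,
    ProbabilityTheory.beta, mlTerm, show p + (a * k + b) = a * k + (b + p) by ring]
  field_simp

theorem intervalIntegrable_rpow_mul_mlTerm {a b p : ℝ} (ha : 0 < a) (hb : 0 < b) (hp : 0 < p)
    {t : ℝ} (ht : 0 < t) (k : ℕ) :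
    IntervalIntegrable (fun u => u ^ (p - 1) * mlTerm a b k (t - u)) volume 0 t := by
  refine ((intervalIntegrable_rpow_mul_sub_rpow hp (q := a * k + b) (by positivity) ht).const_mul
    ((-1) ^ k / Real.Gamma (a * k + b))).congr fun u _ => ?_
  simp only [mlTerm]
  ring

/-- Fractional integration raises the second parameter. -/
theorem integral_rpow_mul_mlSeries {a b p : ℝ} (ha : 1 ≤ a) (hb : 1 ≤ b) (hp : 0 < p) {t : ℝ}
    (ht : 0 < t) :
    ∫ u in (0 : ℝ)..t, u ^ (p - 1) * mlSeries a b (t - u) =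
      Real.Gamma p * mlSeries a (b + p) t := by
  have ha' : 0 < a := by linarith
  have hb' : 0 < b := by linarith
  have hnorm : ∀ k, ∫ u in Ioc 0 t, ‖u ^ (p - 1) * mlTerm a b k (t - u)‖ =
      Real.Gamma p * ‖mlTerm a (b + p) k t‖ := fun k => by
    have h := integral_rpow_mul_mlTerm ha' hb' hp ht k
    have hΓk : ∀ c, 0 < c → 0 < Real.Gamma (a * k + c) := fun c hc =>
      Real.Gamma_pos_of_pos (by positivity)
    have habs : ∀ c s : ℝ, 0 < c → 0 ≤ s → ‖mlTerm a c k s‖ = (-1) ^ k * mlTerm a c k s := by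
      intro c s hc hs
      have := hΓk c hc
      rw [mlTerm, norm_div, norm_mul, norm_pow, norm_neg, norm_one, one_pow, one_mul,
        Real.norm_of_nonneg (by positivity), Real.norm_of_nonneg this.le, ← mul_div_assoc,
        ← mul_assoc, ← mul_pow]
      simp
    rw [habs _ _ (by linarith) ht.le, mul_left_comm, ← h,
      intervalIntegral.integral_of_le ht.le, ← integral_const_mul]
    refine setIntegral_congr_fun measurableSet_Ioc fun u hu => ?_
    have hu₀ : 0 < u := hu.1
    change ‖u ^ (p - 1) * mlTerm a b k (t - u)‖ = (-1) ^ k * (u ^ (p - 1) * mlTerm a b k (t - u))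
    rw [norm_mul, habs _ _ hb' (sub_nonneg.2 hu.2), Real.norm_of_nonneg (by positivity)]
    ring
  have h := (hasSum_integral_of_summable_integral_norm
    (F := fun k u => u ^ (p - 1) * mlTerm a b k (t - u)) (μ := volume.restrict (Ioc 0 t))
    (fun k => (intervalIntegrable_iff_integrableOn_Ioc_of_le ht.le).1
      (intervalIntegrable_rpow_mul_mlTerm ha' hb' hp ht k))
    (by
      simp only [hnorm]
      exact (summable_mlTerm ha (by linarith) t).norm.mul_left _)).tsum_eq
  simp only [tsum_mul_left, ← intervalIntegral.integral_of_le ht.le,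
    integral_rpow_mul_mlTerm ha' hb' hp ht] at h
  exact h.symm

/-- Energy estimate for the fractional oscillation equation. -/
theorem mlSeries_one_sq_le {a : ℝ} (ha₁ : 1 < a) (ha₂ : a < 2) {T : ℝ} (hT : 0 ≤ T) :
    mlSeries a 1 T ^ 2 ≤ 1 := by
  have hf : Continuous (mlSeries a 1) := continuous_mlSeries ha₁.le le_rfl
  have hh : Continuous (mlSeries a a) := continuous_mlSeries ha₁.le ha₁.le
  have hΓ : 0 < Real.Gamma (a - 1) := Real.Gamma_pos_of_pos (by linarith)
  have hone : mlSeries a 1 = fun t => 1 - mlSeries a (a + 1) t := funext (mlSeries_one_eq ha₁.le)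
  have hd : ∀ t, HasDerivAt (fun t => mlSeries a 1 t ^ 2) (-2 * (mlSeries a 1 t * mlSeries a a t))
      t := fun t => by
    have h : HasDerivAt (mlSeries a 1) (-mlSeries a a t) t := by
      rw [hone]
      exact (hasDerivAt_mlSeries ha₁.le ha₁.le t).const_sub 1
    refine (h.pow 2).congr_deriv ?_
    ring
  have hi := intervalIntegral.integral_eq_sub_of_hasDerivAt (a := 0) (b := T) (fun t _ => hd t)
    (Continuous.intervalIntegrable (by fun_prop) _ _)
  have h₀ : mlSeries a 1 0 = 1 := by
    rw [mlSeries_one_eq ha₁.le, mlSeries_add_one_zero ha₁.le, sub_zero]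
  have hpos := integral_mul_integral_rpow_nonneg (β := a - 1) (by linarith) (by linarith) hf hT
  have hconv : ∫ t in (0 : ℝ)..T, mlSeries a 1 t *
        ∫ u in (0 : ℝ)..t, u ^ (a - 1 - 1) * mlSeries a 1 (t - u) =
      Real.Gamma (a - 1) * ∫ t in (0 : ℝ)..T, mlSeries a 1 t * mlSeries a a t := by
    rw [← intervalIntegral.integral_const_mul, intervalIntegral.integral_of_le hT,
      intervalIntegral.integral_of_le hT]
    refine setIntegral_congr_fun measurableSet_Ioc fun t ht => ?_
    simp only [integral_rpow_mul_mlSeries ha₁.le le_rfl (sub_pos.2 ha₁) ht.1, add_sub_cancel]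
    ring
  rw [hconv] at hpos
  have := nonneg_of_mul_nonneg_right hpos hΓ
  rw [intervalIntegral.integral_const_mul, h₀] at hi
  linarith

theorem mul_mittagLeffler_eq_mlSeries {a : ℝ} (ha : 0 < a) {x : ℝ} (hx : 0 ≤ x) :
    (x : ℂ) * mittagLeffler a (a + 1) (-(x : ℂ)) = (mlSeries a (a + 1) (x ^ a⁻¹) : ℝ) := by
  rw [mittagLeffler, mlSeries, Complex.ofReal_tsum, ← tsum_mul_left]
  refine tsum_congr fun k => ?_
  have h : (x ^ a⁻¹) ^ (a * k + (a + 1) - 1) = x ^ (k + 1) := by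
    rw [← Real.rpow_mul hx, ← Real.rpow_natCast]
    congr 1
    push_cast
    field_simp
    ring
  rw [mlTerm, h, neg_pow]
  push_cast
  ring

/-- For 1 < a < 2, the function x -> x*E_{a,a+1}(-x) is bounded on [0,infty). -/
theorem mittagLeffler_neg_arg_bounded (α : ℝ) (hα₁ : 1 < α) (hα₂ : α < 2) :
    ∃ C : ℝ, 0 < C ∧ ∀ x : ℝ, 0 ≤ x →
      ‖(x : ℂ) * mittagLeffler α (α + 1) (-(x : ℂ))‖ ≤ C := by
  refine ⟨2, two_pos, fun x hx => ?_⟩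
  have hT : 0 ≤ x ^ α⁻¹ := Real.rpow_nonneg hx _
  have h := abs_le.1 ((sq_le_one_iff_abs_le_one _).1 (mlSeries_one_sq_le hα₁ hα₂ hT))
  rw [mlSeries_one_eq hα₁.le] at h
  rw [mul_mittagLeffler_eq_mlSeries (by linarith) hx, Complex.norm_real, Real.norm_eq_abs]
  exact abs_le.2 ⟨by linarith, by linarith⟩
end

section
/- Let 1<α<2. There exists a constant C>0 such that for all real x ≥ 1, |x E_{α,α+1}(−x) − 1| ≤ C/x. (This is the quantitative form of the asymptotic relation E_{α,α+1}(z) = −1/z + O(|z|^{−2}) as z → −∞.) -/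
open MeasureTheory Filter Set

theorem integrable_exp_mul_exp_add {c b : ℝ} (hc : c < 0) (hb : 0 < b) :
    Integrable fun u : ℝ => Real.exp (c * Real.exp u + b * u) := by
  have h := (integrableOn_image_iff_integrableOn_abs_deriv_smul (f := Real.exp) (f' := Real.exp)
    MeasurableSet.univ (fun x _ => (Real.hasDerivAt_exp x).hasDerivWithinAt)
    Real.exp_injective.injOn (fun r : ℝ => r ^ (b - 1) * Real.exp (-(-c) * r ^ (1 : ℝ)))).1 (by
      rw [image_univ, Real.range_exp]
      exact integrableOn_rpow_mul_exp_neg_mul_rpow (by linarith) one_pos (by linarith))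
  rw [integrableOn_univ] at h
  refine h.congr (ae_of_all _ fun u => ?_)
  simp only [smul_eq_mul, Real.rpow_one, neg_neg, Real.abs_exp, ← Real.exp_mul, ← Real.exp_add]
  congr 1
  ring

theorem integrableOn_exp_mul_exp_add {c : ℝ} (hc : c < 0) (b U : ℝ) :
    IntegrableOn (fun u : ℝ => Real.exp (c * Real.exp u + b * u)) (Ioi U) := by
  refine ((integrable_exp_mul_exp_add hc (b := |b| + 1) (by positivity)).integrableOn.const_mul
    (Real.exp ((b - (|b| + 1)) * U))).mono' (by fun_prop) ?_
  refine (ae_restrict_iff' measurableSet_Ioi).2 (ae_of_all _ fun u hu => ?_)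
  rw [Real.norm_eq_abs, Real.abs_exp, ← Real.exp_add, Real.exp_le_exp]
  nlinarith [le_abs_self b, mem_Ioi.1 hu]

/-- The integrand `e ^ σ * σ ^ (-z - 1) dσ` of Hankel's formula for `1 / Γ (z + 1)`, in the
logarithmic coordinate `σ = e ^ w`. -/
noncomputable def hankelKernel (z : ℝ) (w : ℂ) : ℂ := Complex.exp (Complex.exp w - z * w)

/-- The integral of `Φ` along the boundary of the half-strip `re w > U`, `|im w| < θ`: the image
under `log` of a Hankel contour. -/
noncomputable def hankelIntegral (θ U : ℝ) (Φ : ℂ → ℂ) : ℂ :=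
  Complex.I * (∫ v : ℝ in (-θ)..θ, Φ (U + v * Complex.I)) +
    ((∫ u : ℝ in Ioi U, Φ (u + θ * Complex.I)) -
      ∫ u : ℝ in Ioi U, Φ (u + (-θ : ℝ) * Complex.I))

@[fun_prop]
theorem continuous_hankelKernel (z : ℝ) : Continuous (hankelKernel z) := by
  unfold hankelKernel; fun_prop

theorem norm_hankelKernel (z u v : ℝ) :
    ‖hankelKernel z (u + v * Complex.I)‖ = Real.exp (Real.cos v * Real.exp u + -z * u) := by
  rw [hankelKernel, Complex.norm_exp]
  simp [Complex.exp_re]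
  ring

theorem integrableOn_hankelKernel {η : ℝ} (hη : Real.cos η < 0) (z U : ℝ) :
    IntegrableOn (fun u : ℝ => hankelKernel z (u + η * Complex.I)) (Ioi U) := by
  refine (integrableOn_exp_mul_exp_add hη (-z) U).mono' ?_ (ae_of_all _ fun u => ?_)
  · exact Continuous.aestronglyMeasurable (by fun_prop)
  · rw [norm_hankelKernel]

theorem integrable_hankelKernel {η : ℝ} (hη : Real.cos η < 0) {z : ℝ} (hz : z < 0) :
    Integrable (fun u : ℝ => hankelKernel z (u + η * Complex.I)) := by
  refine (integrable_exp_mul_exp_add hη (b := -z) (by linarith)).mono' ?_ (ae_of_all _ fun u => ?_)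
  · exact Continuous.aestronglyMeasurable (by fun_prop)
  · rw [norm_hankelKernel]

theorem hasDerivAt_hankelKernel (z : ℝ) (w : ℂ) :
    HasDerivAt (hankelKernel z) (hankelKernel (z - 1) w - z * hankelKernel z w) w := by
  have h : HasDerivAt (fun w => Complex.exp w - z * w) (Complex.exp w - z * 1) w :=
    (Complex.hasDerivAt_exp w).sub ((hasDerivAt_id w).const_mul (z : ℂ))
  have h1 : hankelKernel (z - 1) w = hankelKernel z w * Complex.exp w := by
    rw [hankelKernel, hankelKernel, ← Complex.exp_add]; congr 1; push_cast; ring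
  refine h.cexp.congr_deriv ?_
  rw [h1, hankelKernel]
  ring

theorem tendsto_exp_mul_exp_add_atTop {c : ℝ} (hc : c < 0) (b : ℝ) :
    Tendsto (fun u : ℝ => Real.exp (c * Real.exp u + b * u)) atTop (nhds 0) := by
  refine Real.tendsto_exp_atBot.comp ?_
  have h : (fun u : ℝ => c * Real.exp u + b * u)
      = fun u : ℝ => Real.exp u * (c + b * (u ^ 1 * Real.exp (-u))) := by
    ext u
    have : Real.exp u * Real.exp (-u) = 1 := by rw [← Real.exp_add]; simp
    linear_combination (-b * u) * this
  rw [h]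
  refine Real.tendsto_exp_atTop.atTop_mul_neg hc ?_
  simpa using ((Real.tendsto_pow_mul_exp_neg_atTop_nhds_zero 1).const_mul b).const_add c

theorem tendsto_hankelKernel_atTop {η : ℝ} (hη : Real.cos η < 0) (z : ℝ) :
    Tendsto (fun u : ℝ => hankelKernel z (u + η * Complex.I)) atTop (nhds 0) := by
  rw [tendsto_zero_iff_norm_tendsto_zero]
  simp only [norm_hankelKernel]
  exact tendsto_exp_mul_exp_add_atTop hη (-z)

/-- The contour integral of a total derivative vanishes. -/
theorem hankelIntegral_hankelKernel_sub_one {θ : ℝ} (hθ : Real.cos θ < 0) (U z : ℝ) :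
    hankelIntegral θ U (hankelKernel (z - 1)) = z * hankelIntegral θ U (hankelKernel z) := by
  have ray : ∀ η : ℝ, Real.cos η < 0 →
      (∫ u : ℝ in Ioi U, hankelKernel (z - 1) (u + η * Complex.I)) -
        z * ∫ u : ℝ in Ioi U, hankelKernel z (u + η * Complex.I)
      = -hankelKernel z (U + η * Complex.I) := by
    intro η hη
    rw [← integral_const_mul, ← integral_sub (integrableOn_hankelKernel hη _ _)
      ((integrableOn_hankelKernel hη _ _).const_mul _)]
    rw [integral_Ioi_of_hasDerivAt_of_tendsto
      (f := fun u : ℝ => hankelKernel z (u + η * Complex.I)) (m := 0)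
      (Continuous.continuousWithinAt (by fun_prop)) ?_ ?_ (tendsto_hankelKernel_atTop hη z)]
    · simp
    · intro u _
      exact ((hasDerivAt_hankelKernel z _).comp_add_const (u : ℂ) (η * Complex.I)).comp_ofReal
    · exact (integrableOn_hankelKernel hη _ _).sub ((integrableOn_hankelKernel hη _ _).const_mul _)
  have vert : Complex.I * (∫ v : ℝ in (-θ)..θ, hankelKernel (z - 1) (U + v * Complex.I)) -
        z * (Complex.I * ∫ v : ℝ in (-θ)..θ, hankelKernel z (U + v * Complex.I))
      = hankelKernel z (U + θ * Complex.I) - hankelKernel z (U + (-θ : ℝ) * Complex.I) := by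
    have hi : ∀ y : ℝ, IntervalIntegrable
        (fun v : ℝ => hankelKernel y (U + v * Complex.I)) volume (-θ) θ :=
      fun y => Continuous.intervalIntegrable (by fun_prop) _ _
    rw [← intervalIntegral.integral_eq_sub_of_hasDerivAt
      (f := fun v : ℝ => hankelKernel z (U + v * Complex.I))
      (f' := fun v : ℝ => (hankelKernel (z - 1) (U + v * Complex.I) -
        z * hankelKernel z (U + v * Complex.I)) * Complex.I)]
    · rw [intervalIntegral.integral_mul_const, intervalIntegral.integral_sub (hi _)
        ((hi _).const_mul _), intervalIntegral.integral_const_mul]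
      ring
    · intro v _
      have h1 : HasDerivAt (fun v : ℂ => (U : ℂ) + v * Complex.I) Complex.I (v : ℂ) := by
        simpa using ((hasDerivAt_id (v : ℂ)).mul_const Complex.I).const_add (U : ℂ)
      exact ((hasDerivAt_hankelKernel z _).comp (v : ℂ) h1).comp_ofReal
    · exact Continuous.intervalIntegrable (by fun_prop) _ _
  have h1 := ray θ hθ
  have h2 := ray (-θ) (by rwa [Real.cos_neg])
  simp only [hankelIntegral]
  linear_combination vert + h1 - h2

/-- Cauchy's theorem on the half-strip `re w < U` between `im w = a` and `im w = b`. -/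
theorem integral_vertical_eq_sub_integral_Iic {Φ : ℂ → ℂ} {N : ℝ → ℝ} {a b U : ℝ}
    (hd : ∀ w : ℂ, w.im ∈ uIcc a b → DifferentiableAt ℂ Φ w)
    (hN : ∀ u ≤ U, ∀ v ∈ uIcc a b, ‖Φ (u + v * Complex.I)‖ ≤ N u)
    (hint : IntegrableOn N (Iic U)) (hlim : Tendsto N atBot (nhds 0)) :
    Complex.I * (∫ v : ℝ in a..b, Φ (U + v * Complex.I)) =
      (∫ u : ℝ in Iic U, Φ (u + b * Complex.I)) - ∫ u : ℝ in Iic U, Φ (u + a * Complex.I) := by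
  have hcont : ∀ η ∈ uIcc a b, Continuous fun u : ℝ => Φ (u + η * Complex.I) := by
    intro η hη
    refine continuous_iff_continuousAt.2 fun u => ?_
    exact (hd (u + η * Complex.I) (by simpa using hη)).continuousAt.comp
      (f := fun u : ℝ => (u + η * Complex.I : ℂ)) (by fun_prop)
  have hray : ∀ η ∈ uIcc a b, Tendsto (fun A : ℝ => ∫ u : ℝ in A..U, Φ (u + η * Complex.I)) atBot
      (nhds (∫ u : ℝ in Iic U, Φ (u + η * Complex.I))) := by
    intro η hη
    refine intervalIntegral_tendsto_integral_Iic U ?_ tendsto_id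
    refine hint.mono' (hcont η hη).aestronglyMeasurable ?_
    exact (ae_restrict_iff' measurableSet_Iic).2 (ae_of_all _ fun u hu => hN u hu η hη)
  have hvert : Tendsto (fun A : ℝ => Complex.I * ∫ v : ℝ in a..b, Φ (A + v * Complex.I)) atBot
      (nhds 0) := by
    refine squeeze_zero_norm' (a := fun A => N A * |b - a|) ?_ (by simpa using hlim.mul_const |b - a|)
    filter_upwards [eventually_le_atBot U] with A hA
    rw [norm_mul, Complex.norm_I, one_mul]
    exact intervalIntegral.norm_integral_le_of_norm_le_const fun v hv =>
      hN A hA v (uIoc_subset_uIcc hv)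
  have hrect : ∀ A : ℝ, (∫ u : ℝ in A..U, Φ (u + b * Complex.I)) -
      (∫ u : ℝ in A..U, Φ (u + a * Complex.I)) +
        Complex.I * (∫ v : ℝ in a..b, Φ (A + v * Complex.I)) =
      Complex.I * ∫ v : ℝ in a..b, Φ (U + v * Complex.I) := by
    intro A
    have h := Complex.integral_boundary_rect_eq_zero_of_differentiableOn Φ
      (A + a * Complex.I) (U + b * Complex.I) (fun w hw =>
        (hd w (by simpa using (Complex.mem_reProdIm.1 hw).2)).differentiableWithinAt)
    simp only [Complex.add_re, Complex.add_im, Complex.ofReal_re, Complex.ofReal_im,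
      Complex.re_ofReal_mul, Complex.im_ofReal_mul, Complex.I_re, Complex.I_im, mul_zero, mul_one,
      add_zero, zero_add, smul_eq_mul] at h
    linear_combination -h
  have hlim' := ((hray b right_mem_uIcc).sub (hray a left_mem_uIcc)).add hvert
  simp only [hrect, add_zero] at hlim'
  exact tendsto_nhds_unique tendsto_const_nhds hlim'

theorem hankelIntegral_eq_integral_sub_integral {Φ : ℂ → ℂ} {N : ℝ → ℝ} {θ U : ℝ}
    (hd : ∀ w : ℂ, w.im ∈ uIcc (-θ) θ → DifferentiableAt ℂ Φ w)
    (hN : ∀ u ≤ U, ∀ v ∈ uIcc (-θ) θ, ‖Φ (u + v * Complex.I)‖ ≤ N u)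
    (hint : IntegrableOn N (Iic U)) (hlim : Tendsto N atBot (nhds 0))
    (h₁ : Integrable fun u : ℝ => Φ (u + θ * Complex.I))
    (h₂ : Integrable fun u : ℝ => Φ (u + (-θ : ℝ) * Complex.I)) :
    hankelIntegral θ U Φ =
      (∫ u : ℝ, Φ (u + θ * Complex.I)) - ∫ u : ℝ, Φ (u + (-θ : ℝ) * Complex.I) := by
  rw [hankelIntegral, integral_vertical_eq_sub_integral_Iic hd hN hint hlim,
    ← intervalIntegral.integral_Iic_add_Ioi h₁.integrableOn h₁.integrableOn (b := U),
    ← intervalIntegral.integral_Iic_add_Ioi h₂.integrableOn h₂.integrableOn (b := U)]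
  ring

theorem tendsto_exp_mul_atBot {b : ℝ} (hb : 0 < b) (M : ℝ) :
    Tendsto (fun u : ℝ => M * Real.exp (b * u)) atBot (nhds 0) := by
  simpa using (Real.tendsto_exp_atBot.comp (tendsto_id.const_mul_atBot hb)).const_mul M

theorem differentiable_hankelKernel (z : ℝ) : Differentiable ℂ (hankelKernel z) :=
  fun w => (hasDerivAt_hankelKernel z w).differentiableAt

/-- Rotation of a ray within the left half-plane. -/
theorem integral_hankelKernel_line_eq {a b z c : ℝ} (hz : z < 0) (hc : c < 0)
    (hab : ∀ v ∈ uIcc a b, Real.cos v ≤ c) :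
    (∫ u : ℝ, hankelKernel z (u + b * Complex.I)) =
      ∫ u : ℝ, hankelKernel z (u + a * Complex.I) := by
  have hN : ∀ u : ℝ, ∀ v ∈ uIcc a b, ‖hankelKernel z (u + v * Complex.I)‖ ≤
      Real.exp (c * Real.exp u + -z * u) := by
    intro u v hv
    rw [norm_hankelKernel, Real.exp_le_exp]
    gcongr
    exact hab v hv
  have hint := integrable_exp_mul_exp_add hc (b := -z) (by linarith)
  have hbot : Tendsto (fun u : ℝ => Real.exp (c * Real.exp u + -z * u)) atBot (nhds 0) := by
    refine squeeze_zero (fun u => (Real.exp_pos _).le) (fun u => ?_)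
      (tendsto_exp_mul_atBot (b := -z) (by linarith) 1)
    rw [one_mul, Real.exp_le_exp]
    nlinarith [Real.exp_pos u]
  have htop := (tendsto_exp_mul_exp_add_atTop hc (-z)).mul_const |b - a|
  rw [zero_mul] at htop
  have key : ∀ U : ℝ, Complex.I * (∫ v : ℝ in a..b, hankelKernel z (U + v * Complex.I)) =
      (∫ u : ℝ in Iic U, hankelKernel z (u + b * Complex.I)) -
        ∫ u : ℝ in Iic U, hankelKernel z (u + a * Complex.I) := fun U =>
    integral_vertical_eq_sub_integral_Iic (fun w _ => differentiable_hankelKernel z w)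
      (fun u _ => hN u) hint.integrableOn hbot
  have hvert : Tendsto (fun U : ℝ => Complex.I * ∫ v : ℝ in a..b, hankelKernel z (U + v * Complex.I))
      atTop (nhds 0) := by
    refine squeeze_zero_norm (fun U => ?_) htop
    rw [norm_mul, Complex.norm_I, one_mul]
    exact intervalIntegral.norm_integral_le_of_norm_le_const fun v hv =>
      hN U v (uIoc_subset_uIcc hv)
  have hray : ∀ η ∈ uIcc a b, Tendsto (fun U : ℝ => ∫ u : ℝ in Iic U,
      hankelKernel z (u + η * Complex.I)) atTop
      (nhds (∫ u : ℝ, hankelKernel z (u + η * Complex.I))) := fun η hη =>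
    (aecover_Iic tendsto_id).integral_tendsto_of_countably_generated
      (integrable_hankelKernel ((hab η hη).trans_lt hc) hz)
  simp only [key] at hvert
  exact sub_eq_zero.1 (tendsto_nhds_unique
    ((hray b right_mem_uIcc).sub (hray a left_mem_uIcc)) hvert)

theorem integral_hankelKernel_of_exp_eq_neg_one {η z : ℝ} (hz : z < 0)
    (hη : Complex.exp (η * Complex.I) = -1) :
    (∫ u : ℝ, hankelKernel z (u + η * Complex.I)) =
      Complex.exp (-z * η * Complex.I) * Real.Gamma (-z) := by
  have hG : Real.Gamma (-z) = ∫ u : ℝ, Real.exp (-Real.exp u + -z * u) := by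
    have h := integral_image_eq_integral_abs_deriv_smul (f := Real.exp) (f' := Real.exp)
      MeasurableSet.univ (fun x _ => (Real.hasDerivAt_exp x).hasDerivWithinAt)
      Real.exp_injective.injOn (fun r : ℝ => Real.exp (-r) * r ^ (-z - 1))
    rw [image_univ, Real.range_exp, ← Real.Gamma_eq_integral (by linarith), setIntegral_univ] at h
    rw [h]
    congr 1 with u
    simp only [smul_eq_mul, Real.abs_exp, ← Real.exp_mul, ← Real.exp_add]
    congr 1
    ring
  rw [hG, ← integral_complex_ofReal, ← integral_const_mul]
  congr 1 with u
  rw [hankelKernel, Complex.exp_add, hη]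
  push_cast
  rw [← Complex.exp_add]
  congr 1
  ring

theorem hankelIntegral_hankelKernel_of_neg {θ : ℝ} (h₁ : Real.pi / 2 < θ) (h₂ : θ < Real.pi)
    (U : ℝ) {z : ℝ} (hz : z < 0) :
    hankelIntegral θ U (hankelKernel z) = 2 * Real.pi * Complex.I * (Real.Gamma (z + 1) : ℂ)⁻¹ := by
  have hπ := Real.pi_pos
  have hcos : Real.cos θ < 0 := Real.cos_neg_of_pi_div_two_lt_of_lt h₁ (by linarith)
  have hle : ∀ v, θ ≤ v → v ≤ Real.pi → Real.cos v ≤ Real.cos θ := fun v hv hv' =>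
    Real.cos_le_cos_of_nonneg_of_le_pi (by linarith) hv' hv
  rw [hankelIntegral_eq_integral_sub_integral (N := fun u => Real.exp (Real.exp U) *
      Real.exp (-z * u)) (fun w _ => differentiable_hankelKernel z w) ?_ ?_
      (tendsto_exp_mul_atBot (by linarith) _) (integrable_hankelKernel hcos hz)
      (integrable_hankelKernel (by rwa [Real.cos_neg]) hz),
    ← integral_hankelKernel_line_eq (b := Real.pi) hz hcos,
    ← integral_hankelKernel_line_eq (a := -θ) (b := -Real.pi) hz hcos,
    integral_hankelKernel_of_exp_eq_neg_one hz (by simp),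
    integral_hankelKernel_of_exp_eq_neg_one hz (by simp [Complex.exp_neg])]
  · have hrefl := Real.Gamma_mul_Gamma_one_sub (-z)
    have hG : Real.Gamma (-z) ≠ 0 := (Real.Gamma_pos_of_pos (by linarith)).ne'
    have hval : Real.pi * (Real.Gamma (z + 1))⁻¹ = Real.sin (Real.pi * -z) * Real.Gamma (-z) := by
      rw [show z + 1 = 1 - -z by ring]
      rw [eq_div_of_mul_eq hG ((mul_comm _ _).trans hrefl)]
      field_simp
    have hvalC : (Real.pi : ℂ) * ((Real.Gamma (z + 1))⁻¹ : ℝ) =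
        Complex.sin (Real.pi * -z) * Real.Gamma (-z) := by
      exact_mod_cast congrArg (fun t : ℝ => (t : ℂ)) hval
    have hsin : 2 * Complex.I * Complex.sin (Real.pi * -z) =
        Complex.exp (-z * Real.pi * Complex.I) - Complex.exp (-z * (-Real.pi : ℝ) * Complex.I) := by
      rw [Complex.sin]
      push_cast
      ring_nf
      simp
    push_cast at hvalC hsin ⊢
    linear_combination (-2 * Complex.I) * hvalC - (Real.Gamma (-z) : ℂ) * hsin
  · intro v hv
    rw [uIcc_of_ge (by linarith)] at hv
    rw [← Real.cos_neg v]
    exact hle _ (by linarith [hv.2]) (by linarith [hv.1])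
  · intro v hv
    rw [uIcc_of_le h₂.le] at hv
    exact hle _ hv.1 hv.2
  · intro u hu v _
    rw [norm_hankelKernel, ← Real.exp_add, Real.exp_le_exp]
    gcongr
    nlinarith [Real.cos_le_one v, Real.exp_pos u, Real.exp_le_exp.2 hu]
  · exact (integrableOn_exp_mul_Iic (by linarith) U).const_mul _

theorem continuousAt_hankelIntegral_hankelKernel_zero {θ : ℝ} (hθ : Real.cos θ < 0) (U : ℝ) :
    ContinuousAt (fun z : ℝ => hankelIntegral θ U (hankelKernel z)) 0 := by
  have ray : ∀ η : ℝ, Real.cos η < 0 →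
      ContinuousAt (fun z : ℝ => ∫ u : ℝ in Ioi U, hankelKernel z (u + η * Complex.I)) 0 := by
    intro η hη
    refine tendsto_integral_filter_of_dominated_convergence
      (fun u => Real.exp (2 * |U|) * Real.exp (Real.cos η * Real.exp u + 1 * u))
      (Eventually.of_forall fun z => Continuous.aestronglyMeasurable (by fun_prop)) ?_
      ((integrableOn_exp_mul_exp_add hη 1 U).const_mul _) (ae_of_all _ fun u => ?_)
    · filter_upwards [Ioo_mem_nhds (show (-1 : ℝ) < 0 by norm_num) one_pos] with z hz
      refine (ae_restrict_iff' measurableSet_Ioi).2 (ae_of_all _ fun u hu => ?_)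
      rw [norm_hankelKernel, ← Real.exp_add, Real.exp_le_exp]
      have := mem_Ioi.1 hu
      nlinarith [hz.1, hz.2, neg_abs_le U, abs_nonneg U,
        mul_nonneg (sub_nonneg.2 hz.2.le) (abs_nonneg U)]
    · refine Continuous.tendsto (f := fun z : ℝ => hankelKernel z (u + η * Complex.I)) ?_ 0
      unfold hankelKernel
      fun_prop
  refine ContinuousAt.add (ContinuousAt.mul continuousAt_const ?_)
    ((ray θ hθ).sub (ray (-θ) (by rwa [Real.cos_neg])))
  refine (intervalIntegral.continuous_parametric_intervalIntegral_of_continuous'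
    (f := fun z v : ℝ => hankelKernel z (U + v * Complex.I)) ?_ _ _).continuousAt
  unfold hankelKernel Function.uncurry
  fun_prop

/-- Hankel's formula for the reciprocal Gamma function. -/
theorem hankelIntegral_hankelKernel {θ : ℝ} (h₁ : Real.pi / 2 < θ) (h₂ : θ < Real.pi)
    (U z : ℝ) :
    hankelIntegral θ U (hankelKernel z) = 2 * Real.pi * Complex.I * (Real.Gamma (z + 1) : ℂ)⁻¹ := by
  have hcos : Real.cos θ < 0 :=
    Real.cos_neg_of_pi_div_two_lt_of_lt h₁ (by linarith [Real.pi_pos])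
  have hzero : hankelIntegral θ U (hankelKernel 0) =
      2 * Real.pi * Complex.I * (Real.Gamma (0 + 1) : ℂ)⁻¹ := by
    have hl := (continuousAt_hankelIntegral_hankelKernel_zero hcos U).tendsto.mono_left
      (nhdsWithin_le_nhds (s := Iio 0))
    have hr : ContinuousAt
        (fun z : ℝ => 2 * Real.pi * Complex.I * ((Real.Gamma (z + 1) : ℂ))⁻¹) 0 := by
      have hG : ContinuousAt (fun z : ℝ => Real.Gamma (z + 1)) 0 := by
        refine ContinuousAt.comp (g := Real.Gamma) ?_ (by fun_prop)
        refine (Real.differentiableAt_Gamma fun m => ?_).continuousAt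
        have : (0 : ℝ) ≤ m := m.cast_nonneg
        linarith
      refine continuousAt_const.mul (ContinuousAt.inv₀ ?_ (by simp))
      exact Complex.continuous_ofReal.continuousAt.comp hG
    refine tendsto_nhds_unique hl ((hr.tendsto.mono_left nhdsWithin_le_nhds).congr' ?_)
    filter_upwards [self_mem_nhdsWithin] with y hy
    exact (hankelIntegral_hankelKernel_of_neg h₁ h₂ U hy).symm
  have hlt : ∀ (n : ℕ) (z : ℝ), z < n → hankelIntegral θ U (hankelKernel z) =
      2 * Real.pi * Complex.I * (Real.Gamma (z + 1) : ℂ)⁻¹ := by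
    intro n
    induction n with
    | zero =>
      intro z hz
      exact hankelIntegral_hankelKernel_of_neg h₁ h₂ U (by simpa using hz)
    | succ n ih =>
      intro z hz
      rcases eq_or_ne z 0 with rfl | hz0
      · exact_mod_cast hzero
      · have h := hankelIntegral_hankelKernel_sub_one hcos U z
        rw [ih (z - 1) (by push_cast at hz; linarith), sub_add_cancel] at h
        rw [Real.Gamma_add_one hz0]
        have hzC : (z : ℂ) ≠ 0 := by exact_mod_cast hz0
        refine mul_left_cancel₀ hzC (h.symm.trans ?_)
        push_cast
        rw [mul_inv]
        field_simp
  obtain ⟨n, hn⟩ := exists_nat_gt z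
  exact hlt n z hn

theorem hasSum_hankelIntegral {Φ : ℕ → ℂ → ℂ} {F : ℂ → ℂ} {g : ℂ → ℝ} {q θ U : ℝ}
    (hΦ : ∀ k, Continuous (Φ k)) (hg : Continuous g) (hq₀ : 0 ≤ q) (hq₁ : q < 1)
    (hg₁ : IntegrableOn (fun u : ℝ => g (u + θ * Complex.I)) (Ioi U))
    (hg₂ : IntegrableOn (fun u : ℝ => g (u + (-θ : ℝ) * Complex.I)) (Ioi U))
    (hb : ∀ k w, U ≤ w.re → ‖Φ k w‖ ≤ q ^ k * g w)
    (hs : ∀ w, U ≤ w.re → HasSum (fun k => Φ k w) (F w)) :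
    HasSum (fun k => hankelIntegral θ U (Φ k)) (hankelIntegral θ U F) := by
  have hsum : ∀ t : ℝ, Summable fun k : ℕ => q ^ k * t := fun t =>
    (summable_geometric_of_lt_one hq₀ hq₁).mul_right t
  have ray : ∀ η : ℝ, IntegrableOn (fun u : ℝ => g (u + η * Complex.I)) (Ioi U) →
      HasSum (fun k => ∫ u : ℝ in Ioi U, Φ k (u + η * Complex.I))
        (∫ u : ℝ in Ioi U, F (u + η * Complex.I)) := by
    intro η hη
    refine hasSum_integral_of_dominated_convergence
      (fun k u => q ^ k * g (u + η * Complex.I))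
      (fun k => ((hΦ k).comp (by fun_prop)).aestronglyMeasurable) (fun k => ?_)
      (ae_of_all _ fun u => hsum _) ?_ ?_
    · refine (ae_restrict_iff' measurableSet_Ioi).2 (ae_of_all _ fun u hu => hb k _ ?_)
      simpa using (mem_Ioi.1 hu).le
    · simpa only [tsum_mul_right] using hη.const_mul _
    · refine (ae_restrict_iff' measurableSet_Ioi).2 (ae_of_all _ fun u hu => hs _ ?_)
      simpa using (mem_Ioi.1 hu).le
  refine HasSum.add (HasSum.mul_left _ ?_) ((ray θ hg₁).sub (ray (-θ) hg₂))
  refine intervalIntegral.hasSum_integral_of_dominated_convergence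
    (fun k v => q ^ k * g (U + v * Complex.I))
    (fun k => ((hΦ k).comp (by fun_prop)).aestronglyMeasurable)
    (fun k => ae_of_all _ fun v _ => hb k _ (by simp)) (ae_of_all _ fun v _ => hsum _) ?_
    (ae_of_all _ fun v _ => hs _ (by simp))
  simp only [tsum_mul_right]
  exact ((hg.comp (by fun_prop)).intervalIntegrable _ _).const_mul _

theorem mul_sin_le_norm_one_add_mul_exp {ρ φ ψ : ℝ} (hρ : 0 ≤ ρ)
    (hφ : Real.cos ψ ≤ Real.cos φ) :
    ρ * Real.sin ψ ≤ ‖1 + ρ * Complex.exp (φ * Complex.I)‖ := by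
  refine le_of_sq_le_sq ?_ (norm_nonneg _)
  rw [Complex.sq_norm, Complex.normSq_apply]
  simp only [Complex.add_re, Complex.add_im, Complex.one_re, Complex.one_im,
    Complex.re_ofReal_mul, Complex.im_ofReal_mul, Complex.exp_ofReal_mul_I_re,
    Complex.exp_ofReal_mul_I_im]
  have hsq : ∀ t : ℝ, (ρ * Real.sin t) ^ 2 = ρ ^ 2 - (ρ * Real.cos t) ^ 2 := fun t => by
    linear_combination ρ ^ 2 * Real.sin_sq_add_cos_sq t
  nlinarith [hsq ψ, hsq φ, sq_nonneg (1 + ρ * Real.cos ψ), mul_le_mul_of_nonneg_left hφ hρ]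

/-- The integrand representing `E_{α,1}(-x)`, in the logarithmic coordinate. -/
noncomputable def mittagLefflerKernel (α x : ℝ) (w : ℂ) : ℂ :=
  hankelKernel 0 w * (1 + x * Complex.exp (-α * w))⁻¹

theorem mul_sin_le_norm_one_add {α x θ u v : ℝ} (hα : 0 ≤ α) (hx : 0 ≤ x)
    (hαθ : α * θ ≤ Real.pi) (hv : |v| ≤ θ) :
    x * Real.exp (-α * u) * Real.sin (α * θ) ≤
      ‖1 + x * Complex.exp (-α * (u + v * Complex.I))‖ := by
  have h := mul_sin_le_norm_one_add_mul_exp (ρ := x * Real.exp (-α * u)) (φ := -α * v)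
    (ψ := α * θ) (by positivity) (by
      rw [← Real.cos_abs (-α * v), abs_mul, abs_neg, abs_of_nonneg hα]
      exact Real.cos_le_cos_of_nonneg_of_le_pi (by positivity) hαθ (by gcongr))
  refine h.trans_eq ?_
  push_cast
  rw [mul_assoc (x : ℂ), ← Complex.exp_add]
  congr 4
  ring

theorem norm_mittagLefflerKernel_le {α x θ u v : ℝ} (hα : 0 ≤ α) (hx : 0 < x)
    (hαθ : α * θ ≤ Real.pi) (hs : 0 < Real.sin (α * θ)) (hv : |v| ≤ θ) :
    ‖mittagLefflerKernel α x (u + v * Complex.I)‖ ≤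
      (x * Real.sin (α * θ))⁻¹ * Real.exp (Real.cos v * Real.exp u + α * u) := by
  have h := mul_sin_le_norm_one_add (u := u) hα hx.le hαθ hv
  rw [mittagLefflerKernel, norm_mul, norm_inv, norm_hankelKernel]
  refine (mul_le_mul_of_nonneg_left (inv_anti₀ (by positivity) h) (Real.exp_pos _).le).trans_eq ?_
  rw [mul_inv, mul_inv, mul_inv, ← Real.exp_neg, Real.exp_add, Real.exp_add]
  simp
  ring

theorem differentiableAt_mittagLefflerKernel {α x θ : ℝ} (hα : 0 ≤ α) (hx : 0 < x)
    (hαθ : α * θ ≤ Real.pi) (hs : 0 < Real.sin (α * θ)) {w : ℂ} (hw : |w.im| ≤ θ) :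
    DifferentiableAt ℂ (mittagLefflerKernel α x) w := by
  have h := mul_sin_le_norm_one_add (u := w.re) hα hx.le hαθ hw
  rw [Complex.re_add_im] at h
  refine (differentiable_hankelKernel 0 w).mul (DifferentiableAt.inv (by fun_prop) ?_)
  exact norm_pos_iff.1 (lt_of_lt_of_le (by positivity) h)

theorem hasSum_hankelIntegral_mittagLefflerKernel {α x θ : ℝ} (hα : 0 < α) (hx : 0 < x)
    (h₁ : Real.pi / 2 < θ) (h₂ : θ < Real.pi) {U : ℝ} (hU : x * Real.exp (-α * U) < 1) :
    HasSum (fun k : ℕ => 2 * Real.pi * Complex.I *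
      ((-(x : ℂ)) ^ k / (Real.Gamma (α * k + 1) : ℂ)))
      (hankelIntegral θ U (mittagLefflerKernel α x)) := by
  have hcos : Real.cos θ < 0 :=
    Real.cos_neg_of_pi_div_two_lt_of_lt h₁ (by linarith [Real.pi_pos])
  have hker : ∀ (k : ℕ) (w : ℂ), (-(x : ℂ)) ^ k * hankelKernel (α * k) w =
      hankelKernel 0 w * (-(x * Complex.exp (-α * w))) ^ k := by
    intro k w
    rw [← neg_mul, mul_pow, ← Complex.exp_nat_mul, hankelKernel, hankelKernel, mul_left_comm,
      ← Complex.exp_add]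
    congr 2
    push_cast
    ring
  have hnorm : ∀ w : ℂ, U ≤ w.re →
      ‖-(x * Complex.exp (-α * w))‖ ≤ x * Real.exp (-α * U) := by
    intro w hw
    rw [norm_neg, norm_mul, Complex.norm_real, Complex.norm_exp, Real.norm_of_nonneg hx.le]
    have : (-(α : ℂ) * w).re = -α * w.re := by simp
    rw [this]
    refine mul_le_mul_of_nonneg_left (Real.exp_le_exp.2 ?_) hx.le
    nlinarith
  have hterm : ∀ k : ℕ, hankelIntegral θ U (fun w => (-(x : ℂ)) ^ k * hankelKernel (α * k) w) =
      2 * Real.pi * Complex.I * ((-(x : ℂ)) ^ k / (Real.Gamma (α * k + 1) : ℂ)) := by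
    intro k
    have h : hankelIntegral θ U (fun w => (-(x : ℂ)) ^ k * hankelKernel (α * k) w) =
        (-(x : ℂ)) ^ k * hankelIntegral θ U (hankelKernel (α * k)) := by
      simp only [hankelIntegral, intervalIntegral.integral_const_mul, integral_const_mul]
      ring
    rw [h, hankelIntegral_hankelKernel h₁ h₂]
    ring
  simp only [← hterm]
  refine hasSum_hankelIntegral (g := fun w => ‖hankelKernel 0 w‖) (fun k => by fun_prop)
    (by fun_prop) (by positivity) hU (integrableOn_hankelKernel hcos 0 U).norm
    (integrableOn_hankelKernel (by rwa [Real.cos_neg]) 0 U).norm (fun k w hw => ?_)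
    fun w hw => ?_
  · rw [hker, norm_mul, norm_pow, mul_comm]
    gcongr
    exact hnorm w hw
  · simp only [hker]
    have h := (hasSum_geometric_of_norm_lt_one ((hnorm w hw).trans_lt hU)).mul_left
      (hankelKernel 0 w)
    rwa [sub_neg_eq_add] at h

theorem norm_hankelIntegral_mittagLefflerKernel_le {α x θ : ℝ} (hα : 0 < α) (hx : 0 < x)
    (h₁ : Real.pi / 2 < θ) (h₂ : θ < Real.pi) (hαθ : α * θ ≤ Real.pi)
    (hs : 0 < Real.sin (α * θ)) (U : ℝ) :
    ‖hankelIntegral θ U (mittagLefflerKernel α x)‖ ≤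
      2 * ((x * Real.sin (α * θ))⁻¹ *
        ∫ u : ℝ, Real.exp (Real.cos θ * Real.exp u + α * u)) := by
  have hθ : 0 ≤ θ := by linarith [Real.pi_pos]
  have hcos : Real.cos θ < 0 :=
    Real.cos_neg_of_pi_div_two_lt_of_lt h₁ (by linarith [Real.pi_pos])
  have hint := (integrable_exp_mul_exp_add hcos hα).const_mul (x * Real.sin (α * θ))⁻¹
  have hbound : ∀ η : ℝ, |η| = θ → ∀ u : ℝ, ‖mittagLefflerKernel α x (u + η * Complex.I)‖ ≤
      (x * Real.sin (α * θ))⁻¹ * Real.exp (Real.cos θ * Real.exp u + α * u) := by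
    intro η hη u
    rw [← hη, Real.cos_abs, hη]
    exact norm_mittagLefflerKernel_le hα.le hx hαθ hs hη.le
  have hline : ∀ η : ℝ, |η| = θ →
      Integrable fun u : ℝ => mittagLefflerKernel α x (u + η * Complex.I) := by
    intro η hη
    refine hint.mono' (Continuous.aestronglyMeasurable ?_) (ae_of_all _ (hbound η hη))
    refine continuous_iff_continuousAt.2 fun u => ?_
    exact (differentiableAt_mittagLefflerKernel hα.le hx hαθ hs
      (w := u + η * Complex.I) (by simpa using hη.le)).continuousAt.comp
      (f := fun u : ℝ => (u + η * Complex.I : ℂ)) (by fun_prop)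
  have habs : ∀ v ∈ uIcc (-θ) θ, |v| ≤ θ := by
    intro v hv
    rw [uIcc_of_le (by linarith)] at hv
    exact abs_le.2 hv
  rw [hankelIntegral_eq_integral_sub_integral (N := fun u =>
      (x * Real.sin (α * θ))⁻¹ * Real.exp (Real.exp U) * Real.exp (α * u))
      (fun w hw => differentiableAt_mittagLefflerKernel hα.le hx hαθ hs (habs _ hw)) ?_
      ((integrableOn_exp_mul_Iic hα U).const_mul _) (tendsto_exp_mul_atBot hα _)
      (hline θ (abs_of_nonneg hθ)) (hline (-θ) (by rw [abs_neg, abs_of_nonneg hθ])), two_mul,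
    ← integral_const_mul]
  · refine (norm_sub_le _ _).trans (add_le_add ?_ ?_)
    · exact norm_integral_le_of_norm_le hint (ae_of_all _ (hbound θ (abs_of_nonneg hθ)))
    · exact norm_integral_le_of_norm_le hint
        (ae_of_all _ (hbound (-θ) (by rw [abs_neg, abs_of_nonneg hθ])))
  · intro u hu v hv
    refine (norm_mittagLefflerKernel_le hα.le hx hαθ hs (habs v hv)).trans ?_
    rw [mul_assoc, ← Real.exp_add]
    gcongr
    nlinarith [Real.cos_le_one v, Real.exp_pos u, Real.exp_le_exp.2 hu]

/-- `x E_{α,α+1}(-x) - 1 = -E_{α,1}(-x)`. -/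
theorem mul_mittagLeffler_neg_sub_one {α x : ℝ} {E : ℂ}
    (h : HasSum (fun k : ℕ => (-(x : ℂ)) ^ k / (Real.Gamma (α * k + 1) : ℂ)) E) :
    (x : ℂ) * mittagLeffler α (α + 1) (-(x : ℂ)) - 1 = -E := by
  have h1 := ((hasSum_nat_add_iff' 1).2 h).tsum_eq
  have h2 : ∀ k : ℕ, (-(x : ℂ)) ^ (k + 1) / (Real.Gamma (α * (k + 1 : ℕ) + 1) : ℂ) =
      -x * ((-(x : ℂ)) ^ k / (Real.Gamma (α * k + (α + 1)) : ℂ)) := by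
    intro k
    rw [show α * (k + 1 : ℕ) + 1 = α * k + (α + 1) by push_cast; ring]
    ring
  simp only [h2, tsum_mul_left, ← mittagLeffler.eq_1] at h1
  simp at h1
  linear_combination -h1

/-- Quantitative form of E_{a,a+1}(z) = -1/z + O(1/z^2) as z -> -infty:
|x*E_{a,a+1}(-x) - 1| <= C/x for x >= 1. -/
theorem mittagLeffler_neg_arg_asymptotics (α : ℝ) (hα₁ : 1 < α) (hα₂ : α < 2) :
    ∃ C : ℝ, 0 < C ∧ ∀ x : ℝ, 1 ≤ x →
      ‖(x : ℂ) * mittagLeffler α (α + 1) (-(x : ℂ)) - 1‖ ≤ C / x := by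
  have hπ := Real.pi_pos
  have hα : 0 < α := by linarith
  obtain ⟨θ, h₁, hθ⟩ : ∃ θ, Real.pi / 2 < θ ∧ θ < Real.pi / α :=
    exists_between (by gcongr)
  have hαθ : α * θ < Real.pi := by rwa [lt_div_iff₀' hα] at hθ
  have h₂ : θ < Real.pi := by nlinarith
  have hs : 0 < Real.sin (α * θ) := Real.sin_pos_of_pos_of_lt_pi (by nlinarith) hαθ
  set J := ∫ u : ℝ, Real.exp (Real.cos θ * Real.exp u + α * u) with hJ
  have hJ0 : 0 ≤ J := integral_nonneg fun u => (Real.exp_pos _).le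
  refine ⟨J / (Real.pi * Real.sin (α * θ)) + 1, by positivity, fun x hx => ?_⟩
  have hx0 : 0 < x := by linarith
  obtain ⟨U, hU⟩ : ∃ U : ℝ, x * Real.exp (-α * U) < 1 := by
    refine ⟨(Real.log x + 1) / α, ?_⟩
    rw [neg_mul, mul_div_cancel₀ _ hα.ne']
    nth_rw 1 [← Real.exp_log hx0]
    rw [← Real.exp_add, Real.exp_lt_one_iff]
    linarith
  have hI : (2 * Real.pi * Complex.I : ℂ) ≠ 0 := Complex.two_pi_I_ne_zero
  have hsum := (hasSum_hankelIntegral_mittagLefflerKernel hα hx0 h₁ h₂ hU).mul_left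
    (2 * Real.pi * Complex.I : ℂ)⁻¹
  simp only [inv_mul_cancel_left₀ hI] at hsum
  rw [mul_mittagLeffler_neg_sub_one hsum, norm_neg, norm_mul]
  have hn : ‖(2 * Real.pi * Complex.I : ℂ)⁻¹‖ = (2 * Real.pi)⁻¹ := by
    simp [abs_of_pos hπ]
  rw [hn]
  refine (mul_le_mul_of_nonneg_left (norm_hankelIntegral_mittagLefflerKernel_le hα hx0 h₁ h₂
    hαθ.le hs U) (by positivity)).trans ?_
  rw [← hJ]
  calc (2 * Real.pi)⁻¹ * (2 * ((x * Real.sin (α * θ))⁻¹ * J))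
      = J / (Real.pi * Real.sin (α * θ)) / x := by field_simp
    _ ≤ (J / (Real.pi * Real.sin (α * θ)) + 1) / x := by gcongr; linarith
end

section
/- Let 1<α<2, ω>0, λ>0, and set μ = i^α ω^α = e^{iπα/2} ω^α. Define y_λ(t) = t^α (λ E_{α,α+1}(−λ t^α) + μ E_{α,α+1}(μ t^α))/(λ + μ) for t>0. Then y_λ(t)/E_α(μ t^α) → 1/(λ + μ) as t → ∞. (Scalar principle of limiting amplitude: the solution of D^{(α)}y + λy = E_α(i^α ω^α t^α), y(0)=y'(0)=0, behaves asymptotically like (λ + i^α ω^α)^{−1} E_α(i^α ω^α t^α).) -/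
open MeasureTheory Filter Set

open scoped FourierTransform Topology

theorem integrableOn_rpow_mul_exp_neg {b σ : ℝ} (hb : 0 ≤ b) (hσ : 0 < σ) :
    IntegrableOn (fun t : ℝ => t ^ b * Real.exp (-σ * t)) (Ioi 0) := by
  simpa using integrableOn_rpow_mul_exp_neg_mul_rpow (p := 1) (s := b) (b := σ) (by linarith)
    one_pos hσ

theorem integral_rpow_mul_cexp_neg {b : ℝ} (hb : 0 ≤ b) {s : ℂ} (hs : 0 < s.re) :
    ∫ t in Ioi (0 : ℝ), ((t ^ b : ℝ) : ℂ) * Complex.exp (-s * t)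
      = (Real.Gamma (b + 1) : ℂ) * s ^ (-((b + 1 : ℝ) : ℂ)) := by
  let ν : Measure ℝ := (volume.restrict (Ioi 0)).withDensity fun t => ENNReal.ofReal (t ^ b)
  have hmeas : Measurable fun t : ℝ => ENNReal.ofReal (t ^ b) := by fun_prop
  have hν : ∀ z : ℂ, ProbabilityTheory.complexMGF id ν z
      = ∫ t in Ioi (0 : ℝ), ((t ^ b : ℝ) : ℂ) * Complex.exp (z * t) := by
    intro z
    rw [ProbabilityTheory.complexMGF, integral_withDensity_eq_integral_toReal_smul hmeas (by simp)]
    refine setIntegral_congr_fun measurableSet_Ioi fun t ht => ?_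
    simp [ENNReal.toReal_ofReal (Real.rpow_nonneg (mem_Ioi.1 ht).le b)]
  have hexp : Iio 0 ⊆ ProbabilityTheory.integrableExpSet id ν := by
    intro x hx
    rw [ProbabilityTheory.integrableExpSet, mem_ofPred_eq,
      integrable_withDensity_iff_integrable_smul' hmeas (by simp)]
    refine ((integrableOn_rpow_mul_exp_neg hb (neg_pos.2 hx)).congr_fun ?_ measurableSet_Ioi)
    intro t ht
    simp [ENNReal.toReal_ofReal (Real.rpow_nonneg (mem_Ioi.1 ht).le b)]
  have hopen : IsOpen {z : ℂ | 0 < z.re} := isOpen_lt continuous_const Complex.continuous_re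
  have hL : AnalyticOnNhd ℂ (fun z => ProbabilityTheory.complexMGF id ν (-z)) {z : ℂ | 0 < z.re} := by
    refine DifferentiableOn.analyticOnNhd (fun z hz => ?_) hopen
    have := (ProbabilityTheory.hasDerivAt_complexMGF (X := id) (μ := ν) (z := -z)
      (interior_maximal hexp isOpen_Iio (by simpa using hz))).differentiableAt
    exact (this.comp z differentiable_neg.differentiableAt).differentiableWithinAt
  have hR : AnalyticOnNhd ℂ (fun z : ℂ => (Real.Gamma (b + 1) : ℂ) * z ^ (-((b + 1 : ℝ) : ℂ)))
      {z : ℂ | 0 < z.re} := by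
    refine DifferentiableOn.analyticOnNhd (fun z hz => ?_) hopen
    exact ((differentiableAt_id.cpow_const (Or.inl hz)).const_mul _).differentiableWithinAt
  have hreal : ∀ x : ℝ, 0 < x → ProbabilityTheory.complexMGF id ν (-(x : ℂ))
      = (Real.Gamma (b + 1) : ℂ) * (x : ℂ) ^ (-((b + 1 : ℝ) : ℂ)) := by
    intro x hx
    have h := Real.integral_rpow_mul_exp_neg_mul_Ioi (a := b + 1) (by linarith) hx
    rw [hν, ← Complex.ofReal_neg (b + 1), ← Complex.ofReal_cpow hx.le, ← Complex.ofReal_mul,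
      Real.rpow_neg hx.le, ← Real.inv_rpow hx.le, mul_comm, ← one_div, ← h, ← integral_complex_ofReal]
    simp
  have hfreq : ∃ᶠ z in nhdsWithin (1 : ℂ) {1}ᶜ, ProbabilityTheory.complexMGF id ν (-z)
      = (Real.Gamma (b + 1) : ℂ) * z ^ (-((b + 1 : ℝ) : ℂ)) := by
    have ht : Tendsto (fun x : ℝ => (x : ℂ)) (nhdsWithin 1 {1}ᶜ) (nhdsWithin (1 : ℂ) {1}ᶜ) := by
      refine tendsto_nhdsWithin_of_tendsto_nhds_of_eventually_within _ ?_ ?_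
      · exact (Complex.continuous_ofReal.tendsto' 1 1 (by simp)).mono_left nhdsWithin_le_nhds
      · filter_upwards [self_mem_nhdsWithin] with x hx
        simpa using hx
    refine ht.frequently (Eventually.frequently ?_)
    filter_upwards [nhdsWithin_le_nhds (lt_mem_nhds one_pos)] with x hx using hreal x hx
  have := hL.eqOn_of_preconnected_of_frequently_eq hR
    (convex_halfSpace_re_gt 0).isPreconnected (by simp : (1 : ℂ) ∈ {z : ℂ | 0 < z.re}) hfreq hs
  simpa [hν] using this

theorem Real.rpow_div_Gamma_add_one_le_exp {a x : ℝ} (ha : 0 ≤ a) (hx : 0 ≤ x) :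
    x ^ a / Real.Gamma (a + 1) ≤ Real.exp x := by
  rw [div_le_iff₀ (Real.Gamma_pos_of_pos (by linarith)), Real.Gamma_eq_integral (by linarith)]
  have hint := Real.GammaIntegral_convergent (s := a + 1) (by linarith)
  have h1 : ∫ t in Ioi x, Real.exp (-t) * x ^ a ≤ ∫ t in Ioi 0, Real.exp (-t) * t ^ (a + 1 - 1) := by
    refine (setIntegral_mono_on ?_ (hint.mono_set (Ioi_subset_Ioi hx)) measurableSet_Ioi ?_).trans
      (setIntegral_mono_set hint ?_ (Ioi_subset_Ioi hx).eventuallyLE)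
    · exact (integrableOn_exp_neg_Ioi x).mul_const _
    · intro t ht
      rw [add_sub_cancel_right]
      have := Real.rpow_le_rpow hx (mem_Ioi.1 ht).le ha
      gcongr
    · filter_upwards [ae_restrict_mem measurableSet_Ioi] with t ht
      have := mem_Ioi.1 ht
      simp only [Pi.zero_apply]
      positivity
  rw [integral_mul_const, integral_exp_neg_Ioi] at h1
  calc x ^ a = Real.exp x * (Real.exp (-x) * x ^ a) := by
        rw [← mul_assoc, ← Real.exp_add]; simp
    _ ≤ _ := by gcongr

theorem norm_mittagLeffler_term_le {α x r : ℝ} (hα : 0 < α) (hx : 0 < x) (hr : 0 ≤ r) {z : ℂ}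
    (hz : ‖z‖ ≤ r * x ^ α) (k : ℕ) :
    ‖z ^ k / (Real.Gamma (α * k + 1) : ℂ)‖ ≤ r ^ k * Real.exp x := by
  have hΓ : 0 < Real.Gamma (α * k + 1) := Real.Gamma_pos_of_pos (by positivity)
  rw [norm_div, norm_pow, Complex.norm_real, Real.norm_of_nonneg hΓ.le]
  calc ‖z‖ ^ k / Real.Gamma (α * k + 1) ≤ (r * x ^ α) ^ k / Real.Gamma (α * k + 1) := by gcongr
    _ = r ^ k * (x ^ (α * k) / Real.Gamma (α * k + 1)) := by
        rw [mul_pow, Real.rpow_mul_natCast hx.le]; ring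
    _ ≤ _ := by
        gcongr
        exact Real.rpow_div_Gamma_add_one_le_exp (by positivity) hx.le

theorem exists_pos_mul_rpow_bound {α R : ℝ} (hα : 0 < α) (hR : 0 < R) :
    ∃ x : ℝ, 0 < x ∧ R = 1 / 2 * x ^ α :=
  ⟨(2 * R) ^ (α⁻¹), by positivity, by
    rw [← Real.rpow_mul (by positivity), inv_mul_cancel₀ hα.ne']; simp⟩

theorem summable_mittagLeffler {α : ℝ} (hα : 0 < α) (z : ℂ) :
    Summable fun k : ℕ => z ^ k / (Real.Gamma (α * k + 1) : ℂ) := by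
  obtain ⟨x, hx, h⟩ := exists_pos_mul_rpow_bound (R := ‖z‖ + 1) hα (by positivity)
  refine Summable.of_norm_bounded (summable_geometric_two.mul_right (Real.exp x)) fun k => ?_
  exact norm_mittagLeffler_term_le hα hx (by norm_num) (by linarith) k

theorem continuous_mittagLeffler {α : ℝ} (hα : 0 < α) : Continuous (mittagLeffler α 1) := by
  refine continuous_iff_continuousAt.2 fun z => ?_
  obtain ⟨x, hx, h⟩ := exists_pos_mul_rpow_bound (R := ‖z‖ + 1) hα (by positivity)
  have hc : ContinuousOn (mittagLeffler α 1) (Metric.ball 0 (‖z‖ + 1)) := by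
    refine continuousOn_tsum (fun k => by fun_prop)
      (summable_geometric_two.mul_right (Real.exp x)) fun k w hw => ?_
    refine norm_mittagLeffler_term_le hα hx (by norm_num) ?_ k
    rw [← h]; simpa using (Metric.mem_ball.1 hw).le
  exact hc.continuousAt (Metric.isOpen_ball.mem_nhds (by simp))

theorem norm_mittagLeffler_le {α ρ t : ℝ} (hα : 0 < α) {c : ℂ} (hρ : 0 < ρ) (hc : ‖c‖ < ρ ^ α)
    (ht : 0 < t) :
    ‖mittagLeffler α 1 (c * ((t ^ α : ℝ) : ℂ))‖
      ≤ (1 - ‖c‖ / ρ ^ α)⁻¹ * Real.exp (ρ * t) := by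
  have hρα : 0 < ρ ^ α := by positivity
  refine tsum_of_norm_bounded ((hasSum_geometric_of_lt_one (by positivity)
    ((div_lt_one hρα).2 hc)).mul_right _) fun k => ?_
  refine norm_mittagLeffler_term_le hα (by positivity) (by positivity) ?_ k
  rw [norm_mul, Complex.norm_real, Real.norm_of_nonneg (by positivity), Real.mul_rpow hρ.le ht.le]
  field_simp
  rfl

/-- The recurrence `z E_{α,α+1}(z) = E_α(z) - 1`. -/
theorem mul_mittagLeffler_add_one {α : ℝ} (hα : 0 < α) (z : ℂ) :
    z * mittagLeffler α (α + 1) z = mittagLeffler α 1 z - 1 := by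
  rw [mittagLeffler, mittagLeffler, (summable_mittagLeffler hα z).tsum_eq_zero_add, ← tsum_mul_left]
  simp only [pow_zero, Nat.cast_zero, mul_zero, zero_add, Real.Gamma_one, Complex.ofReal_one,
    div_one, add_sub_cancel_left]
  refine tsum_congr fun k => ?_
  rw [show α * (k + 1 : ℕ) + 1 = α * k + (α + 1) by push_cast; ring]
  ring

theorem integral_mittagLeffler_mul_cexp_neg {α σ : ℝ} (hα : 0 < α) {c : ℂ} (hσ : 0 < σ)
    (hc : ‖c‖ < σ ^ α) {s : ℂ} (hs : s.re = σ) :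
    ∫ t in Ioi (0 : ℝ), mittagLeffler α 1 (c * ((t ^ α : ℝ) : ℂ)) * Complex.exp (-s * t)
      = s ^ ((α : ℂ) - 1) / (s ^ (α : ℂ) - c) := by
  have hs0 : s ≠ 0 := by rintro rfl; simp at hs; exact hσ.ne hs
  have hΓ : ∀ k : ℕ, 0 < Real.Gamma (α * k + 1) := fun k => Real.Gamma_pos_of_pos (by positivity)
  let F : ℕ → ℝ → ℂ := fun k t => c ^ k / (Real.Gamma (α * k + 1) : ℂ)
    * (((t ^ (α * k) : ℝ) : ℂ) * Complex.exp (-s * t))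
  have hnorm : ∀ k : ℕ, ∀ t ∈ Ioi (0 : ℝ), ‖F k t‖
      = ‖c‖ ^ k / Real.Gamma (α * k + 1) * (t ^ (α * k) * Real.exp (-(σ * t))) := by
    intro k t ht
    have ht' := mem_Ioi.1 ht
    simp only [F, norm_mul, norm_div, norm_pow, Complex.norm_real, Complex.norm_exp,
      Real.norm_of_nonneg (hΓ k).le, Real.norm_of_nonneg (Real.rpow_nonneg ht'.le (α * k))]
    simp [hs]
  have hint : ∀ k, IntegrableOn (F k) (Ioi 0) := by
    intro k
    have h0 := (integrableOn_rpow_mul_exp_neg (b := α * k) (by positivity) hσ).const_mul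
      (‖c‖ ^ k / Real.Gamma (α * k + 1))
    refine Integrable.mono' h0 ?_ ?_
    · refine Measurable.aestronglyMeasurable ?_
      fun_prop
    · filter_upwards [ae_restrict_mem measurableSet_Ioi] with t ht
      rw [hnorm k t ht]; simp
  have hq : ‖c‖ / σ ^ α < 1 := (div_lt_one (by positivity)).2 hc
  have hsum : Summable fun k => ∫ t in Ioi (0 : ℝ), ‖F k t‖ := by
    have : ∀ k, ∫ t in Ioi (0 : ℝ), ‖F k t‖ = σ⁻¹ * (‖c‖ / σ ^ α) ^ k := by
      intro k
      have h := Real.integral_rpow_mul_exp_neg_mul_Ioi (a := α * k + 1) (by positivity) hσ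
      rw [setIntegral_congr_fun measurableSet_Ioi (hnorm k), integral_const_mul]
      rw [add_sub_cancel_right] at h
      rw [h, one_div, Real.inv_rpow hσ.le, Real.rpow_add_one hσ.ne', Real.rpow_mul_natCast hσ.le]
      have := (hΓ k).ne'
      rw [div_pow]
      field_simp
    simp_rw [this]
    exact (summable_geometric_of_lt_one (by positivity) hq).mul_left _
  have key := (hasSum_integral_of_summable_integral_norm hint hsum).tsum_eq
  have hsα : ‖s ^ (α : ℂ)‖ ≥ σ ^ α := by
    rw [Complex.norm_cpow_real]
    exact Real.rpow_le_rpow hσ.le (hs ▸ Complex.re_le_norm s) hα.le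
  have hsα0 : s ^ (α : ℂ) ≠ 0 := by simp [hs0]
  have hne : s ^ (α : ℂ) - c ≠ 0 := fun h => by
    rw [sub_eq_zero.1 h] at hsα; linarith
  have hterm : ∀ k, ∫ t in Ioi (0 : ℝ), F k t = s⁻¹ * (c / s ^ (α : ℂ)) ^ k := by
    intro k
    rw [integral_const_mul, integral_rpow_mul_cexp_neg (by positivity) (hs ▸ hσ)]
    have h1 : s ^ (-((α * k + 1 : ℝ) : ℂ)) = s⁻¹ * ((s ^ (α : ℂ)) ^ k)⁻¹ := by
      push_cast
      rw [neg_add, Complex.cpow_add _ _ hs0, Complex.cpow_neg, Complex.cpow_mul_nat,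
        Complex.cpow_neg_one, mul_comm]
    have : (Real.Gamma (α * k + 1) : ℂ) ≠ 0 := Complex.ofReal_ne_zero.2 (hΓ k).ne'
    rw [h1, div_pow]
    field_simp
  have hq' : ‖c / s ^ (α : ℂ)‖ < 1 := by
    rw [norm_div]
    exact (div_lt_one (by positivity)).2 (hc.trans_le hsα)
  calc _ = ∫ t in Ioi (0 : ℝ), ∑' k, F k t := by
        refine setIntegral_congr_fun measurableSet_Ioi fun t ht => ?_
        simp only [F, mittagLeffler, ← tsum_mul_right]
        refine tsum_congr fun k => ?_
        rw [mul_pow, Real.rpow_mul_natCast (mem_Ioi.1 ht).le]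
        push_cast
        ring
    _ = ∑' k : ℕ, s⁻¹ * (c / s ^ (α : ℂ)) ^ k := by rw [← key]; exact tsum_congr hterm
    _ = _ := by
        rw [tsum_mul_left, tsum_geometric_of_norm_lt_one hq', Complex.cpow_sub _ _ hs0,
          Complex.cpow_one]
        have : 1 - c / s ^ (α : ℂ) ≠ 0 := by
          rw [one_sub_div hsα0]; exact div_ne_zero hne hsα0
        field_simp

theorem exists_norm_le_inv_one_add_normSq {G : ℂ → ℂ} (hc : ContinuousOn G {s | 0 ≤ s.re})
    {C R : ℝ} (hG : ∀ s : ℂ, 0 ≤ s.re → R ≤ ‖s‖ → ‖G s‖ ≤ C / ‖s‖ ^ 2) :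
    ∃ M : ℝ, ∀ s : ℂ, 0 ≤ s.re → ‖G s‖ ≤ M * (1 + ‖s‖ ^ 2)⁻¹ := by
  let R' := max R 1
  have hK : IsCompact ({s : ℂ | 0 ≤ s.re} ∩ Metric.closedBall 0 R') :=
    (isCompact_closedBall _ _).inter_left (isClosed_le continuous_const Complex.continuous_re)
  obtain ⟨B, hB⟩ := hK.exists_bound_of_continuousOn (hc.mono inter_subset_left)
  refine ⟨max (B * (1 + R' ^ 2)) (2 * C), fun s hs => ?_⟩
  rw [← div_eq_mul_inv, le_div_iff₀ (by positivity)]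
  rcases le_total ‖s‖ R' with h | h
  · refine le_max_of_le_left ?_
    have h1 := hB s ⟨hs, by simpa using h⟩
    have h2 : 0 ≤ B := (norm_nonneg _).trans h1
    gcongr
  · refine le_max_of_le_right ?_
    have h1 : 1 ≤ ‖s‖ := (le_max_right _ _).trans h
    have h2 := hG s hs ((le_max_left _ _).trans h)
    have h3 : 0 < ‖s‖ ^ 2 := by positivity
    rw [le_div_iff₀ h3] at h2
    nlinarith [norm_nonneg (G s), mul_nonneg (norm_nonneg (G s)) (by nlinarith : 0 ≤ ‖s‖ ^ 2 - 1)]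

theorem integrable_vertical_line {G : ℂ → ℂ} (hc : ContinuousOn G {s | 0 ≤ s.re}) {M : ℝ}
    (hG : ∀ s : ℂ, 0 ≤ s.re → ‖G s‖ ≤ M * (1 + ‖s‖ ^ 2)⁻¹) {x : ℝ} (hx : 0 ≤ x) :
    Integrable fun y : ℝ => G (x + y * Complex.I) := by
  have hcont : Continuous fun y : ℝ => G (x + y * Complex.I) :=
    hc.comp_continuous (by fun_prop) (by simp [hx])
  refine (integrable_inv_one_add_sq.const_mul M).mono' hcont.aestronglyMeasurable
    (Eventually.of_forall fun y => ?_)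
  have h1 := hG (x + y * Complex.I) (by simp [hx])
  have hM : 0 ≤ M := by
    have := (norm_nonneg _).trans (hG 0 (by simp))
    simpa using this
  refine h1.trans ?_
  have h2 : |y| ≤ ‖(x + y * Complex.I : ℂ)‖ := by
    simpa using Complex.abs_im_le_norm (x + y * Complex.I)
  have h3 : y ^ 2 ≤ ‖(x + y * Complex.I : ℂ)‖ ^ 2 := by
    rw [← sq_abs]; gcongr
  gcongr

theorem integrable_vertical_line_exp {G : ℂ → ℂ} (hc : ContinuousOn G {s | 0 ≤ s.re}) {M : ℝ}
    (hG : ∀ s : ℂ, 0 ≤ s.re → ‖G s‖ ≤ M * (1 + ‖s‖ ^ 2)⁻¹) {x : ℝ} (hx : 0 ≤ x) (t : ℝ) :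
    Integrable fun y : ℝ => Complex.exp ((x + y * Complex.I) * t) * G (x + y * Complex.I) := by
  refine (integrable_vertical_line hc hG hx).bdd_mul (c := Real.exp (x * t))
    (Continuous.aestronglyMeasurable (by fun_prop)) (Eventually.of_forall fun y => ?_)
  simp [Complex.norm_exp]

theorem integral_vertical_line_eq {G : ℂ → ℂ} (hc : ContinuousOn G {s | 0 ≤ s.re})
    (hd : DifferentiableOn ℂ G {s | 0 < s.re}) {M : ℝ}
    (hG : ∀ s : ℂ, 0 ≤ s.re → ‖G s‖ ≤ M * (1 + ‖s‖ ^ 2)⁻¹) {σ : ℝ} (hσ : 0 < σ) {t : ℝ}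
    (ht : 0 ≤ t) :
    ∫ y : ℝ, Complex.exp ((σ + y * Complex.I) * t) * G (σ + y * Complex.I)
      = ∫ y : ℝ, Complex.exp (y * Complex.I * t) * G (y * Complex.I) := by
  let K : ℂ → ℂ := fun s => Complex.exp (s * t) * G s
  have hM : 0 ≤ M := by
    have := (norm_nonneg _).trans (hG 0 (by simp))
    simpa using this
  have hK1 : ContinuousOn K {s | 0 ≤ s.re} := ContinuousOn.mul (by fun_prop) hc
  have hK2 : DifferentiableOn ℂ K {s | 0 < s.re} := DifferentiableOn.mul (by fun_prop) hd
  have hrect : ∀ T : ℝ,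
      (∫ y in (-T)..T, K (σ + y * Complex.I)) - ∫ y in (-T)..T, K ((0 : ℝ) + y * Complex.I)
      = Complex.I * ((∫ x in (0 : ℝ)..σ, K (x + (-T : ℝ) * Complex.I))
        - ∫ x in (0 : ℝ)..σ, K (x + T * Complex.I)) := by
    intro T
    have h := Complex.integral_boundary_rect_eq_zero_of_continuousOn_of_differentiableOn K
      (⟨0, -T⟩ : ℂ) (⟨σ, T⟩ : ℂ) (hK1.mono ?_) (hK2.mono ?_)
    · simp only [smul_eq_mul] at h
      linear_combination (-Complex.I) * h + ((∫ y in (-T)..T, K (σ + y * Complex.I))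
        - ∫ y in (-T)..T, K ((0 : ℝ) + y * Complex.I)) * Complex.I_sq
    · intro z hz
      have := hz.1
      simp only [uIcc_of_le hσ.le, mem_preimage] at this
      exact this.1
    · intro z hz
      have := hz.1
      simp only [min_eq_left hσ.le, mem_preimage] at this
      exact this.1
  have hbound : ∀ T : ℝ, ∀ x ∈ Ioc 0 σ,
      ‖K (x + T * Complex.I)‖ ≤ Real.exp (σ * t) * M * (1 + T ^ 2)⁻¹ := by
    intro T x hx
    have h1 := hG (x + T * Complex.I) (by simp [hx.1.le])
    have h2 : |T| ≤ ‖(x + T * Complex.I : ℂ)‖ := by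
      simpa using Complex.abs_im_le_norm (x + T * Complex.I)
    have h3 : T ^ 2 ≤ ‖(x + T * Complex.I : ℂ)‖ ^ 2 := by
      rw [← sq_abs]; gcongr
    have h4 : ‖Complex.exp ((x + T * Complex.I) * t)‖ ≤ Real.exp (σ * t) := by
      have := hx.2
      rw [Complex.norm_exp]
      simp
      gcongr
    rw [norm_mul, mul_assoc]
    refine mul_le_mul h4 (h1.trans ?_) (norm_nonneg _) (Real.exp_pos _).le
    gcongr
  have hhor : ∀ T : ℝ, ‖∫ x in (0 : ℝ)..σ, K (x + T * Complex.I)‖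
      ≤ Real.exp (σ * t) * M * (1 + T ^ 2)⁻¹ * |σ - 0| := fun T =>
    intervalIntegral.norm_integral_le_of_norm_le_const fun x hx =>
      hbound T x (by rwa [uIoc_of_le hσ.le] at hx)
  have hz : Tendsto (fun T : ℝ => Real.exp (σ * t) * M * (1 + T ^ 2)⁻¹ * |σ - 0|) atTop (𝓝 0) := by
    have : Tendsto (fun T : ℝ => (1 + T ^ 2)⁻¹) atTop (𝓝 0) :=
      tendsto_inv_atTop_zero.comp
        (tendsto_atTop_add_const_left _ _ (tendsto_pow_atTop two_ne_zero))
    simpa using (this.const_mul (Real.exp (σ * t) * M)).mul_const |σ - 0|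
  have hz1 : Tendsto (fun T : ℝ => ∫ x in (0 : ℝ)..σ, K (x + T * Complex.I)) atTop (𝓝 0) :=
    squeeze_zero_norm hhor hz
  have hz2 : Tendsto (fun T : ℝ => ∫ x in (0 : ℝ)..σ, K (x + (-T : ℝ) * Complex.I)) atTop (𝓝 0) :=
    squeeze_zero_norm (fun T => by simpa only [neg_sq] using hhor (-T)) hz
  have hI : ∀ x : ℝ, 0 ≤ x → Tendsto (fun T : ℝ => ∫ y in (-T)..T, K (x + y * Complex.I)) atTop
      (𝓝 (∫ y : ℝ, K (x + y * Complex.I))) := fun x hx =>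
    intervalIntegral_tendsto_integral (integrable_vertical_line_exp hc hG hx t)
      tendsto_neg_atTop_atBot tendsto_id
  have hlim := (hI σ hσ.le).sub (hI 0 le_rfl)
  simp_rw [hrect] at hlim
  have h0 := tendsto_nhds_unique hlim ((hz2.sub hz1).const_mul Complex.I)
  rw [sub_self, mul_zero, sub_eq_zero] at h0
  simpa [K] using h0

/-- If the Laplace transform of `h` extends continuously to the closed right half-plane with
quadratic decay, then `h` vanishes at infinity. -/
theorem tendsto_zero_of_laplace_eq {h : ℝ → ℂ} {G : ℂ → ℂ} {σ C R : ℝ} (hσ : 0 < σ)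
    (hcont : ContinuousOn h (Ioi 0))
    (hint : IntegrableOn (fun t : ℝ => h t * Complex.exp (-(σ : ℂ) * t)) (Ioi 0))
    (hc : ContinuousOn G {s | 0 ≤ s.re}) (hd : DifferentiableOn ℂ G {s | 0 < s.re})
    (hG : ∀ s : ℂ, 0 ≤ s.re → R ≤ ‖s‖ → ‖G s‖ ≤ C / ‖s‖ ^ 2)
    (hL : ∀ s : ℂ, s.re = σ → ∫ t in Ioi (0 : ℝ), h t * Complex.exp (-s * t) = G s) :
    Tendsto h atTop (𝓝 0) := by
  obtain ⟨M, hM⟩ := exists_norm_le_inv_one_add_normSq hc hG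
  let f : ℝ → ℂ := (Ioi 0).indicator fun t : ℝ => h t * Complex.exp (-(σ : ℂ) * t)
  have hf : Integrable f := (integrable_indicator_iff measurableSet_Ioi).2 hint
  have hF : 𝓕 f = fun v : ℝ => G (σ + (2 * Real.pi * v : ℝ) * Complex.I) := by
    funext v
    rw [← hL _ (by simp), Real.fourier_eq', ← integral_indicator measurableSet_Ioi]
    refine integral_congr_ae (Eventually.of_forall fun t => ?_)
    by_cases ht : t ∈ Ioi (0 : ℝ)
    · simp only [f, indicator_of_mem ht, smul_eq_mul]
      rw [mul_left_comm, ← Complex.exp_add]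
      congr 2
      simp
      ring
    · simp only [f, indicator_of_notMem ht, smul_zero]
  have hFint : Integrable (𝓕 f) := by
    rw [hF]
    exact (integrable_vertical_line hc hM hσ.le).comp_mul_left' (by positivity)
  let g : ℝ → ℂ := fun v => G ((2 * Real.pi * v : ℝ) * Complex.I)
  have hrep : ∀ t : ℝ, 0 < t → h t = 𝓕 g (-t) := by
    intro t ht
    have hct : ContinuousAt f t := by
      have : ContinuousAt (fun t : ℝ => h t * Complex.exp (-(σ : ℂ) * t)) t :=
        (hcont.continuousAt (Ioi_mem_nhds ht)).mul (by fun_prop)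
      refine this.congr ?_
      filter_upwards [Ioi_mem_nhds ht] with x hx
      simp only [f, indicator_of_mem hx]
    have hinv := hf.fourierInv_fourier_eq hFint hct
    have hft : h t = Complex.exp (σ * t) * f t := by
      simp only [f, indicator_of_mem (mem_Ioi.2 ht)]
      rw [mul_left_comm, ← Complex.exp_add]
      simp
    have hpi : (2 * Real.pi) ≠ 0 := by positivity
    rw [hft, ← hinv, Real.fourierInv_eq', ← integral_const_mul, Real.fourier_eq', hF]
    have h1 := Measure.integral_comp_mul_left
      (fun y : ℝ => Complex.exp ((σ + y * Complex.I) * t) * G (σ + y * Complex.I)) (2 * Real.pi)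
    have h2 := Measure.integral_comp_mul_left
      (fun y : ℝ => Complex.exp (y * Complex.I * t) * G (y * Complex.I)) (2 * Real.pi)
    rw [integral_vertical_line_eq hc hd hM hσ ht.le, ← h2] at h1
    convert! h1 using 1
    · refine integral_congr_ae (Eventually.of_forall fun v => ?_)
      simp only [smul_eq_mul]
      rw [← mul_assoc, ← Complex.exp_add]
      congr 2
      simp
      ring
    · refine integral_congr_ae (Eventually.of_forall fun v => ?_)
      simp only [smul_eq_mul, g]
      congr 2
      simp
      ring
  have hRL : Tendsto (fun t : ℝ => 𝓕 g (-t)) atTop (𝓝 0) :=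
    (Real.zero_at_infty_fourier g).comp
      (tendsto_neg_atTop_atBot.mono_right atBot_le_cocompact)
  refine hRL.congr' ?_
  filter_upwards [eventually_gt_atTop 0] with t ht using (hrep t ht).symm

theorem tendsto_mittagLeffler_sub {α ω A : ℝ} (hα : 1 < α) {c : ℂ}
    (hne : ∀ s : ℂ, 0 < s.re → s ^ (α : ℂ) ≠ c) {G : ℂ → ℂ}
    (hG : ContinuousOn G {s | 0 ≤ s.re})
    (hGH : ∀ s : ℂ, 0 ≤ s.re → s ≠ ω * Complex.I →
      G s = s ^ ((α : ℂ) - 1) / (s ^ (α : ℂ) - c) - A / (s - ω * Complex.I) - (1 - A) / (s + 1)) :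
    Tendsto (fun t : ℝ => mittagLeffler α 1 (c * ((t ^ α : ℝ) : ℂ))
      - A * Complex.exp (ω * Complex.I * t)) atTop (𝓝 0) := by
  have hα0 : 0 < α := by linarith
  have hre : ∀ s : ℂ, 0 < s.re → s ≠ ω * Complex.I := by
    rintro s hs rfl; simp at hs
  have hre' : ∀ s : ℂ, 0 ≤ s.re → s + 1 ≠ 0 := by
    intro s hs h
    have := congrArg Complex.re h
    simp at this; linarith
  -- a growth rate `ρ` of the Mittag-Leffler function and an abscissa `σ` beyond it
  obtain ⟨ρ, hρ, hcρ⟩ := exists_pos_mul_rpow_bound (α := α) (R := ‖c‖ + 1) hα0 (by positivity)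
  have hcρ' : ‖c‖ < ρ ^ α := by
    have : 0 < ρ ^ α := by positivity
    linarith
  let σ := ρ + 1
  have hσ : 0 < σ := by positivity
  have hcσ : ‖c‖ < σ ^ α := hcρ'.trans (Real.rpow_lt_rpow hρ.le (by simp [σ]) hα0)
  have hEcont : Continuous fun t : ℝ => mittagLeffler α 1 (c * ((t ^ α : ℝ) : ℂ)) := by
    have : Continuous fun t : ℝ => t ^ α := Real.continuous_rpow_const hα0.le
    exact (continuous_mittagLeffler hα0).comp (by fun_prop)
  have hEint : ∀ s : ℂ, s.re = σ → IntegrableOn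
      (fun t : ℝ => mittagLeffler α 1 (c * ((t ^ α : ℝ) : ℂ)) * Complex.exp (-s * t)) (Ioi 0) := by
    intro s hs
    refine ((integrableOn_exp_mul_Ioi (a := -1) (by norm_num) 0).const_mul
      (1 - ‖c‖ / ρ ^ α)⁻¹).mono' (Continuous.aestronglyMeasurable (by fun_prop)) ?_
    filter_upwards [ae_restrict_mem measurableSet_Ioi] with t ht
    calc _ ≤ (1 - ‖c‖ / ρ ^ α)⁻¹ * Real.exp (ρ * t) * Real.exp (-(σ * t)) := by
          rw [norm_mul, Complex.norm_exp]
          have h1 := norm_mittagLeffler_le hα0 hρ hcρ' ht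
          have h2 : (-s * t).re = -(σ * t) := by simp [hs]
          rw [h2]
          gcongr
      _ = _ := by
          rw [mul_assoc, ← Real.exp_add]
          congr 2
          ring
  have hexp : ∀ s p : ℂ, p.re ≤ 0 → s.re = σ →
      IntegrableOn (fun t : ℝ => Complex.exp (p * t) * Complex.exp (-s * t)) (Ioi 0) ∧
      ∫ t in Ioi (0 : ℝ), Complex.exp (p * t) * Complex.exp (-s * t) = 1 / (s - p) := by
    intro s p hp hs
    have hlt : (p - s).re < 0 := by simp [hs]; linarith
    have he : ∀ t : ℝ, Complex.exp (p * t) * Complex.exp (-s * t) = Complex.exp ((p - s) * t) := by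
      intro t; rw [← Complex.exp_add]; ring_nf
    simp_rw [he]
    refine ⟨integrableOn_exp_mul_complex_Ioi hlt 0, ?_⟩
    rw [integral_exp_mul_complex_Ioi hlt]
    simp only [Complex.ofReal_zero, mul_zero, Complex.exp_zero]
    rw [← neg_sub s p, neg_div_neg_eq]
  let h : ℝ → ℂ := fun t => mittagLeffler α 1 (c * ((t ^ α : ℝ) : ℂ))
    - A * Complex.exp (ω * Complex.I * t) - (1 - A) * Complex.exp (-1 * t)
  have hsplit : ∀ s : ℂ, ∀ t : ℝ, h t * Complex.exp (-s * t)
      = mittagLeffler α 1 (c * ((t ^ α : ℝ) : ℂ)) * Complex.exp (-s * t)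
        - A * (Complex.exp (ω * Complex.I * t) * Complex.exp (-s * t))
        - (1 - A) * (Complex.exp (-1 * t) * Complex.exp (-s * t)) := by
    intro s t; simp only [h]; ring
  have hmain : Tendsto h atTop (𝓝 0) := by
    refine tendsto_zero_of_laplace_eq (G := G) (σ := σ) (C := 2 * ‖c‖ + |A| * (2 * |ω|) + |1 - A| * 2)
      (R := max (max 1 (2 * ‖c‖)) (max (2 * |ω| + 1) 2)) hσ ?_ ?_ hG ?_ ?_ ?_
    · exact Continuous.continuousOn (by fun_prop)
    · simp_rw [hsplit]
      exact ((hEint σ (by simp)).sub ((hexp σ (ω * Complex.I) (by simp) (by simp)).1.const_mul _)).sub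
        ((hexp σ (-1) (by simp) (by simp)).1.const_mul _)
    · intro s hs
      have hs' : 0 < s.re := hs
      have hslit : s ∈ Complex.slitPlane := Or.inl hs'
      refine DifferentiableWithinAt.congr (f := fun s : ℂ => s ^ ((α : ℂ) - 1) / (s ^ (α : ℂ) - c)
        - A / (s - ω * Complex.I) - (1 - A) / (s + 1)) (DifferentiableAt.differentiableWithinAt ?_)
        (fun z hz => hGH z (le_of_lt hz) (hre z hz)) (hGH s hs'.le (hre s hs'))
      refine ((DifferentiableAt.div ?_ ?_ ?_).sub ?_).sub ?_
      · exact differentiableAt_id.cpow_const hslit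
      · exact (differentiableAt_id.cpow_const hslit).sub_const c
      · exact sub_ne_zero.2 (hne s hs')
      · exact (differentiableAt_const _).div (by fun_prop) (sub_ne_zero.2 (hre s hs'))
      · exact (differentiableAt_const _).div (by fun_prop) (hre' s hs'.le)
    · intro s hs hR
      simp only [max_le_iff] at hR
      obtain ⟨⟨hR1, hR2⟩, hR3, hR4⟩ := hR
      have hs0 : s ≠ 0 := norm_pos_iff.1 (by linarith)
      have hsn : 0 < ‖s‖ := norm_pos_iff.2 hs0
      have hlow : ∀ w p : ℂ, ‖s‖ ≤ ‖w‖ → 2 * ‖p‖ ≤ ‖s‖ → ‖s‖ / 2 ≤ ‖w - p‖ := by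
        intro w p h1 h2
        linarith [norm_sub_norm_le w p]
      have hfrac : ∀ w p : ℂ, ‖s‖ ≤ ‖w‖ → 2 * ‖p‖ ≤ ‖s‖ →
          ‖p / (s * (w - p))‖ ≤ 2 * ‖p‖ / ‖s‖ ^ 2 := by
        intro w p h1 h2
        rw [norm_div, norm_mul, div_le_div_iff₀ (mul_pos hsn (by linarith [hlow w p h1 h2]))
          (by positivity)]
        nlinarith [hlow w p h1 h2, mul_nonneg (norm_nonneg p) hsn.le]
      have hsα : ‖s‖ ≤ ‖s ^ (α : ℂ)‖ := by
        rw [Complex.norm_cpow_real]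
        simpa using Real.rpow_le_rpow_of_exponent_le hR1 hα.le
      have hnz : ∀ w p : ℂ, ‖s‖ ≤ ‖w‖ → 2 * ‖p‖ ≤ ‖s‖ → w - p ≠ 0 := fun w p h1 h2 =>
        norm_pos_iff.1 (by linarith [hlow w p h1 h2])
      have hω2 : 2 * ‖(ω * Complex.I : ℂ)‖ ≤ ‖s‖ := by simp; linarith
      have h12 : 2 * ‖(-1 : ℂ)‖ ≤ ‖s‖ := by simpa using hR4
      have hd1 := hnz _ c hsα hR2
      have hd2 := hnz s _ le_rfl hω2
      have hd3 := hnz s _ le_rfl h12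
      have hdec : G s = c / (s * (s ^ (α : ℂ) - c))
          - A * (ω * Complex.I / (s * (s - ω * Complex.I))) - (1 - A) * (-1 / (s * (s - -1))) := by
        rw [hGH s hs (sub_ne_zero.1 hd2), Complex.cpow_sub _ _ hs0, Complex.cpow_one]
        rw [sub_neg_eq_add] at hd3 ⊢
        field_simp
        ring
      rw [hdec]
      have e1 := hfrac _ c hsα hR2
      have e2 := hfrac s _ le_rfl hω2
      have e3 := hfrac s _ le_rfl h12
      have hA1 : ‖(A : ℂ)‖ = |A| := by simp
      have hA2 : ‖(1 - A : ℂ)‖ = |1 - A| := by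
        rw [← Complex.ofReal_one, ← Complex.ofReal_sub, Complex.norm_real, Real.norm_eq_abs]
      calc _ ≤ ‖c / (s * (s ^ (α : ℂ) - c))‖ + ‖A * (ω * Complex.I / (s * (s - ω * Complex.I)))‖
            + ‖(1 - A) * (-1 / (s * (s - -1)))‖ :=
            (norm_sub_le _ _).trans (add_le_add_left (norm_sub_le _ _) _)
        _ ≤ 2 * ‖c‖ / ‖s‖ ^ 2 + |A| * (2 * ‖(ω * Complex.I : ℂ)‖ / ‖s‖ ^ 2)
            + |1 - A| * (2 * ‖(-1 : ℂ)‖ / ‖s‖ ^ 2) := by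
            rw [norm_mul, norm_mul, hA1, hA2]
            gcongr
        _ = _ := by
            simp
            ring
    · intro s hs
      simp_rw [hsplit]
      obtain ⟨i1, v1⟩ := hexp s (ω * Complex.I) (by simp) hs
      obtain ⟨i2, v2⟩ := hexp s (-1) (by simp) hs
      have i3 : IntegrableOn (fun t : ℝ =>
          mittagLeffler α 1 (c * ((t ^ α : ℝ) : ℂ)) * Complex.exp (-s * t)
          - A * (Complex.exp (ω * Complex.I * t) * Complex.exp (-s * t))) (Ioi 0) :=
        (hEint s hs).sub (i1.const_mul _)
      rw [integral_sub i3 (i2.const_mul _),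
        integral_sub (hEint s hs) (i1.const_mul _), integral_const_mul, integral_const_mul, v1, v2,
        integral_mittagLeffler_mul_cexp_neg hα0 hσ hcσ hs, hGH s (hs ▸ hσ.le) (hre s (hs ▸ hσ))]
      simp [div_eq_mul_inv]
  have hdecay : Tendsto (fun t : ℝ => (1 - A : ℂ) * Complex.exp (-1 * t)) atTop (𝓝 0) := by
    have h1 : Tendsto (fun t : ℝ => Complex.exp (-1 * t)) atTop (𝓝 0) := by
      rw [tendsto_zero_iff_norm_tendsto_zero]
      simpa [Complex.norm_exp] using Real.tendsto_exp_neg_atTop_nhds_zero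
    simpa using h1.const_mul (1 - A : ℂ)
  simpa [h] using hmain.add hdecay

theorem Complex.log_cpow_ofReal {α : ℝ} (hα₁ : 0 < α) (hα₂ : α < 2) {s : ℂ} (hs : 0 ≤ s.re)
    (hs0 : s ≠ 0) :
    |(Complex.log s * α).im| < Real.pi ∧ Complex.log (s ^ (α : ℂ)) = Complex.log s * α := by
  have h1 : |s.arg| ≤ Real.pi / 2 := Complex.abs_arg_le_pi_div_two_iff.2 hs
  have h2 : |(Complex.log s * α).im| < Real.pi := by
    rw [Complex.im_mul_ofReal, Complex.log_im, abs_mul, abs_of_pos hα₁]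
    nlinarith [Real.pi_pos]
  refine ⟨h2, ?_⟩
  rw [Complex.cpow_def_of_ne_zero hs0]
  exact Complex.log_exp (abs_lt.1 h2).1 (abs_lt.1 h2).2.le

theorem cpow_injOn_re_nonneg {α : ℝ} (hα₁ : 0 < α) (hα₂ : α < 2) {s w : ℂ} (hs : 0 ≤ s.re)
    (hw : 0 ≤ w.re) (hw0 : w ≠ 0) (h : s ^ (α : ℂ) = w ^ (α : ℂ)) : s = w := by
  have hα : (α : ℂ) ≠ 0 := by exact_mod_cast hα₁.ne'
  have hs0 : s ≠ 0 := by
    rintro rfl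
    rw [Complex.zero_cpow hα, eq_comm, Complex.cpow_eq_zero_iff] at h
    exact hw0 h.1
  have hlog : Complex.log s * α = Complex.log w * α := by
    rw [← (Complex.log_cpow_ofReal hα₁ hα₂ hs hs0).2, h,
      (Complex.log_cpow_ofReal hα₁ hα₂ hw hw0).2]
  rw [← Complex.exp_log hs0, mul_right_cancel₀ hα hlog, Complex.exp_log hw0]

theorem cpow_ne_neg_ofReal {α : ℝ} (hα₁ : 0 < α) (hα₂ : α < 2) {r : ℝ} (hr : 0 < r) {s : ℂ}
    (hs : 0 ≤ s.re) : s ^ (α : ℂ) ≠ -(r : ℂ) := by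
  intro h
  have hs0 : s ≠ 0 := by
    rintro rfl
    rw [Complex.zero_cpow (by exact_mod_cast hα₁.ne')] at h
    simp [hr.ne'] at h
  obtain ⟨h1, h2⟩ := Complex.log_cpow_ofReal hα₁ hα₂ hs hs0
  rw [← h2, h, Complex.log_im, ← Complex.ofReal_neg, Complex.arg_ofReal_of_neg (by linarith)] at h1
  exact (le_abs_self _).not_gt h1

theorem continuousOn_laplace_mittagLeffler_sub {α ω A : ℝ} (hα : 1 < α) {c : ℂ} {S : Set ℂ}
    (hS : ∀ s ∈ S, 0 ≤ s.re ∧ (A = 0 ∨ s ≠ ω * Complex.I) ∧ s ^ (α : ℂ) ≠ c) :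
    ContinuousOn (fun s : ℂ => s ^ ((α : ℂ) - 1) / (s ^ (α : ℂ) - c) - A / (s - ω * Complex.I)
      - (1 - A) / (s + 1)) S := by
  intro s hs
  obtain ⟨h1, h2, h3⟩ := hS s hs
  have h4 : s + 1 ≠ 0 := by
    intro h
    have := congrArg Complex.re h
    simp at this; linarith
  refine ContinuousAt.continuousWithinAt ?_
  refine ((ContinuousAt.div ?_ ?_ ?_).sub ?_).sub ?_
  · exact Complex.continuousAt_cpow_const_of_re_pos (Or.inl h1) (by simpa using hα)
  · exact (Complex.continuousAt_cpow_const_of_re_pos (Or.inl h1) (by simp; linarith)).sub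
      continuousAt_const
  · exact sub_ne_zero.2 h3
  · rcases h2 with rfl | h2
    · simpa using continuousAt_const
    · exact continuousAt_const.div (by fun_prop) (sub_ne_zero.2 h2)
  · exact continuousAt_const.div (by fun_prop) h4

theorem tendsto_mittagLeffler_neg {α r : ℝ} (hα₁ : 1 < α) (hα₂ : α < 2) (hr : 0 < r) :
    Tendsto (fun t : ℝ => mittagLeffler α 1 (-(r : ℂ) * ((t ^ α : ℝ) : ℂ))) atTop (𝓝 0) := by
  have hne : ∀ s : ℂ, 0 ≤ s.re → s ^ (α : ℂ) ≠ -(r : ℂ) := fun s hs =>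
    cpow_ne_neg_ofReal (by linarith) hα₂ hr hs
  simpa using tendsto_mittagLeffler_sub (ω := 0) (A := 0) hα₁ (fun s hs => hne s hs.le)
    (continuousOn_laplace_mittagLeffler_sub hα₁ fun s hs => ⟨hs, Or.inl rfl, hne s hs⟩)
    fun _ _ _ => rfl

theorem exists_tendsto_laplace_mittagLeffler {α : ℝ} (hα : 0 < α) {a : ℂ}
    (ha : a ∈ Complex.slitPlane) :
    ∃ L : ℂ, Tendsto (fun s : ℂ => s ^ ((α : ℂ) - 1) / (s ^ (α : ℂ) - a ^ (α : ℂ))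
      - (1 / α : ℝ) / (s - a)) (𝓝[≠] a) (𝓝 L) := by
  have hα' : (α : ℂ) ≠ 0 := by exact_mod_cast hα.ne'
  have ha0 : a ≠ 0 := Complex.slitPlane_ne_zero ha
  have hnhds : Complex.slitPlane ∈ 𝓝 a := Complex.isOpen_slitPlane.mem_nhds ha
  let D := dslope (fun s : ℂ => s ^ (α : ℂ)) a
  have hDa : D a = α * a ^ ((α : ℂ) - 1) := by
    have := (hasDerivAt_id a).cpow_const (c := (α : ℂ)) ha
    simpa [D, dslope_same] using this.deriv
  have hap : a ^ ((α : ℂ) - 1) ≠ 0 := by simp [Complex.cpow_eq_zero_iff, ha0]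
  have hDd : DifferentiableAt ℂ D a := by
    refine DifferentiableOn.differentiableAt ((Complex.differentiableOn_dslope hnhds).2 ?_) hnhds
    exact fun z hz => (differentiableAt_id.cpow_const hz).differentiableWithinAt
  let q : ℂ → ℂ := fun s => s ^ ((α : ℂ) - 1) / D s
  have hq : DifferentiableAt ℂ q a :=
    (differentiableAt_id.cpow_const ha).div hDd (by rw [hDa]; exact mul_ne_zero hα' hap)
  refine ⟨deriv q a, (hasDerivAt_iff_tendsto_slope.1 hq.hasDerivAt).congr' ?_⟩
  filter_upwards [self_mem_nhdsWithin] with s hs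
  have hsa : s - a ≠ 0 := sub_ne_zero.2 hs
  have hqa : q a = (1 / α : ℝ) := by
    simp only [q, hDa]
    push_cast
    field_simp
  rw [slope_def_field, hqa]
  simp only [q, D, dslope_of_ne _ hs, slope_def_field]
  rw [sub_div, div_div, div_mul_cancel₀ _ hsa]

theorem tendsto_mittagLeffler_sub_exp {α ω : ℝ} (hα₁ : 1 < α) (hα₂ : α < 2) (hω : 0 < ω) :
    Tendsto (fun t : ℝ => mittagLeffler α 1 ((ω * Complex.I) ^ (α : ℂ) * ((t ^ α : ℝ) : ℂ))
      - (1 / α : ℝ) * Complex.exp (ω * Complex.I * t)) atTop (𝓝 0) := by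
  have hα0 : 0 < α := by linarith
  have ha : (ω * Complex.I : ℂ) ∈ Complex.slitPlane := Or.inr (by simp [hω.ne'])
  have hne : ∀ s : ℂ, 0 ≤ s.re → s ≠ ω * Complex.I → s ^ (α : ℂ) ≠ (ω * Complex.I) ^ (α : ℂ) :=
    fun s hs hsa h => hsa (cpow_injOn_re_nonneg hα0 hα₂ hs (by simp)
      (Complex.slitPlane_ne_zero ha) h)
  obtain ⟨L, hL⟩ := exists_tendsto_laplace_mittagLeffler hα0 ha
  have hreg : ContinuousAt (fun s : ℂ => (1 - (1 / α : ℝ) : ℂ) / (s + 1)) (ω * Complex.I) := by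
    refine continuousAt_const.div (by fun_prop) fun h => ?_
    simpa using congrArg Complex.re h
  have hL' := hL.sub (hreg.tendsto.mono_left nhdsWithin_le_nhds)
  refine tendsto_mittagLeffler_sub hα₁ (fun s hs => hne s hs.le ?_)
    ((continuousOn_update_iff (x := (ω * Complex.I : ℂ))).2
      ⟨continuousOn_laplace_mittagLeffler_sub hα₁ ?_, fun _ => hL'.mono_left ?_⟩)
    fun s _ hsa => Function.update_of_ne hsa _ _
  · rintro rfl; simp at hs
  · exact fun s hs => ⟨hs.1, Or.inr hs.2, hne s hs.1 hs.2⟩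
  · exact nhdsWithin_mono _ fun s hs => hs.2

/-- Scalar principle of limiting amplitude: with mu = i^a w^a, the solution
y(t) = t^a*(lam*E_{a,a+1}(-lam t^a) + mu*E_{a,a+1}(mu t^a))/(lam+mu) of
D^(a) y + lam y = E_a(mu t^a), y(0)=y'(0)=0, satisfies y(t)/E_a(mu t^a) -> 1/(lam+mu). -/
theorem scalar_limiting_amplitude
    (α ω lam : ℝ) (hα₁ : 1 < α) (hα₂ : α < 2) (hω : 0 < ω) (hlam : 0 < lam)
    (μ : ℂ) (hμ : μ = Complex.exp (Real.pi * α / 2 * Complex.I) * ((ω ^ α : ℝ) : ℂ))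
    (y : ℝ → ℂ)
    (hy : ∀ t : ℝ, y t = ((t ^ α : ℝ) : ℂ)
        * ((lam : ℂ) * mittagLeffler α (α + 1) (-(lam : ℂ) * ((t ^ α : ℝ) : ℂ))
           + μ * mittagLeffler α (α + 1) (μ * ((t ^ α : ℝ) : ℂ)))
        / ((lam : ℂ) + μ)) :
    Tendsto (fun t : ℝ => y t / mittagLeffler α 1 (μ * ((t ^ α : ℝ) : ℂ)))
      atTop (nhds (1 / ((lam : ℂ) + μ))) := by
  have hα0 : 0 < α := by linarith
  have hμ' : μ = (ω * Complex.I) ^ (α : ℂ) := by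
    have hω0 : (ω : ℂ) ≠ 0 := by exact_mod_cast hω.ne'
    rw [hμ, Complex.ofReal_cpow hω.le, Complex.cpow_def_of_ne_zero hω0,
      Complex.cpow_def_of_ne_zero (mul_ne_zero hω0 Complex.I_ne_zero),
      Complex.log_ofReal_mul hω Complex.I_ne_zero, Complex.log_I, Complex.ofReal_log hω.le,
      ← Complex.exp_add]
    ring_nf
  have hne : (lam : ℂ) + μ ≠ 0 := by
    intro h
    refine cpow_ne_neg_ofReal hα0 hα₂ hlam (s := ω * Complex.I) (by simp) ?_
    rw [← hμ', eq_neg_of_add_eq_zero_right h]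
  have h1 := tendsto_mittagLeffler_neg hα₁ hα₂ hlam
  have h2 := tendsto_mittagLeffler_sub_exp hα₁ hα₂ hω
  rw [← hμ'] at h2
  have hlow : ∀ᶠ t : ℝ in atTop,
      1 / (2 * α) ≤ ‖mittagLeffler α 1 (μ * ((t ^ α : ℝ) : ℂ))‖ := by
    have h3 := (tendsto_zero_iff_norm_tendsto_zero.1 h2).eventually
      (ge_mem_nhds (show (0 : ℝ) < 1 / (2 * α) by positivity))
    filter_upwards [h3] with t ht
    have h4 : ‖(1 / α : ℝ) * Complex.exp (ω * Complex.I * t)‖ = 1 / α := by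
      rw [norm_mul, Complex.norm_real, Complex.norm_exp, Real.norm_of_nonneg (by positivity)]
      simp
    have h5 := norm_sub_norm_le ((1 / α : ℝ) * Complex.exp (ω * Complex.I * t))
      (mittagLeffler α 1 (μ * ((t ^ α : ℝ) : ℂ)))
    rw [norm_sub_rev, h4] at h5
    have h6 : 1 / α = 1 / (2 * α) + 1 / (2 * α) := by field_simp; norm_num
    linarith
  have hratio : Tendsto (fun t : ℝ => mittagLeffler α 1 (-(lam : ℂ) * ((t ^ α : ℝ) : ℂ))
      / mittagLeffler α 1 (μ * ((t ^ α : ℝ) : ℂ))) atTop (nhds 0) := by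
    refine squeeze_zero_norm' (a := fun t : ℝ =>
      ‖mittagLeffler α 1 (-(lam : ℂ) * ((t ^ α : ℝ) : ℂ))‖ / (1 / (2 * α))) ?_ ?_
    · filter_upwards [hlow] with t ht
      rw [norm_div]
      gcongr
    · simpa using h1.norm.div_const (1 / (2 * α))
  have hlim := (hratio.const_sub 1).div_const ((lam : ℂ) + μ)
  rw [sub_zero] at hlim
  refine hlim.congr' ?_
  filter_upwards [hlow] with t ht
  have hE : mittagLeffler α 1 (μ * ((t ^ α : ℝ) : ℂ)) ≠ 0 :=
    norm_pos_iff.1 (lt_of_lt_of_le (by positivity) ht)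
  have e1 := mul_mittagLeffler_add_one hα0 (-(lam : ℂ) * ((t ^ α : ℝ) : ℂ))
  have e2 := mul_mittagLeffler_add_one hα0 (μ * ((t ^ α : ℝ) : ℂ))
  have hnum : ((t ^ α : ℝ) : ℂ)
      * ((lam : ℂ) * mittagLeffler α (α + 1) (-(lam : ℂ) * ((t ^ α : ℝ) : ℂ))
        + μ * mittagLeffler α (α + 1) (μ * ((t ^ α : ℝ) : ℂ)))
      = mittagLeffler α 1 (μ * ((t ^ α : ℝ) : ℂ))
        - mittagLeffler α 1 (-(lam : ℂ) * ((t ^ α : ℝ) : ℂ)) := by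
    linear_combination e2 - e1
  rw [hy, hnum, one_sub_div hE, div_right_comm]
end

section
/- Let n≥3, 1<α<2, and C,σ>0. Let H: (0,∞)×(0,∞) → ℝ be continuous, continuously differentiable in its second variable, and satisfy for all t>0, r>0: |H(t,r)| ≤ C t^{−α} r^{−n+2} exp(−σ(t^{−α/2}r)^{2/(2−α)}), |∂H(t,r)/∂r| ≤ C t^{−α} r^{−n+1} exp(−σ(t^{−α/2}r)^{2/(2−α)}), and the normalization ∫_{ℝⁿ} H(t,|ξ|) dξ = 1 for all t>0. Let u⁰: ℝⁿ → ℝ be bounded and continuous, and suppose there is a constant c such that for every x₀ ∈ ℝⁿ, (1/|K_R(x₀)|) ∫_{K_R(x₀)} u⁰(y) dy → c as R → ∞. Then for every x ∈ ℝⁿ, ∫_{ℝⁿ} H(t,|x−ξ|) u⁰(ξ) dξ → c as t → ∞. -/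
open MeasureTheory Filter Set

/-- Integrating the fundamental theorem of calculus for a radial profile against `w`: the integral
of `h ‖y‖ * w y` is expressed through the integrals of `w` over balls. -/
theorem integral_radial_mul_eq_neg_integral_deriv_mul {E : Type*} [NormedAddCommGroup E]
    [NormedSpace ℝ E] [FiniteDimensional ℝ E] [Nontrivial E] [MeasurableSpace E] [BorelSpace E]
    (μ : Measure E) [μ.IsAddHaarMeasure] {h h' : ℝ → ℝ} {w : E → ℝ} {K : ℝ}
    (hderiv : ∀ r, 0 < r → HasDerivAt h (h' r) r) (hlim : Tendsto h atTop (nhds 0))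
    (hint : IntegrableOn (fun r => r ^ Module.finrank ℝ E * h' r) (Ioi 0))
    (hw : Measurable w) (hK : ∀ y, |w y| ≤ K) :
    IntegrableOn (fun r => h' r * ∫ y in Metric.closedBall 0 r, w y ∂μ) (Ioi 0) ∧
      ∫ y, h ‖y‖ * w y ∂μ = -∫ r in Ioi 0, h' r * ∫ y in Metric.closedBall 0 r, w y ∂μ := by
  set F : E → ℝ → ℝ := fun y r => h' r * (Metric.closedBall (0 : E) r).indicator w y with hF
  have hmeas' : AEStronglyMeasurable h' (volume.restrict (Ioi 0)) := by
    refine (measurable_deriv h).aestronglyMeasurable.congr ?_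
    filter_upwards [ae_restrict_mem measurableSet_Ioi] with r hr using (hderiv r hr).deriv
  have hmeasF : AEStronglyMeasurable (Function.uncurry F) (μ.prod (volume.restrict (Ioi 0))) := by
    refine hmeas'.comp_snd.mul (Measurable.aestronglyMeasurable ?_)
    have hs : MeasurableSet {p : E × ℝ | ‖p.1‖ ≤ p.2} :=
      measurableSet_le (measurable_norm.comp measurable_fst) measurable_snd
    convert (hw.comp measurable_fst).indicator hs using 1
    ext p
    simp [Set.indicator]
  have hball : ∀ r, IntegrableOn w (Metric.closedBall 0 r) μ := fun r =>
    Measure.integrableOn_of_bounded (M := K) (measure_closedBall_lt_top.ne)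
      hw.aestronglyMeasurable (ae_of_all _ hK)
  have hFr : ∀ r, Integrable (fun y => F y r) μ := fun r =>
    ((integrable_indicator_iff Metric.isClosed_closedBall.measurableSet).2 (hball r)).const_mul _
  have hFint : Integrable (Function.uncurry F) (μ.prod (volume.restrict (Ioi 0))) := by
    refine (integrable_prod_iff' hmeasF).2 ⟨ae_of_all _ hFr, ?_⟩
    refine Integrable.mono' (hint.norm.const_mul (K * μ.real (Metric.ball 0 1)))
      hmeasF.norm.prod_swap.integral_prod_right' ?_
    filter_upwards [ae_restrict_mem measurableSet_Ioi] with r hr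
    have hr : 0 < r := hr
    have h1 : ∫ y, ‖F y r‖ ∂μ = |h' r| * ∫ y in Metric.closedBall 0 r, |w y| ∂μ := by
      rw [← integral_indicator Metric.isClosed_closedBall.measurableSet, ← integral_const_mul]
      congr 1
      ext y
      simp only [hF, norm_mul, Real.norm_eq_abs]
      by_cases hy : y ∈ Metric.closedBall (0 : E) r <;> simp only [hy, indicator_of_mem,
        indicator_of_notMem, not_false_eq_true, abs_zero]
    have h2 : ∫ y in Metric.closedBall 0 r, |w y| ∂μ ≤ K * μ.real (Metric.closedBall 0 r) := by
      refine (le_abs_self _).trans ?_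
      refine norm_setIntegral_le_of_norm_le_const (μ := μ) (f := fun y => |w y|)
        measure_closedBall_lt_top fun y _ => ?_
      simpa using hK y
    change ‖∫ y, ‖F y r‖ ∂μ‖ ≤ _
    rw [Real.norm_of_nonneg (integral_nonneg fun _ => norm_nonneg _), h1]
    rw [Measure.addHaar_real_closedBall _ _ hr.le] at h2
    calc _ ≤ |h' r| * _ := mul_le_mul_of_nonneg_left h2 (abs_nonneg _)
      _ = _ := by
        rw [norm_mul, Real.norm_eq_abs, Real.norm_eq_abs, abs_of_nonneg (pow_nonneg hr.le _)]
        ring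
  have hinner : ∀ r, ∫ y, F y r ∂μ = h' r * ∫ y in Metric.closedBall 0 r, w y ∂μ := fun r => by
    simp only [hF]
    rw [integral_const_mul, integral_indicator Metric.isClosed_closedBall.measurableSet]
  have houter : ∀ y, y ≠ 0 → ∫ r in Ioi 0, F y r = -(h ‖y‖ * w y) := fun y hy => by
    have hy0 : 0 < ‖y‖ := norm_pos_iff.2 hy
    have hsub : Ioi ‖y‖ ⊆ Ioi (0 : ℝ) := Ioi_subset_Ioi hy0.le
    have hi : IntegrableOn h' (Ioi ‖y‖) := by
      refine Integrable.mono' ((hint.mono_set hsub).norm.const_mul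
        (‖y‖ ^ Module.finrank ℝ E)⁻¹) (hmeas'.mono_set hsub) ?_
      filter_upwards [ae_restrict_mem measurableSet_Ioi] with r hr
      have hr : ‖y‖ < r := hr
      have hp : 0 < ‖y‖ ^ Module.finrank ℝ E := pow_pos hy0 _
      rw [norm_mul, norm_pow, Real.norm_eq_abs r, abs_of_pos (hy0.trans hr), ← mul_assoc]
      refine le_mul_of_one_le_left (norm_nonneg _) ?_
      rw [inv_mul_eq_div, one_le_div hp]
      exact pow_le_pow_left₀ hy0.le hr.le _
    have h3 := integral_Ioi_of_hasDerivAt_of_tendsto (hderiv _ hy0).continuousAt.continuousWithinAt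
      (fun r (hr : ‖y‖ < r) => hderiv r (hy0.trans hr)) hi hlim
    have h4 : F y = (Ici ‖y‖).indicator fun r => h' r * w y := by
      ext r
      simp [hF, Set.indicator]
    rw [h4, setIntegral_indicator measurableSet_Ici,
      inter_eq_self_of_subset_right (Ici_subset_Ioi.2 hy0),
      integral_Ici_eq_integral_Ioi, integral_mul_const, h3]
    ring
  refine ⟨?_, ?_⟩
  · have := hFint.integral_prod_right
    simpa only [IntegrableOn, Function.uncurry, hinner] using this
  · have hswap := integral_integral_swap hFint
    simp only [hinner] at hswap
    rw [← hswap, ← integral_neg]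
    refine integral_congr_ae ?_
    filter_upwards [compl_mem_ae_iff.2 (measure_singleton (μ := μ) (0 : E))] with y hy
    rw [houter y hy, neg_neg]

/-- Sufficiency half of the pointwise stabilization theorem: if the radial kernel `H`
satisfies the fundamental-solution estimates and the normalization
`∫ H(t,|ξ|) dξ = 1`, and the averages of the bounded continuous initial datum `u⁰` over
balls of radius `R` around every point converge to `c` as `R → ∞`, then
`∫ H(t,|x-ξ|) u⁰(ξ) dξ → c` as `t → ∞`, for every `x`. -/
theorem stabilization_sufficiency
    (n : ℕ) (hn : 3 ≤ n) (α C σ : ℝ) (hα₁ : 1 < α) (hα₂ : α < 2) (hC : 0 < C) (hσ : 0 < σ)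
    (H H' : ℝ → ℝ → ℝ)
    (hHcont : ContinuousOn (fun p : ℝ × ℝ => H p.1 p.2) (Ioi 0 ×ˢ Ioi 0))
    (hHderiv : ∀ t : ℝ, 0 < t → ∀ r : ℝ, 0 < r → HasDerivAt (H t) (H' t r) r)
    (hHbd : ∀ t : ℝ, 0 < t → ∀ r : ℝ, 0 < r →
      |H t r| ≤ C * t ^ (-α) * r ^ ((2 : ℝ) - n)
        * Real.exp (-σ * (t ^ (-α / 2) * r) ^ (2 / (2 - α))))
    (hH'bd : ∀ t : ℝ, 0 < t → ∀ r : ℝ, 0 < r →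
      |H' t r| ≤ C * t ^ (-α) * r ^ ((1 : ℝ) - n)
        * Real.exp (-σ * (t ^ (-α / 2) * r) ^ (2 / (2 - α))))
    (hHnorm : ∀ t : ℝ, 0 < t → ∫ ξ : EuclideanSpace ℝ (Fin n), H t ‖ξ‖ = 1)
    (u0 : EuclideanSpace ℝ (Fin n) → ℝ) (hu0cont : Continuous u0)
    (M : ℝ) (hu0bd : ∀ y, |u0 y| ≤ M)
    (c : ℝ)
    (hmean : ∀ x₀ : EuclideanSpace ℝ (Fin n),
      Tendsto (fun R : ℝ => (∫ y in Metric.closedBall x₀ R, u0 y)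
        / (volume (Metric.closedBall x₀ R)).toReal) atTop (nhds c)) :
    ∀ x : EuclideanSpace ℝ (Fin n),
      Tendsto (fun t : ℝ => ∫ ξ, H t ‖x - ξ‖ * u0 ξ) atTop (nhds c) := by
  intro x
  have : Nontrivial (EuclideanSpace ℝ (Fin n)) := by
    have : Nonempty (Fin n) := ⟨⟨0, by omega⟩⟩
    infer_instance
  have hn0 : (0 : ℝ) < n - 2 := by
    have : (3 : ℝ) ≤ n := by exact_mod_cast hn
    linarith
  have hp : 1 ≤ 2 / (2 - α) := by rw [le_div_iff₀ (by linarith)]; linarith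
  set p : ℝ := 2 / (2 - α)
  set w : EuclideanSpace ℝ (Fin n) → ℝ := fun ξ => u0 (x - ξ) - c with hwdef
  have hwcont : Continuous w := by fun_prop
  set K : ℝ := M + |c|
  have hwK : ∀ y, |w y| ≤ K := fun y => (abs_sub _ _).trans (add_le_add_left (hu0bd _) _)
  have hK : 0 ≤ K := (abs_nonneg _).trans (hwK 0)
  set A : ℝ → ℝ := fun r => ∫ y in Metric.closedBall 0 r, w y with hA
  set V : ℝ := volume.real (Metric.ball (0 : EuclideanSpace ℝ (Fin n)) 1)
  have hV : 0 < V := ENNReal.toReal_pos (Metric.measure_ball_pos _ _ one_pos).ne'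
    measure_ball_lt_top.ne
  have hvol : ∀ (z : EuclideanSpace ℝ (Fin n)) {r : ℝ}, 0 ≤ r →
      volume.real (Metric.closedBall z r) = r ^ n * V := fun z r hr => by
    rw [Measure.addHaar_real_closedBall _ _ hr, finrank_euclideanSpace_fin]
  have hAK : ∀ r, 0 < r → |A r / (r ^ n * V)| ≤ K := fun r hr => by
    rw [abs_div, abs_of_pos (a := r ^ n * V) (by positivity), div_le_iff₀ (by positivity),
      ← hvol 0 hr.le]
    exact norm_setIntegral_le_of_norm_le_const (μ := volume) (f := w)
      measure_closedBall_lt_top fun y _ => hwK y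
  have hAlim : Tendsto (fun r => A r / (r ^ n * V)) atTop (nhds 0) := by
    have h1 := (hmean x).sub_const c
    rw [sub_self] at h1
    refine h1.congr' ?_
    filter_upwards [eventually_gt_atTop 0] with r hr
    have h2 : ∫ y in Metric.closedBall 0 r, u0 (x - y) = ∫ y in Metric.closedBall x r, u0 y := by
      have h3 := (Measure.measurePreserving_sub_left volume x).setIntegral_preimage_emb
        (MeasurableEquiv.subLeft x).measurableEmbedding u0 (Metric.closedBall x r)
      rw [← h3]
      congr 2
      ext y
      simp [dist_eq_norm]
    have h4 : IntegrableOn (fun y => u0 (x - y)) (Metric.closedBall 0 r) volume :=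
      (hu0cont.comp (continuous_const.sub continuous_id)).continuousOn.integrableOn_compact
        (isCompact_closedBall _ _)
    have h5 : A r = (∫ y in Metric.closedBall x r, u0 y) - r ^ n * V * c := by
      simp only [hA, hwdef]
      rw [integral_sub h4 (integrable_const_iff.2 (Or.inr ⟨by
        simpa using measure_closedBall_lt_top⟩)), h2, setIntegral_const, hvol 0 hr.le, smul_eq_mul]
    rw [h5, ← measureReal_def, hvol x hr.le]
    field_simp
  have hexp : ∀ b : ℝ, 0 < b → IntegrableOn (fun r : ℝ => r * Real.exp (-b * r ^ p)) (Ioi 0) :=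
    fun b hb => by
      simpa using integrableOn_rpow_mul_exp_neg_mul_rpow (s := 1) (by norm_num)
        (one_pos.trans_le hp) hb
  have hHlim : ∀ t, 0 < t → Tendsto (H t) atTop (nhds 0) := fun t ht => by
    have h1 : Tendsto (fun r : ℝ => C * t ^ (-α) * r ^ (-((n : ℝ) - 2))) atTop (nhds 0) := by
      simpa using (tendsto_rpow_neg_atTop hn0).const_mul (C * t ^ (-α))
    refine squeeze_zero_norm' ?_ h1
    filter_upwards [eventually_gt_atTop 0] with r hr
    refine (hHbd t ht r hr).trans ?_
    rw [neg_sub]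
    refine mul_le_of_le_one_right (by positivity) (Real.exp_le_one_iff.2 ?_)
    have : 0 ≤ (t ^ (-α / 2) * r) ^ p := by positivity
    nlinarith
  have hpow : ∀ r : ℝ, 0 < r → r ^ n * r ^ ((1 : ℝ) - n) = r := fun r hr => by
    rw [← Real.rpow_natCast, ← Real.rpow_add hr]
    simp
  have hH'int : ∀ t, 0 < t → IntegrableOn (fun r => r ^ n * H' t r) (Ioi 0) := fun t ht => by
    have hb : 0 < σ * (t ^ (-α / 2)) ^ p := by positivity
    refine Integrable.mono' ((hexp _ hb).const_mul (C * t ^ (-α))) ?_ ?_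
    · refine ((measurable_id.pow_const n).mul
        (measurable_deriv (H t))).aestronglyMeasurable.congr ?_
      filter_upwards [ae_restrict_mem measurableSet_Ioi] with r hr
      simp [(hHderiv t ht r hr).deriv]
    · filter_upwards [ae_restrict_mem measurableSet_Ioi] with r hr
      have hr : 0 < r := hr
      rw [norm_mul, Real.norm_of_nonneg (by positivity)]
      refine (mul_le_mul_of_nonneg_left (hH'bd t ht r hr) (by positivity)).trans_eq ?_
      rw [Real.mul_rpow (by positivity) hr.le, ← mul_assoc (-σ), neg_mul]
      linear_combination C * t ^ (-α) *
        Real.exp (-(σ * (t ^ (-α / 2)) ^ p) * r ^ p) * hpow r hr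
  have hkey := fun t (ht : 0 < t) => integral_radial_mul_eq_neg_integral_deriv_mul
    (volume : Measure (EuclideanSpace ℝ (Fin n))) (hHderiv t ht) (hHlim t ht)
    (by simpa using hH'int t ht) hwcont.measurable hwK
  set F : ℝ → ℝ → ℝ := fun t s =>
    t ^ (α / 2) * (H' t (t ^ (α / 2) * s) * A (t ^ (α / 2) * s)) with hF
  have hFbd : ∀ t, 0 < t → ∀ s, 0 < s → |F t s| ≤ C * V * (s * Real.exp (-σ * s ^ p)) *
      |A (t ^ (α / 2) * s) / ((t ^ (α / 2) * s) ^ n * V)| := fun t ht s hs => by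
    set τ := t ^ (α / 2) with hτ
    have hτ0 : 0 < τ := by positivity
    have h1 : t ^ (-α / 2) * (τ * s) = s := by
      rw [← mul_assoc, hτ, ← Real.rpow_add ht]
      ring_nf
      simp
    have h2 : t ^ (-α) * τ ^ 2 = 1 := by
      rw [hτ, ← Real.rpow_natCast, ← Real.rpow_mul ht.le, ← Real.rpow_add ht]
      ring_nf
      simp
    have h3 := hH'bd t ht (τ * s) (by positivity)
    rw [h1] at h3
    have h4 : |A (τ * s)| = (τ * s) ^ n * V * |A (τ * s) / ((τ * s) ^ n * V)| := by
      rw [abs_div, abs_of_pos (a := (τ * s) ^ n * V) (by positivity)]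
      field_simp
    have h5 := hpow (τ * s) (by positivity)
    simp only [hF]
    rw [← hτ, abs_mul, abs_mul, abs_of_pos hτ0, h4]
    set m := |A (τ * s) / ((τ * s) ^ n * V)|
    calc _ ≤ τ * (C * t ^ (-α) * (τ * s) ^ ((1 : ℝ) - n) * Real.exp (-σ * s ^ p) *
          ((τ * s) ^ n * V * m)) := by gcongr
      _ = τ * C * t ^ (-α) * Real.exp (-σ * s ^ p) * V * m *
          ((τ * s) ^ n * (τ * s) ^ ((1 : ℝ) - n)) := by ring
      _ = _ := by
        rw [h5]
        linear_combination C * V * s * Real.exp (-σ * s ^ p) * m * h2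
  have hFlim : Tendsto (fun t => ∫ s in Ioi 0, F t s) atTop (nhds (∫ _ in Ioi (0 : ℝ), (0 : ℝ))) := by
    refine tendsto_integral_filter_of_dominated_convergence
      (fun s => C * V * (s * Real.exp (-σ * s ^ p)) * K) ?_ ?_
      (((hexp σ hσ).const_mul _).mul_const _) ?_
    · filter_upwards [eventually_gt_atTop 0] with t ht
      have h1 := (integrableOn_Ioi_comp_mul_left_iff (fun r => H' t r * A r) 0
        (Real.rpow_pos_of_pos ht (α / 2))).2 (by simpa using (hkey t ht).1)
      exact (h1.const_mul _).aestronglyMeasurable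
    · filter_upwards [eventually_gt_atTop 0] with t ht
      filter_upwards [ae_restrict_mem measurableSet_Ioi] with s hs
      have hs : 0 < s := hs
      refine (hFbd t ht s hs).trans ?_
      gcongr
      exact hAK _ (by positivity)
    · filter_upwards [ae_restrict_mem measurableSet_Ioi] with s hs
      have hs : 0 < s := hs
      have h1 : Tendsto (fun t : ℝ => t ^ (α / 2) * s) atTop atTop :=
        (tendsto_rpow_atTop (by linarith)).atTop_mul_const hs
      have h2 := ((hAlim.comp h1).abs).const_mul (C * V * (s * Real.exp (-σ * s ^ p)))
      rw [abs_zero, mul_zero] at h2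
      refine squeeze_zero_norm' ?_ h2
      filter_upwards [eventually_gt_atTop 0] with t ht using hFbd t ht s hs
  rw [integral_zero] at hFlim
  have hfin := hFlim.neg.add_const c
  rw [neg_zero, zero_add] at hfin
  refine hfin.congr' ?_
  filter_upwards [eventually_gt_atTop 0] with t ht
  have hτ : 0 < t ^ (α / 2) := by positivity
  have h1 : ∫ s in Ioi 0, F t s = ∫ r in Ioi 0, H' t r * A r := by
    simp only [hF]
    rw [integral_const_mul, integral_comp_mul_left_Ioi (fun r => H' t r * A r) 0 hτ, mul_zero,
      smul_eq_mul, mul_inv_cancel_left₀ hτ.ne']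
  have hHint : Integrable fun ξ : EuclideanSpace ℝ (Fin n) => H t ‖ξ‖ :=
    Integrable.of_integral_ne_zero (by rw [hHnorm t ht]; exact one_ne_zero)
  have h2 : ∫ ξ, H t ‖x - ξ‖ * u0 ξ = ∫ ξ, H t ‖ξ‖ * u0 (x - ξ) := by
    rw [← integral_sub_left_eq_self (fun ξ => H t ‖x - ξ‖ * u0 ξ) volume x]
    simp
  rw [h1, ← (hkey t ht).2, h2]
  have h3 : ∫ ξ, H t ‖ξ‖ * u0 (x - ξ) = ∫ ξ, (H t ‖ξ‖ * w ξ + H t ‖ξ‖ * c) := by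
    congr 1
    ext ξ
    simp only [hwdef]
    ring
  rw [h3, integral_add (hHint.mul_bdd hwcont.aestronglyMeasurable (ae_of_all _ hwK))
    (hHint.mul_const c), integral_mul_const, hHnorm t ht, one_mul]
end
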